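/- Let M be a weight sequence satisfying (M.2) and (M.2)*. Let E be a Banach space and π : ℝ^d → GL(E) a group homomorphism into the invertible bounded operators on E such that (x,e) ↦ π(x)e is continuous and ‖π(x)e‖_E ≤ C e^{κ|x|}‖e‖_E for some C, κ > 0 and all x ∈ ℝ^d, e ∈ E. Then Π(𝒦^{(M)}(ℝ^d))E = Π(𝒦^{(M)}(ℝ^d))E^{(M)} = E^{(M)}; explicitly: (a) for every f ∈ 𝒦^{(M)}(ℝ^d) and every e ∈ E one has Π(f)e ∈ E^{(M)}; (b) for every e ∈ E^{(M)} there exist ψ ∈ 𝒦^{(M)}(ℝ^d) and v ∈ E^{(M)} with e = Π(ψ)v. Moreover, for every set B̃ ⊆ E^{(M)} that is bounded in E^{(M)} (i.e., for every h > 0, sup_{e∈B̃} sup_α h^{|α|}‖e_α‖_E/M_α < ∞) there exist ψ ∈ 𝒦^{(M)}(ℝ^d) and a bounded set Ã ⊆ E^{(M)} with Π(ψ)Ã = B̃. -/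

import Mathlib

open Filter MeasureTheory
open scoped BigOperators

noncomputable section

abbrev Rd (d : ℕ) := EuclideanSpace ℝ (Fin d)

/-- Partial derivative in the `j`-th coordinate direction. -/
def dop {d : ℕ} {E : Type*} [NormedAddCommGroup E] [NormedSpace ℝ E]
    (j : Fin d) (f : Rd d → E) : Rd d → E :=
  fun x => fderiv ℝ f x (EuclideanSpace.single j (1:ℝ))

/-- Iterated partial derivative `∂^α` for a multi-index `α : Fin d → ℕ`. -/
def pD {d : ℕ} {E : Type*} [NormedAddCommGroup E] [NormedSpace ℝ E]
    (α : Fin d → ℕ) (f : Rd d → E) : Rd d → E :=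
  (List.finRange d).foldr (fun j g => (dop j)^[α j] g) f

/-- Length `|α|` of a multi-index. -/
def msize {d : ℕ} (α : Fin d → ℕ) : ℕ := ∑ j, α j

/-- `M` is a weight sequence: positive, normalized, `M_p^{1/p} → ∞`, log-convex. -/
def IsWeightSeq (M : ℕ → ℝ) : Prop :=
  (∀ p, 0 < M p) ∧ M 0 = 1 ∧ M 1 = 1 ∧
  Tendsto (fun p : ℕ => (M p) ^ ((p : ℝ)⁻¹)) atTop atTop ∧
  ∀ p : ℕ, 1 ≤ p → (M p)^2 ≤ M (p-1) * M (p+1)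

/-- Condition (M.2) with explicit constants `C₀, H ≥ 1`. -/
def HasM2 (M : ℕ → ℝ) (C₀ H : ℝ) : Prop :=
  1 ≤ C₀ ∧ 1 ≤ H ∧ ∀ p q : ℕ, M (p+q) ≤ C₀ * H^(p+q) * M p * M q

/-- Condition (M.2). -/
def M2 (M : ℕ → ℝ) : Prop := ∃ C₀ H, HasM2 M C₀ H

/-- Condition (M.2)*: `2 m_p ≤ m_{Np}` for `p ≥ p₀`. -/
def M2star (M : ℕ → ℝ) : Prop :=
  ∃ p₀ N : ℕ, 0 < p₀ ∧ 0 < N ∧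
    ∀ p, p₀ ≤ p → 2 * (M p / M (p-1)) ≤ M (N*p) / M (N*p - 1)

/-- Associated function `ν_M(t) = sup_p log(t^p / M_p)`. -/
def nuA (M : ℕ → ℝ) (t : ℝ) : ℝ := ⨆ p : ℕ, Real.log (t ^ p / M p)

/-- `φ ∈ 𝒦^{(M)}(ℝ^d)` (Beurling type). -/
def KBeu (d : ℕ) (M : ℕ → ℝ) (φ : Rd d → ℂ) : Prop :=
  ContDiff ℝ (⊤ : ℕ∞) φ ∧ ∀ k : ℝ, 0 < k → ∀ n : ℕ, ∃ C : ℝ,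
    ∀ (α : Fin d → ℕ) (x : Rd d),
      k ^ msize α * ‖pD α φ x‖ * Real.exp ((n : ℝ) * ‖x‖) ≤ C * M (msize α)

/-- `φ ∈ 𝒦^{{M}}(ℝ^d)` (Roumieu type). -/
def KRou (d : ℕ) (M : ℕ → ℝ) (φ : Rd d → ℂ) : Prop :=
  ContDiff ℝ (⊤ : ℕ∞) φ ∧ ∃ k : ℝ, 0 < k ∧ ∀ n : ℕ, ∃ C : ℝ,
    ∀ (α : Fin d → ℕ) (x : Rd d),
      k ^ msize α * ‖pD α φ x‖ * Real.exp ((n : ℝ) * ‖x‖) ≤ C * M (msize α)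

/-- Orbit map `γ_e(x) = π(x)e` of a representation of `(ℝ^d,+)`. -/
def orbit {d : ℕ} {E : Type*} [NormedAddCommGroup E] [NormedSpace ℂ E]
    (π : Rd d → E →L[ℂ] E) (e : E) : Rd d → E := fun x => π x e

/-- The action `Π(f)e = ∫_{ℝ^d} f(x) π(x)e dx` (Bochner integral). -/
def PiOp {d : ℕ} {E : Type*} [NormedAddCommGroup E] [NormedSpace ℂ E] [CompleteSpace E]
    (π : Rd d → E →L[ℂ] E) (f : Rd d → ℂ) (e : E) : E :=
  ∫ x : Rd d, f x • (π x e)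

/-- `e ∈ E^{(M)}`: Beurling ultradifferentiable vector of a Banach representation. -/
def UVBeu (d : ℕ) (M : ℕ → ℝ) {E : Type*} [NormedAddCommGroup E] [NormedSpace ℂ E]
    (π : Rd d → E →L[ℂ] E) (e : E) : Prop :=
  ContDiff ℝ (⊤ : ℕ∞) (orbit π e) ∧ ∀ k : ℝ, 0 < k → ∃ C : ℝ,
    ∀ α : Fin d → ℕ, k ^ msize α * ‖pD α (orbit π e) 0‖ ≤ C * M (msize α)

/-- Bounded subset of `E^{(M)}`. -/
def UVBeuBdd (d : ℕ) (M : ℕ → ℝ) {E : Type*} [NormedAddCommGroup E] [NormedSpace ℂ E]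
    (π : Rd d → E →L[ℂ] E) (B : Set E) : Prop :=
  (∀ e ∈ B, UVBeu d M π e) ∧ ∀ k : ℝ, 0 < k → ∃ C : ℝ,
    ∀ e ∈ B, ∀ α : Fin d → ℕ, k ^ msize α * ‖pD α (orbit π e) 0‖ ≤ C * M (msize α)

/-! ### Weight sequences -/

section WeightSequences

variable {M : ℕ → ℝ}

/-- The quotients `m_p = M_p / M_{p-1}`. -/
def quot (M : ℕ → ℝ) (p : ℕ) : ℝ := M p / M (p - 1)

lemma quot_pos (hM : IsWeightSeq M) (p : ℕ) : 0 < quot M p := div_pos (hM.1 _) (hM.1 _)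

lemma quot_one (hM : IsWeightSeq M) : quot M 1 = 1 := by
  simp [quot, hM.2.1, hM.2.2.1]

lemma weight_succ (hM : IsWeightSeq M) (p : ℕ) : M (p + 1) = quot M (p + 1) * M p := by
  have := (hM.1 p).ne'
  simp only [quot, Nat.add_sub_cancel]
  field_simp

lemma quot_mono_succ (hM : IsWeightSeq M) (p : ℕ) : quot M (p + 1) ≤ quot M (p + 2) := by
  have h := hM.2.2.2.2 (p + 1) (by omega)
  simp only [Nat.add_sub_cancel] at h
  simp only [quot, Nat.add_sub_cancel, show p + 2 - 1 = p + 1 by omega]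
  rw [div_le_div_iff₀ (hM.1 _) (hM.1 _)]
  nlinarith [h]

lemma quot_mono (hM : IsWeightSeq M) {p q : ℕ} (hp : 1 ≤ p) (hpq : p ≤ q) :
    quot M p ≤ quot M q := by
  induction q, hpq using Nat.le_induction with
  | base => exact le_rfl
  | succ q hq ih =>
    obtain ⟨r, rfl⟩ : ∃ r, q = r + 1 := ⟨q - 1, by omega⟩
    exact ih.trans (quot_mono_succ hM r)

lemma weight_le_quot_pow (hM : IsWeightSeq M) (p : ℕ) : M p ≤ quot M p ^ p := by
  induction p with
  | zero => simp [hM.2.1]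
  | succ p ih =>
    rw [weight_succ hM, pow_succ']
    refine mul_le_mul_of_nonneg_left (ih.trans ?_) (quot_pos hM _).le
    rcases Nat.eq_zero_or_pos p with rfl | hp
    · simp
    · exact pow_le_pow_left₀ (quot_pos hM _).le (quot_mono hM hp (by omega)) _

lemma weight_mul_quot_pow_le (hM : IsWeightSeq M) (p q : ℕ) :
    M p * quot M (p + 1) ^ q ≤ M (p + q) := by
  induction q with
  | zero => simp
  | succ q ih =>
    rw [← add_assoc, weight_succ hM, pow_succ]
    have h1 := quot_mono hM (show 1 ≤ p + 1 by omega) (show p + 1 ≤ p + q + 1 by omega)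
    calc M p * (quot M (p + 1) ^ q * quot M (p + 1))
        = (quot M (p + 1)) * (M p * quot M (p + 1) ^ q) := by ring
      _ ≤ quot M (p + q + 1) * M (p + q) :=
        mul_le_mul h1 ih (mul_nonneg (hM.1 _).le (pow_nonneg (quot_pos hM _).le _))
          (quot_pos hM _).le

lemma weight_le_mul_quot_pow (hM : IsWeightSeq M) (p q : ℕ) :
    M (p + q) ≤ M p * quot M (p + q) ^ q := by
  induction q with
  | zero => simp
  | succ q ih =>
    rw [← add_assoc, weight_succ hM, pow_succ]
    have h2 : M (p + q) ≤ M p * quot M (p + q + 1) ^ q := by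
      rcases Nat.eq_zero_or_pos (p + q) with h | h
      · obtain ⟨rfl, rfl⟩ : p = 0 ∧ q = 0 := by omega
        simp
      · exact ih.trans (mul_le_mul_of_nonneg_left (pow_le_pow_left₀ (quot_pos hM _).le
          (quot_mono hM h (by omega)) _) (hM.1 _).le)
    calc quot M (p + q + 1) * M (p + q)
        ≤ quot M (p + q + 1) * (M p * quot M (p + q + 1) ^ q) :=
          mul_le_mul_of_nonneg_left h2 (quot_pos hM _).le
      _ = _ := by ring

lemma weight_mul_le (hM : IsWeightSeq M) (p q : ℕ) : M p * M q ≤ M (p + q) := by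
  induction q with
  | zero => simp [hM.2.1]
  | succ q ih =>
    rw [← add_assoc, weight_succ hM (p + q), weight_succ hM q]
    have h1 := quot_mono hM (show 1 ≤ q + 1 by omega) (show q + 1 ≤ p + q + 1 by omega)
    calc M p * (quot M (q + 1) * M q) = quot M (q + 1) * (M p * M q) := by ring
      _ ≤ _ := mul_le_mul h1 ih (mul_nonneg (hM.1 _).le (hM.1 _).le) (quot_pos hM _).le

lemma weight_prod_le (hM : IsWeightSeq M) {ι : Type*} (s : Finset ι) (f : ι → ℕ) :
    ∏ i ∈ s, M (f i) ≤ M (∑ i ∈ s, f i) := by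
  classical
  induction s using Finset.induction_on with
  | empty => simp [hM.2.1]
  | insert a s ha ih =>
    rw [Finset.prod_insert ha, Finset.sum_insert ha]
    exact (mul_le_mul_of_nonneg_left ih (hM.1 _).le).trans (weight_mul_le hM _ _)

lemma quot_unbounded (hM : IsWeightSeq M) (t : ℝ) : ∃ p, t < quot M (p + 1) := by
  by_contra! h
  have ht : 0 < t := (quot_pos hM 1).trans_le (h 0)
  have hb : ∀ p : ℕ, 1 ≤ p → M p ^ ((p : ℝ)⁻¹) ≤ t := by
    intro p hp
    obtain ⟨r, rfl⟩ : ∃ r, p = r + 1 := ⟨p - 1, by omega⟩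
    have h1 := (weight_le_quot_pow hM (r + 1)).trans
      (pow_le_pow_left₀ (quot_pos hM _).le (h r) _)
    calc M (r + 1) ^ (((r + 1 : ℕ) : ℝ)⁻¹) ≤ (t ^ (r + 1)) ^ (((r + 1 : ℕ) : ℝ)⁻¹) :=
          Real.rpow_le_rpow (hM.1 _).le h1 (by positivity)
      _ = t := Real.pow_rpow_inv_natCast ht.le (by omega)
  obtain ⟨p, hp1, hp2⟩ := ((hM.2.2.2.1.eventually_gt_atTop t).and (eventually_ge_atTop 1)).exists
  exact absurd (hb p hp2) (not_le.mpr hp1)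

lemma exists_count (hM : IsWeightSeq M) {t : ℝ} (ht : 1 ≤ t) :
    ∃ p, 1 ≤ p ∧ quot M p ≤ t ∧ t < quot M (p + 1) := by
  classical
  have h := quot_unbounded hM t
  refine ⟨Nat.find h, ?_, ?_, Nat.find_spec h⟩
  · rw [Nat.one_le_iff_ne_zero]
    intro h0
    have := Nat.find_spec h
    rw [h0, zero_add, quot_one hM] at this
    linarith
  · rcases Nat.eq_zero_or_pos (Nat.find h) with h0 | h0
    · have := Nat.find_spec h
      rw [h0, zero_add, quot_one hM] at this
      linarith
    · have := Nat.find_min h (m := Nat.find h - 1) (by omega)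
      rw [Nat.sub_add_cancel h0] at this
      exact not_lt.mp this

open Classical in
/-- The counting function of the quotients: `m_p ≤ t < m_{p+1}` for `p = count M t`, `t ≥ 1`. -/
def count (M : ℕ → ℝ) (t : ℝ) : ℕ :=
  if h : ∃ p, 1 ≤ p ∧ quot M p ≤ t ∧ t < quot M (p + 1) then h.choose else 0

lemma count_spec (hM : IsWeightSeq M) {t : ℝ} (ht : 1 ≤ t) :
    1 ≤ count M t ∧ quot M (count M t) ≤ t ∧ t < quot M (count M t + 1) := by
  have h := exists_count hM ht
  rw [count, dif_pos h]
  exact h.choose_spec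

lemma le_count (hM : IsWeightSeq M) {t : ℝ} (ht : 1 ≤ t) {p : ℕ} (h : quot M p ≤ t) :
    p ≤ count M t := by
  by_contra! hc
  exact absurd ((quot_mono hM (by omega) hc).trans h) (not_le.mpr (count_spec hM ht).2.2)

lemma count_mono (hM : IsWeightSeq M) {s t : ℝ} (hs : 1 ≤ s) (hst : s ≤ t) :
    count M s ≤ count M t :=
  le_count hM (hs.trans hst) ((count_spec hM hs).2.1.trans hst)

lemma quot_two_mul_pow_le {C₀ H : ℝ} (hM : IsWeightSeq M) (h2 : HasM2 M C₀ H) {p : ℕ} :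
    quot M (2 * p + 1) ^ p ≤ (C₀ * H ^ 3) ^ p * M p := by
  rcases Nat.eq_zero_or_pos p with rfl | hp
  · simp [hM.2.1]
  have h := (weight_mul_quot_pow_le hM (2 * p) p).trans (h2.2.2 (2 * p) p)
  have h3 : M (2 * p) * quot M (2 * p + 1) ^ p ≤ M (2 * p) * (C₀ * (H ^ 3) ^ p * M p) := by
    calc _ ≤ _ := h
      _ = _ := by rw [show 2 * p + p = 3 * p by ring, pow_mul]; ring
  refine (le_of_mul_le_mul_left h3 (hM.1 _)).trans ?_
  rw [mul_pow]
  have : C₀ ≤ C₀ ^ p := le_self_pow₀ h2.1 hp.ne'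
  have hH : (0:ℝ) ≤ (H ^ 3) ^ p := by have := h2.2.1; positivity
  exact mul_le_mul_of_nonneg_right (mul_le_mul_of_nonneg_right this hH) (hM.1 _).le

lemma quot_two_mul_le {C₀ H : ℝ} (hM : IsWeightSeq M) (h2 : HasM2 M C₀ H) {p : ℕ} (hp : 1 ≤ p) :
    quot M (2 * p + 1) ≤ C₀ * H ^ 3 * quot M p := by
  have hc : 0 ≤ C₀ * H ^ 3 := by have := h2.1; have := h2.2.1; positivity
  refine le_of_pow_le_pow_left₀ (n := p) (by omega) (mul_nonneg hc (quot_pos hM _).le) ?_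
  rw [mul_pow]
  exact (quot_two_mul_pow_le hM h2).trans
    (mul_le_mul_of_nonneg_left (weight_le_quot_pow hM p) (pow_nonneg hc _))

lemma two_mul_count_le {C₀ H : ℝ} (hM : IsWeightSeq M) (h2 : HasM2 M C₀ H) {t ρ : ℝ} (ht : 1 ≤ t)
    (hρ : C₀ * H ^ 3 ≤ ρ) : 2 * count M t ≤ count M (ρ * t) := by
  have h1 : 1 ≤ C₀ * H ^ 3 := one_le_mul_of_one_le_of_one_le h2.1 (one_le_pow₀ h2.2.1)
  obtain ⟨hp, hp1, hp2⟩ := count_spec hM ht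
  refine le_count hM (one_le_mul_of_one_le_of_one_le (h1.trans hρ) ht) ?_
  refine (quot_mono hM (by omega) (Nat.le_succ _)).trans ((quot_two_mul_le hM h2 hp).trans ?_)
  exact mul_le_mul hρ hp1 (quot_pos hM _).le (by linarith)

lemma count_two_mul_le (hM : IsWeightSeq M) (h : M2star M) :
    ∃ N : ℕ, 1 ≤ N ∧ ∀ t : ℝ, 1 ≤ t → count M (2 * t) ≤ N * count M t := by
  obtain ⟨p₀, N, hp₀, hN, h⟩ := h
  refine ⟨N * (p₀ + 2), Nat.one_le_iff_ne_zero.mpr (by positivity), fun t ht => ?_⟩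
  obtain ⟨hn, hn1, hn2⟩ := count_spec hM ht
  obtain ⟨-, hm1, -⟩ := count_spec hM (show 1 ≤ 2 * t by linarith)
  set n := count M t
  have hq : p₀ + n + 1 ≤ (p₀ + 2) * n := by nlinarith
  by_contra! hc
  have h1 : N * (n + 1 + p₀) ≤ count M (2 * t) := by
    have := Nat.mul_le_mul_left N hq
    calc _ = N * (p₀ + n + 1) := by ring
      _ ≤ _ := this
      _ = N * (p₀ + 2) * n := by ring
      _ ≤ _ := hc.le
  have h2 := quot_mono hM (Nat.one_le_iff_ne_zero.mpr (by positivity)) h1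
  have h3 : 2 * quot M (n + 1 + p₀) ≤ quot M (N * (n + 1 + p₀)) := h (n + 1 + p₀) (by omega)
  have h4 := quot_mono hM (show 1 ≤ n + 1 by omega) (show n + 1 ≤ n + 1 + p₀ by omega)
  linarith

lemma count_two_pow_mul_le {N : ℕ}
    (h : ∀ t : ℝ, 1 ≤ t → count M (2 * t) ≤ N * count M t) (s : ℕ) {t : ℝ} (ht : 1 ≤ t) :
    count M (2 ^ s * t) ≤ N ^ s * count M t := by
  induction s with
  | zero => simp
  | succ s ih =>
    rw [pow_succ', mul_assoc, pow_succ', mul_assoc]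
    exact (h _ (one_le_mul_of_one_le_of_one_le (one_le_pow₀ (by norm_num)) ht)).trans
      (Nat.mul_le_mul_left _ ih)

lemma pow_mul_weight_le (hM : IsWeightSeq M) {t : ℝ} (ht : 1 ≤ t) (q : ℕ) :
    t ^ q * M (count M t) ≤ t ^ count M t * M q := by
  obtain ⟨hp, hp1, hp2⟩ := count_spec hM ht
  set p := count M t
  have ht0 : 0 < t := by linarith
  rcases le_total p q with hpq | hpq
  · obtain ⟨r, rfl⟩ := Nat.exists_eq_add_of_le hpq
    rw [pow_add, mul_assoc]
    refine mul_le_mul_of_nonneg_left ?_ (by positivity)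
    refine le_trans ?_ (weight_mul_quot_pow_le hM p r)
    rw [mul_comm]
    exact mul_le_mul_of_nonneg_left (pow_le_pow_left₀ ht0.le hp2.le _) (hM.1 _).le
  · obtain ⟨r, hr⟩ := Nat.exists_eq_add_of_le hpq
    rw [hr, pow_add, mul_assoc]
    refine mul_le_mul_of_nonneg_left ?_ (by positivity)
    refine (weight_le_mul_quot_pow hM q r).trans ?_
    rw [← hr, mul_comm]
    exact mul_le_mul_of_nonneg_right (pow_le_pow_left₀ (quot_pos hM _).le hp1 _) (hM.1 _).le

lemma pow_le_pow_count_mul_weight {C₀ H : ℝ} (hM : IsWeightSeq M) (h2 : HasM2 M C₀ H)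
    {t : ℝ} (ht : 1 ≤ t) (q : ℕ) : t ^ q ≤ (C₀ * H ^ 3) ^ count M t * M q := by
  obtain ⟨hp, hp1, hp2⟩ := count_spec hM ht
  have h := pow_mul_weight_le hM ht q
  set p := count M t
  have ht0 : 0 < t := by linarith
  have hc : 0 ≤ C₀ * H ^ 3 := by have := h2.1; have := h2.2.1; positivity
  have h4 : t ^ p ≤ (C₀ * H ^ 3) ^ p * M p := by
    refine le_trans (pow_le_pow_left₀ ht0.le ?_ p) (quot_two_mul_pow_le hM h2)
    exact hp2.le.trans (quot_mono hM (by omega) (by omega))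
  refine le_of_mul_le_mul_right (h.trans ?_) (hM.1 p)
  calc t ^ p * M q ≤ (C₀ * H ^ 3) ^ p * M p * M q := mul_le_mul_of_nonneg_right h4 (hM.1 _).le
    _ = _ := by ring

lemma weight_two_pow_mul_count_le {C₀ H : ℝ} (hM : IsWeightSeq M) (h2 : HasM2 M C₀ H)
    {t : ℝ} (ht : 1 ≤ t) (r : ℕ) :
    M (2 ^ r * count M t) ≤ ((C₀ * H ^ 3) ^ r * t) ^ (2 ^ r * count M t) := by
  refine (weight_le_quot_pow hM _).trans (pow_le_pow_left₀ (quot_pos hM _).le ?_ _)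
  have hc : 0 ≤ C₀ * H ^ 3 := by have := h2.1; have := h2.2.1; positivity
  obtain ⟨hp, hp1, -⟩ := count_spec hM ht
  induction r with
  | zero => simpa using hp1
  | succ r ih =>
    rw [pow_succ', mul_assoc, pow_succ', mul_assoc]
    have h1 : 1 ≤ 2 ^ r * count M t := Nat.one_le_iff_ne_zero.mpr (by positivity)
    exact (quot_mono hM (by omega) (Nat.le_succ _)).trans ((quot_two_mul_le hM h2 h1).trans
      (mul_le_mul_of_nonneg_left ih hc))

end WeightSequences

/-- Any requirement `K l ≤ k` can be met, for every `l`, by a slowly growing unbounded sequence. -/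
lemma exists_slow_sequence (K : ℕ → ℕ) :
    ∃ l : ℕ → ℕ, l 0 = 0 ∧ (∀ k, l k ≤ l (k + 1) ∧ l (k + 1) ≤ l k + 1) ∧
      (∀ n, ∃ k₀, ∀ k ≥ k₀, n ≤ l k) ∧ ∃ k₀, ∀ k ≥ k₀, K (l k) ≤ k := by
  let l : ℕ → ℕ := fun k => Nat.rec 0 (fun k lk => if K (lk + 1) ≤ k + 1 then lk + 1 else lk) k
  have hs : ∀ k, l (k + 1) = if K (l k + 1) ≤ k + 1 then l k + 1 else l k := fun k => rfl
  have hmono : ∀ k, l k ≤ l (k + 1) := fun k => by rw [hs]; split_ifs <;> omega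
  have hm : Monotone l := monotone_nat_of_le_succ hmono
  refine ⟨l, rfl, fun k => ⟨hmono k, by rw [hs]; split_ifs <;> omega⟩, ?_, K 0, ?_⟩
  · intro n
    suffices h : ∃ k, n ≤ l k from h.imp fun k hk j hj => hk.trans (hm hj)
    induction n with
    | zero => exact ⟨0, Nat.zero_le _⟩
    | succ n ih =>
      obtain ⟨k, hk⟩ := ih
      by_contra! hc
      have h1 : ∀ j ≥ k, l j = n := fun j hj => le_antisymm (Nat.lt_succ_iff.mp (hc j))
        (hk.trans (hm hj))
      have h2 := hs (max k (K (n + 1)))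
      rw [h1 _ (le_max_left _ _), if_pos (le_trans (le_max_right _ _) (Nat.le_succ _))] at h2
      have := hc (max k (K (n + 1)) + 1)
      omega
  · suffices h : ∀ k, l k = 0 ∨ K (l k) ≤ k by
      intro k hk
      rcases h k with h0 | h0
      · rw [h0]; exact hk
      · exact h0
    intro k
    induction k with
    | zero => exact Or.inl rfl
    | succ k ih =>
      rw [hs]
      split_ifs with hc
      · exact Or.inr hc
      · exact ih.imp_right fun h => h.trans (Nat.le_succ k)

section StripKernels

open scoped FourierTransform Convolution

/-- Entire functions bounded by `A / (1 + (re ζ)²)` on the strip `|im ζ| ≤ Y`. -/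
def StripBound (Y A : ℝ) (F : ℂ → ℂ) : Prop :=
  Differentiable ℂ F ∧ ∀ ζ : ℂ, |ζ.im| ≤ Y → ‖F ζ‖ * (1 + ζ.re ^ 2) ≤ A

/-- Entire functions decaying faster than any power on every horizontal strip. -/
def StripDecay (F : ℂ → ℂ) : Prop :=
  Differentiable ℂ F ∧ ∀ (Y : ℝ) (n : ℕ), ∃ A : ℝ, ∀ ζ : ℂ, |ζ.im| ≤ Y → ‖ζ‖ ^ n * ‖F ζ‖ ≤ A

/-- Entire functions bounded on every horizontal strip. -/
def StripBdd (F : ℂ → ℂ) : Prop :=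
  Differentiable ℂ F ∧ ∀ Y : ℝ, ∃ A : ℝ, ∀ ζ : ℂ, |ζ.im| ≤ Y → ‖F ζ‖ ≤ A

/-- The inverse Fourier transform of the restriction of `F` to the real line. -/
def fker (F : ℂ → ℂ) : ℝ → ℂ := 𝓕⁻ (fun ξ : ℝ => F ξ)

lemma StripBound.nonneg {Y A : ℝ} {F : ℂ → ℂ} (hY : 0 ≤ Y) (h : StripBound Y A F) : 0 ≤ A :=
  le_trans (by positivity) (h.2 0 (by simpa using hY))

lemma StripBdd.mul_decay {F G : ℂ → ℂ} (hF : StripBdd F) (hG : StripDecay G) :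
    StripDecay (fun ζ => F ζ * G ζ) := by
  refine ⟨hF.1.mul hG.1, fun Y n => ?_⟩
  obtain ⟨A, hA⟩ := hF.2 Y
  obtain ⟨B, hB⟩ := hG.2 Y n
  refine ⟨A * B, fun ζ hζ => ?_⟩
  have hA0 : 0 ≤ A := (norm_nonneg _).trans (hA ζ hζ)
  calc ‖ζ‖ ^ n * ‖F ζ * G ζ‖ = ‖F ζ‖ * (‖ζ‖ ^ n * ‖G ζ‖) := by rw [norm_mul]; ring
    _ ≤ A * B := mul_le_mul (hA ζ hζ) (hB ζ hζ) (by positivity) hA0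

lemma StripDecay.stripBdd {F : ℂ → ℂ} (hF : StripDecay F) : StripBdd F :=
  ⟨hF.1, fun Y => by simpa using hF.2 Y 0⟩

lemma StripDecay.mul {F G : ℂ → ℂ} (hF : StripDecay F) (hG : StripDecay G) :
    StripDecay (fun ζ => F ζ * G ζ) := hF.stripBdd.mul_decay hG

lemma StripDecay.id_mul {F : ℂ → ℂ} (hF : StripDecay F) : StripDecay (fun ζ => ζ * F ζ) := by
  refine ⟨differentiable_id.mul hF.1, fun Y n => ?_⟩
  obtain ⟨A, hA⟩ := hF.2 Y (n + 1)
  refine ⟨A, fun ζ hζ => ?_⟩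
  rw [norm_mul, ← mul_assoc, ← pow_succ]
  exact hA ζ hζ

lemma StripDecay.const_mul {F : ℂ → ℂ} (c : ℂ) (hF : StripDecay F) :
    StripDecay (fun ζ => c * F ζ) :=
  StripBdd.mul_decay ⟨differentiable_const _, fun _ => ⟨‖c‖, fun _ _ => le_rfl⟩⟩ hF

lemma StripDecay.add {F G : ℂ → ℂ} (hF : StripDecay F) (hG : StripDecay G) :
    StripDecay (fun ζ => F ζ + G ζ) := by
  refine ⟨hF.1.add hG.1, fun Y n => ?_⟩
  obtain ⟨A, hA⟩ := hF.2 Y n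
  obtain ⟨B, hB⟩ := hG.2 Y n
  refine ⟨A + B, fun ζ hζ => ?_⟩
  have := norm_add_le (F ζ) (G ζ)
  calc ‖ζ‖ ^ n * ‖F ζ + G ζ‖ ≤ ‖ζ‖ ^ n * (‖F ζ‖ + ‖G ζ‖) := by gcongr
    _ ≤ A + B := by rw [mul_add]; exact add_le_add (hA ζ hζ) (hB ζ hζ)

lemma StripDecay.pow_mul {F : ℂ → ℂ} (hF : StripDecay F) (n : ℕ) :
    StripDecay (fun ζ => ζ ^ n * F ζ) := by
  induction n with
  | zero => simpa using hF
  | succ n ih => simpa only [pow_succ', mul_assoc] using ih.id_mul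

lemma StripDecay.stripBound {F : ℂ → ℂ} (hF : StripDecay F) (Y : ℝ) :
    ∃ A, StripBound Y A F := by
  obtain ⟨A, hA⟩ := hF.2 Y 0
  obtain ⟨B, hB⟩ := hF.2 Y 2
  refine ⟨A + B, hF.1, fun ζ hζ => ?_⟩
  have h1 := hA ζ hζ
  have h2 := hB ζ hζ
  have h3 : ζ.re ^ 2 ≤ ‖ζ‖ ^ 2 := by
    rw [← sq_abs ζ.re]; gcongr; exact Complex.abs_re_le_norm ζ
  nlinarith [norm_nonneg (F ζ), mul_le_mul_of_nonneg_left h3 (norm_nonneg (F ζ))]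

/-- A bound outside a compact part of every strip suffices for rapid decay. -/
lemma stripDecay_of_eventually {F : ℂ → ℂ} (hF : Differentiable ℂ F)
    (h : ∀ (Y : ℝ) (n : ℕ), ∃ R A : ℝ, ∀ ζ : ℂ, |ζ.im| ≤ Y → R ≤ ‖ζ‖ → ‖ζ‖ ^ n * ‖F ζ‖ ≤ A) :
    StripDecay F := by
  refine ⟨hF, fun Y n => ?_⟩
  obtain ⟨R, A, hA⟩ := h Y n
  have hc : Continuous fun ζ : ℂ => ‖ζ‖ ^ n * ‖F ζ‖ := by
    have := hF.continuous
    fun_prop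
  obtain ⟨B, hB⟩ := (isCompact_closedBall (0 : ℂ) R).bddAbove_image hc.continuousOn
  refine ⟨max A B, fun ζ hζ => ?_⟩
  rcases le_total R ‖ζ‖ with hR | hR
  · exact (hA ζ hζ hR).trans (le_max_left _ _)
  · exact (hB ⟨ζ, by simpa using hR, rfl⟩).trans (le_max_right _ _)

/-- A bound outside a compact part of every strip suffices for boundedness on strips. -/
lemma stripBdd_of_eventually {F : ℂ → ℂ} (hF : Differentiable ℂ F)
    (h : ∀ Y : ℝ, ∃ R A : ℝ, ∀ ζ : ℂ, |ζ.im| ≤ Y → R ≤ ‖ζ‖ → ‖F ζ‖ ≤ A) :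
    StripBdd F := by
  refine ⟨hF, fun Y => ?_⟩
  obtain ⟨R, A, hA⟩ := h Y
  obtain ⟨B, hB⟩ :=
    (isCompact_closedBall (0 : ℂ) R).bddAbove_image hF.continuous.norm.continuousOn
  refine ⟨max A B, fun ζ hζ => ?_⟩
  rcases le_total R ‖ζ‖ with hR | hR
  · exact (hA ζ hζ hR).trans (le_max_left _ _)
  · exact (hB ⟨ζ, by simpa using hR, rfl⟩).trans (le_max_right _ _)

lemma integrable_of_norm_mul_le {V : Type*} [NormedAddCommGroup V] {G : ℝ → V}
    (hG : Continuous G) {A : ℝ} (hb : ∀ x, ‖G x‖ * (1 + x ^ 2) ≤ A) : Integrable G := by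
  refine (integrable_inv_one_add_sq.const_mul A).mono' hG.aestronglyMeasurable
    (Eventually.of_forall fun x => ?_)
  rw [← div_eq_mul_inv, le_div_iff₀ (by positivity)]
  exact hb x

lemma norm_integral_le_pi_mul {G : ℝ → ℂ} {A : ℝ}
    (hb : ∀ x, ‖G x‖ * (1 + x ^ 2) ≤ A) : ‖∫ x, G x‖ ≤ Real.pi * A := by
  calc ‖∫ x, G x‖ ≤ ∫ x : ℝ, A * (1 + x ^ 2)⁻¹ := by
        refine norm_integral_le_of_norm_le (integrable_inv_one_add_sq.const_mul A)
          (Eventually.of_forall fun x => ?_)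
        rw [← div_eq_mul_inv, le_div_iff₀ (by positivity)]
        exact hb x
    _ = Real.pi * A := by rw [integral_const_mul, integral_univ_inv_one_add_sq, mul_comm]

open Complex in
/-- Horizontal lines in a strip of decay have the same integral. -/
lemma integral_horizontal_shift {G : ℂ → ℂ} {Y A y : ℝ} (hG : StripBound Y A G) (hy : |y| ≤ Y) :
    ∫ x : ℝ, G (x + y * I) = ∫ x : ℝ, G x := by
  have hY : 0 ≤ Y := (abs_nonneg y).trans hy
  have hA := hG.nonneg hY
  have hc := hG.1.continuous
  have hi : ∀ t : ℝ, |t| ≤ Y → Integrable fun x : ℝ => G (x + t * I) := fun t ht =>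
    integrable_of_norm_mul_le (by fun_prop) (A := A) fun x => by
      simpa using hG.2 (x + t * I) (by simpa using ht)
  have hi0 : Integrable fun x : ℝ => G x := by simpa using hi 0 (by simpa using hY)
  have h1 := intervalIntegral_tendsto_integral (hi y hy) tendsto_neg_atTop_atBot tendsto_id
  have h2 := intervalIntegral_tendsto_integral hi0 tendsto_neg_atTop_atBot tendsto_id
  have hv : ∀ s : ℝ → ℝ, (∀ T, s T ^ 2 = T ^ 2) →
      Tendsto (fun T : ℝ => I * ∫ t in (0:ℝ)..y, G (s T + t * I)) atTop (nhds 0) := by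
    intro s hs
    rw [tendsto_zero_iff_norm_tendsto_zero]
    have hlim : Tendsto (fun T : ℝ => A * (1 + T ^ 2)⁻¹ * |y - 0|) atTop (nhds 0) := by
      have : Tendsto (fun T : ℝ => (1 + T ^ 2)⁻¹) atTop (nhds 0) :=
        (tendsto_atTop_add_const_left _ _ (tendsto_pow_atTop two_ne_zero)).inv_tendsto_atTop
      simpa using (this.const_mul A).mul_const |y - 0|
    refine squeeze_zero (fun _ => norm_nonneg _) (fun T => ?_) hlim
    rw [norm_mul, norm_I, one_mul]
    refine intervalIntegral.norm_integral_le_of_norm_le_const fun t ht => ?_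
    have ht' : |t| ≤ |y| := by
      simpa using Set.abs_sub_left_of_mem_uIcc (Set.uIoc_subset_uIcc ht)
    have := hG.2 (s T + t * I) (by simpa using ht'.trans hy)
    rw [← div_eq_mul_inv, le_div_iff₀ (by positivity)]
    simpa [hs] using this
  have hC : ∀ T : ℝ, (∫ x in (-T)..T, G (x + y * I)) = (∫ x in (-T)..T, G x) +
      I * (∫ t in (0:ℝ)..y, G ((T : ℝ) + t * I)) - I * ∫ t in (0:ℝ)..y, G ((-T : ℝ) + t * I) := by
    intro T
    have := integral_boundary_rect_eq_zero_of_differentiableOn G (-T) (T + y * I)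
      hG.1.differentiableOn
    simp only [neg_im, ofReal_im, neg_zero, ofReal_zero, zero_mul, add_zero, neg_re,
      ofReal_re, add_re, mul_re, I_re, mul_zero, I_im, tsub_zero, add_im, mul_im,
      mul_one, zero_add, smul_eq_mul, ofReal_neg] at this ⊢
    linear_combination -this
  refine tendsto_nhds_unique h1 ?_
  simp only [id]
  simp_rw [hC]
  simpa using (h2.add (hv id fun _ => rfl)).sub (hv (fun T => -T) fun T => by ring)

open Complex in
lemma fker_eq_integral (F : ℂ → ℂ) (x : ℝ) :
    fker F x = ∫ ξ : ℝ, exp (2 * Real.pi * ξ * x * I) * F ξ := by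
  rw [fker, Real.fourierInv_eq']
  refine integral_congr_ae (Eventually.of_forall fun ξ => ?_)
  simp only [RCLike.inner_apply, conj_trivial, smul_eq_mul]
  push_cast
  ring_nf

open Complex in
/-- Paley–Wiener type decay of kernels of functions controlled on a strip. -/
lemma norm_fker_le {Y A : ℝ} {F : ℂ → ℂ} (hY : 0 ≤ Y) (hF : StripBound Y A F) (x : ℝ) :
    ‖fker F x‖ ≤ Real.pi * A * Real.exp (-(2 * Real.pi * Y * |x|)) := by
  have hnorm : ∀ ζ : ℂ, ‖exp (2 * Real.pi * ζ * x * I)‖ = Real.exp (-(2 * Real.pi * x * ζ.im)) := by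
    intro ζ
    rw [norm_exp]
    congr 1
    simp
    ring
  have hGd : Differentiable ℂ fun ζ : ℂ => exp (2 * Real.pi * ζ * x * I) * F ζ := by
    have := hF.1
    fun_prop
  have hA := hF.nonneg hY
  have hG : StripBound Y (Real.exp (2 * Real.pi * Y * |x|) * A)
      fun ζ : ℂ => exp (2 * Real.pi * ζ * x * I) * F ζ := by
    refine ⟨hGd, fun ζ hζ => ?_⟩
    rw [norm_mul, hnorm, mul_assoc]
    refine mul_le_mul (Real.exp_le_exp.2 ?_) (hF.2 ζ hζ) (by positivity) (Real.exp_nonneg _)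
    have h1 : |x * ζ.im| ≤ |x| * Y := by rw [abs_mul]; gcongr
    have h2 := neg_abs_le (x * ζ.im)
    nlinarith [Real.pi_pos]
  have key : ∀ y : ℝ, |y| ≤ Y → ‖fker F x‖ ≤ Real.pi * (Real.exp (-(2 * Real.pi * x * y)) * A) := by
    intro y hy
    rw [fker_eq_integral, ← integral_horizontal_shift hG hy]
    refine norm_integral_le_pi_mul fun t => ?_
    rw [norm_mul, hnorm, mul_assoc]
    have := hF.2 (t + y * I) (by simpa using hy)
    simp only [add_im, ofReal_im, mul_im, ofReal_re, I_im, mul_one, I_re, mul_zero, add_zero,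
      zero_add, add_re, mul_re, sub_self] at this ⊢
    gcongr
  rcases le_total 0 x with hx | hx
  · refine (key Y (by rw [abs_of_nonneg hY])).trans_eq ?_
    rw [abs_of_nonneg hx, mul_right_comm _ x Y]
    ring
  · refine (key (-Y) (by rw [abs_neg, abs_of_nonneg hY])).trans_eq ?_
    rw [abs_of_nonpos hx, show 2 * Real.pi * x * -Y = 2 * Real.pi * Y * -x by ring]
    ring

lemma StripDecay.integrable {F : ℂ → ℂ} (hF : StripDecay F) : Integrable fun ξ : ℝ => F ξ := by
  obtain ⟨A, hA⟩ := hF.stripBound 0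
  have := hF.1.continuous
  exact integrable_of_norm_mul_le (A := A) (by fun_prop) fun x => by
    simpa using hA.2 x (by simp)

open Complex in
lemma hasDerivAt_fker {F : ℂ → ℂ} (hF : StripDecay F) (x : ℝ) :
    HasDerivAt (fker F) (fker (fun ζ => 2 * Real.pi * I * ζ * F ζ) x) x := by
  have h1 : Integrable fun ξ : ℝ => ξ • F ξ := by
    simpa [real_smul] using hF.id_mul.integrable
  have h2 := (Real.hasDerivAt_fourier hF.integrable h1 (-x)).scomp x (hasDerivAt_neg x)
  have h3 : fker F = 𝓕 (fun ξ : ℝ => F ξ) ∘ Neg.neg := by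
    ext t
    simp [fker, Real.fourierInv_eq_fourier_neg]
  rw [h3]
  have h4 : -1 • 𝓕 (fun ξ : ℝ => (-2 * Real.pi * I * ξ) • F ξ) (-x) =
      fker (fun ζ => 2 * Real.pi * I * ζ * F ζ) x := by
    rw [fker, ← Real.fourierInv_eq_fourier_neg, Real.fourierInv_eq', Real.fourierInv_eq',
      neg_smul, one_smul, ← integral_neg]
    congr 1
    ext ξ
    simp [smul_eq_mul]
  rw [← h4]
  simpa using h2

lemma continuous_fker {F : ℂ → ℂ} (hF : StripDecay F) : Continuous (fker F) :=
  continuous_iff_continuousAt.2 fun x => (hasDerivAt_fker hF x).continuousAt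

open Complex in
lemma iteratedDeriv_fker {F : ℂ → ℂ} (hF : StripDecay F) (p : ℕ) :
    iteratedDeriv p (fker F) = fker (fun ζ => (2 * Real.pi * I * ζ) ^ p * F ζ) := by
  induction p with
  | zero => simp
  | succ p ih =>
    have h : StripDecay (fun ζ => (2 * Real.pi * I * ζ) ^ p * F ζ) := by
      simpa only [mul_pow, mul_assoc] using (hF.pow_mul p).const_mul ((2 * Real.pi * I) ^ p)
    ext x
    rw [iteratedDeriv_succ, ih, (hasDerivAt_fker h x).deriv]
    congr 1
    ext ζ
    ring

lemma contDiff_fker {F : ℂ → ℂ} (hF : StripDecay F) : ContDiff ℝ (⊤ : ℕ∞) (fker F) := by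
  refine contDiff_of_differentiable_iteratedDeriv fun m _ => ?_
  rw [iteratedDeriv_fker hF]
  have h : StripDecay (fun ζ => (2 * Real.pi * Complex.I * ζ) ^ m * F ζ) := by
    simpa only [mul_pow, mul_assoc] using (hF.pow_mul m).const_mul ((2 * Real.pi * Complex.I) ^ m)
  exact fun x => (hasDerivAt_fker h x).differentiableAt

lemma integrable_exp_neg_mul_abs {b : ℝ} (hb : 0 < b) :
    Integrable fun x : ℝ => Real.exp (-(b * |x|)) := by
  refine integrable_of_norm_mul_le (by fun_prop) (A := 1 + 2 / b ^ 2) fun x => ?_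
  have h1 := Real.quadratic_le_exp_of_nonneg (mul_nonneg hb.le (abs_nonneg x))
  rw [Real.norm_of_nonneg (Real.exp_nonneg _), Real.exp_neg, ← div_eq_inv_mul,
    div_le_iff₀ (Real.exp_pos _)]
  have h2 : 2 / b ^ 2 * ((b * |x|) ^ 2 / 2) = x ^ 2 := by
    rw [mul_pow, sq_abs]
    field_simp
  have h3 : 0 ≤ b * |x| := by positivity
  have h4 : 0 ≤ 2 / b ^ 2 := by positivity
  have h5 := mul_le_mul_of_nonneg_left
    (show (b * |x|) ^ 2 / 2 ≤ Real.exp (b * |x|) by linarith) h4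
  rw [h2] at h5
  have h6 : 1 ≤ Real.exp (b * |x|) := Real.one_le_exp h3
  linarith

lemma integrable_fker {F : ℂ → ℂ} (hF : StripDecay F) : Integrable (fker F) := by
  obtain ⟨A, hA⟩ := hF.stripBound 1
  refine ((integrable_exp_neg_mul_abs (b := 2 * Real.pi) (by positivity)).const_mul
    (Real.pi * A)).mono' (continuous_fker hF).aestronglyMeasurable
    (Eventually.of_forall fun x => ?_)
  simpa using norm_fker_le zero_le_one hA x

lemma fourier_fker {F : ℂ → ℂ} (hF : StripDecay F) : 𝓕 (fker F) = fun ξ : ℝ => F ξ := by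
  have h : Integrable (𝓕 fun ξ : ℝ => F ξ) := by
    have h1 : 𝓕 (fun ξ : ℝ => F ξ) = fun x => fker F (-x) := by
      ext x
      simp [fker, Real.fourierInv_eq_fourier_neg]
    rw [h1]
    exact (integrable_fker hF).comp_neg
  have := hF.1.continuous
  exact Continuous.fourier_fourierInv_eq (by fun_prop) hF.integrable h

/-- The kernel of a product is the convolution of the kernels. -/
lemma fker_mul {F G : ℂ → ℂ} (hF : StripDecay F) (hG : StripDecay G) (x : ℝ) :
    fker (fun ζ => F ζ * G ζ) x = ∫ t, fker F t * fker G (x - t) := by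
  set f := fker F ⋆[ContinuousLinearMap.mul ℂ ℂ] fker G with hf
  have hfi : Integrable f := (integrable_fker hF).integrable_convolution _ (integrable_fker hG)
  have hfour : 𝓕 f = fun ξ : ℝ => F ξ * G ξ := by
    ext ξ
    rw [hf, Real.fourier_mul_convolution_eq (integrable_fker hF) (integrable_fker hG),
      fourier_fker hF, fourier_fker hG]
  have hfc : Continuous f := by
    obtain ⟨A, hA⟩ := hG.stripBound 0
    refine BddAbove.continuous_convolution_right_of_integrable _ ?_ (integrable_fker hF)
      (continuous_fker hG)
    refine ⟨Real.pi * A, ?_⟩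
    rintro _ ⟨t, rfl⟩
    simpa using norm_fker_le le_rfl hA t
  have h := hfc.fourierInv_fourier_eq hfi (by rw [hfour]; exact (hF.mul hG).integrable)
  rw [hfour] at h
  rw [fker, h]
  rfl

end StripKernels

/-- The monomials `(ζ / ρ^(k+1))^m`. -/
def omg (ρ : ℝ) (m k : ℕ) (ζ : ℂ) : ℂ := (ζ / (ρ : ℂ) ^ (k + 1)) ^ m

/-- Points where the monomials `omg ρ m k` are under control. -/
def Good (ρ : ℝ) (m : ℕ) (ζ : ℂ) : Prop := 4 * m * |ζ.im| ≤ ‖ζ‖ ∨ ‖ζ‖ ≤ ρ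

/-- Growth conditions on the exponents. -/
structure Admissible (ρ Λ : ℝ) (m : ℕ) (a : ℕ → ℕ) : Prop where
  one_le_rho : 1 ≤ ρ
  one_le_m : 1 ≤ m
  one_le_lam : 1 ≤ Λ
  lam_le : 100 * Λ ≤ ρ ^ m
  one_le_zero : 1 ≤ a 0
  two_mul_le : ∀ k, 2 * a k ≤ a (k + 1)
  le_mul : ∀ k, (a (k + 1) : ℝ) ≤ Λ * a k

lemma norm_omg {ρ : ℝ} (hρ : 1 ≤ ρ) (m k : ℕ) (ζ : ℂ) :
    ‖omg ρ m k ζ‖ = (‖ζ‖ / ρ ^ (k + 1)) ^ m := by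
  rw [omg, norm_pow, norm_div, norm_pow, Complex.norm_of_nonneg (by linarith)]

lemma norm_omg_le_one {ρ : ℝ} (hρ : 1 ≤ ρ) {m k : ℕ} {ζ : ℂ} (h : ‖ζ‖ ≤ ρ ^ (k + 1)) :
    ‖omg ρ m k ζ‖ ≤ 1 := by
  rw [norm_omg hρ]
  exact pow_le_one₀ (by positivity) (div_le_one_of_le₀ h (by positivity))

lemma one_le_norm_omg {ρ : ℝ} (hρ : 1 ≤ ρ) {m k : ℕ} {ζ : ℂ} (h : ρ ^ (k + 1) ≤ ‖ζ‖) :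
    1 ≤ ‖omg ρ m k ζ‖ := by
  rw [norm_omg hρ]
  exact one_le_pow₀ ((one_le_div (by positivity)).2 h)

lemma norm_pow_sub_pow_le (z w : ℂ) {r : ℝ} (hz : ‖z‖ ≤ r) (hw : ‖w‖ ≤ r) (n : ℕ) :
    ‖z ^ n - w ^ n‖ ≤ n * ‖z - w‖ * r ^ (n - 1) := by
  have hr : 0 ≤ r := (norm_nonneg z).trans hz
  rw [← Commute.geom_sum₂_mul (Commute.all z w), norm_mul]
  have : ‖∑ i ∈ Finset.range n, z ^ i * w ^ (n - 1 - i)‖ ≤ ∑ i ∈ Finset.range n, r ^ (n - 1) := by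
    refine norm_sum_le_of_le _ fun i hi => ?_
    rw [norm_mul, norm_pow, norm_pow]
    calc ‖z‖ ^ i * ‖w‖ ^ (n - 1 - i) ≤ r ^ i * r ^ (n - 1 - i) := by gcongr
      _ = r ^ (n - 1) := by
        rw [← pow_add]; congr 1; have := Finset.mem_range.1 hi; omega
  rw [Finset.sum_const, Finset.card_range, nsmul_eq_mul] at this
  calc _ ≤ (n * r ^ (n - 1)) * ‖z - w‖ := by gcongr
    _ = _ := by ring

/-- Powers of points close to the real axis have large real part, for even exponents. -/
lemma half_norm_pow_le_re {m : ℕ} (hm : Even m) {ζ : ℂ} (h : 4 * m * |ζ.im| ≤ ‖ζ‖) :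
    ‖ζ ^ m‖ / 2 ≤ (ζ ^ m).re := by
  have h1 : ‖ζ ^ m - (ζ.re : ℂ) ^ m‖ ≤ ‖ζ‖ ^ m / 4 := by
    rcases Nat.eq_zero_or_pos m with rfl | hm0
    · simp
    refine (norm_pow_sub_pow_le ζ ζ.re le_rfl (by simpa using Complex.abs_re_le_norm ζ) m).trans ?_
    have h2 : ‖ζ - (ζ.re : ℂ)‖ = |ζ.im| := by
      have : ζ - (ζ.re : ℂ) = ζ.im * Complex.I := by
        apply Complex.ext <;> simp
      rw [this]; simp
    rw [h2]
    have h3 : ‖ζ‖ ^ m = ‖ζ‖ * ‖ζ‖ ^ (m - 1) := by rw [← pow_succ']; congr 1; omega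
    rw [h3]
    have := mul_le_mul_of_nonneg_right h (pow_nonneg (norm_nonneg ζ) (m - 1))
    linarith
  have h2 : (0 : ℝ) ≤ ζ.re ^ m := hm.pow_nonneg _
  have h3 : ‖(ζ.re : ℂ) ^ m‖ = ζ.re ^ m := by
    rw [norm_pow, Complex.norm_real, Real.norm_eq_abs, hm.pow_abs]
  have h4 : |(ζ ^ m - (ζ.re : ℂ) ^ m).re| ≤ ‖ζ‖ ^ m / 4 := (Complex.abs_re_le_norm _).trans h1
  have h5 : ((ζ.re : ℂ) ^ m).re = ζ.re ^ m := by norm_cast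
  rw [Complex.sub_re, h5] at h4
  have h6 : ‖ζ ^ m‖ ≤ ‖ζ ^ m - (ζ.re : ℂ) ^ m‖ + ‖(ζ.re : ℂ) ^ m‖ := by
    simpa using norm_add_le (ζ ^ m - (ζ.re : ℂ) ^ m) ((ζ.re : ℂ) ^ m)
  rw [h3] at h6
  have h7 := (abs_le.1 h4).1
  rw [norm_pow] at h6 ⊢
  linarith

lemma half_norm_omg_le_re {ρ : ℝ} (hρ : 1 ≤ ρ) {m : ℕ} (hm : Even m) (k : ℕ) {ζ : ℂ}
    (h : 4 * m * |ζ.im| ≤ ‖ζ‖) : ‖omg ρ m k ζ‖ / 2 ≤ (omg ρ m k ζ).re := by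
  have hp : (0 : ℝ) < ρ ^ (k + 1) := by positivity
  refine half_norm_pow_le_re hm ?_
  have h1 : (ζ / (ρ : ℂ) ^ (k + 1)).im = ζ.im / ρ ^ (k + 1) := by
    rw [← Complex.ofReal_pow, Complex.div_ofReal_im]
  rw [h1, norm_div, norm_pow, Complex.norm_of_nonneg (by linarith), abs_div, abs_of_pos hp,
    ← mul_div_assoc]
  gcongr

lemma Good.norm_omg_le_one_of_not {ρ : ℝ} (hρ : 1 ≤ ρ) {m : ℕ} (k : ℕ) {ζ : ℂ}
    (hζ : Good ρ m ζ) (h : ¬ 4 * m * |ζ.im| ≤ ‖ζ‖) : ‖omg ρ m k ζ‖ ≤ 1 :=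
  norm_omg_le_one hρ ((hζ.resolve_left h).trans (le_self_pow₀ hρ (by omega)))

lemma Good.le_re_omg {ρ : ℝ} (hρ : 1 ≤ ρ) {m : ℕ} (hm : Even m) (k : ℕ) {ζ : ℂ}
    (hζ : Good ρ m ζ) : ‖omg ρ m k ζ‖ / 2 - 2 ≤ (omg ρ m k ζ).re := by
  by_cases h : 4 * m * |ζ.im| ≤ ‖ζ‖
  · linarith [half_norm_omg_le_re hρ hm k h]
  · have h1 := hζ.norm_omg_le_one_of_not hρ k h
    have h2 := (abs_le.1 (Complex.abs_re_le_norm (omg ρ m k ζ))).1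
    linarith

lemma Good.norm_one_sub_exp_le {ρ : ℝ} (hρ : 1 ≤ ρ) {m : ℕ} (hm : Even m) (k : ℕ) {ζ : ℂ}
    (hζ : Good ρ m ζ) :
    ‖1 - Complex.exp (-omg ρ m k ζ)‖ ≤ 2 ∧
      ‖1 - Complex.exp (-omg ρ m k ζ)‖ ≤ 2 * ‖omg ρ m k ζ‖ := by
  rcases le_total ‖omg ρ m k ζ‖ 1 with h | h
  · have h1 := Complex.norm_exp_sub_one_le (x := -omg ρ m k ζ) (by simpa using h)
    rw [norm_sub_rev, norm_neg] at h1
    exact ⟨by linarith, h1⟩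
  · have h2 : ‖1 - Complex.exp (-omg ρ m k ζ)‖ ≤ 2 := by
      rcases h.eq_or_lt with h | h
      · have h1 := Complex.norm_exp_sub_one_le (x := -omg ρ m k ζ) (by simp [← h])
        rw [norm_sub_rev, norm_neg] at h1
        linarith
      have h1 : 4 * m * |ζ.im| ≤ ‖ζ‖ := by
        by_contra hc
        linarith [hζ.norm_omg_le_one_of_not hρ k hc]
      have h2 := half_norm_omg_le_re hρ hm k h1
      refine (norm_sub_le _ _).trans ?_
      rw [norm_one, Complex.norm_exp, Complex.neg_re]
      have : Real.exp (-(omg ρ m k ζ).re) ≤ 1 := Real.exp_le_one_iff.2 (by linarith)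
      linarith
    exact ⟨h2, by linarith⟩

namespace Admissible

variable {ρ Λ : ℝ} {m : ℕ} {a : ℕ → ℕ}

lemma rho_pow_pos (h : Admissible ρ Λ m a) (n : ℕ) : 0 < ρ ^ n :=
  pow_pos (by linarith [h.one_le_rho]) n

lemma lt_a (h : Admissible ρ Λ m a) (k : ℕ) : k + 1 ≤ a k := by
  induction k with
  | zero => exact h.one_le_zero
  | succ k ih => have := h.two_mul_le k; omega

lemma sum_le (h : Admissible ρ Λ m a) (k : ℕ) : ∑ j ∈ Finset.range k, a j ≤ a k := by
  induction k with
  | zero => simp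
  | succ k ih =>
    rw [Finset.sum_range_succ]
    have := h.two_mul_le k
    omega

lemma a_mul_norm_omg_succ_le (h : Admissible ρ Λ m a) (k : ℕ) (ζ : ℂ) :
    a (k + 1) * ‖omg ρ m (k + 1) ζ‖ ≤ a k * ‖omg ρ m k ζ‖ / 100 := by
  have hρ := h.one_le_rho
  have h1 : ‖omg ρ m (k + 1) ζ‖ * ρ ^ m = ‖omg ρ m k ζ‖ := by
    rw [norm_omg hρ, norm_omg hρ, ← mul_pow]
    congr 1
    rw [pow_succ ρ (k + 1)]
    have := h.rho_pow_pos (k + 1)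
    field_simp
  have h2 := h.le_mul k
  have h3 := h.lam_le
  have h4 := norm_nonneg (omg ρ m (k + 1) ζ)
  have h5 : (0 : ℝ) ≤ a k := by positivity
  rw [← h1]
  have h6 := mul_le_mul_of_nonneg_right h2 h4
  have h7 := mul_le_mul_of_nonneg_left h3 (mul_nonneg h5 h4)
  linarith

lemma a_mul_norm_omg_add_le (h : Admissible ρ Λ m a) (k j : ℕ) (ζ : ℂ) :
    a (k + j) * ‖omg ρ m (k + j) ζ‖ ≤ a k * ‖omg ρ m k ζ‖ * (1 / 100) ^ j := by
  induction j with
  | zero => simp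
  | succ j ih =>
    have := h.a_mul_norm_omg_succ_le (k + j) ζ
    rw [← add_assoc, pow_succ]
    linarith

end Admissible

/-- The `k`-th term of the exponent of the multiplier. -/
def gterm (ρ : ℝ) (m : ℕ) (a : ℕ → ℕ) (k : ℕ) (ζ : ℂ) : ℂ :=
  a k * (1 - Complex.exp (-omg ρ m k ζ))

/-- The exponent of the multiplier. -/
def gsum (ρ : ℝ) (m : ℕ) (a : ℕ → ℕ) (ζ : ℂ) : ℂ := ∑' k, gterm ρ m a k ζ

lemma differentiable_omg (ρ : ℝ) (m k : ℕ) : Differentiable ℂ (omg ρ m k) := by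
  unfold omg
  fun_prop

lemma norm_exp_sub_one_le_mul_exp (z : ℂ) : ‖Complex.exp z - 1‖ ≤ ‖z‖ * Real.exp ‖z‖ := by
  simpa using Complex.norm_exp_sub_sum_le_norm_mul_exp z 1

lemma norm_gterm_le {ρ : ℝ} (hρ : 1 ≤ ρ) (m : ℕ) (a : ℕ → ℕ) (k : ℕ) {ζ : ℂ} {r : ℝ}
    (hζ : ‖ζ‖ ≤ r) :
    ‖gterm ρ m a k ζ‖ ≤ a k * ‖omg ρ m k (r : ℂ)‖ * Real.exp (r ^ m) := by
  have hr : 0 ≤ r := (norm_nonneg ζ).trans hζ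
  rw [gterm, norm_mul, Complex.norm_natCast, norm_sub_rev, mul_assoc]
  have h0 : ‖omg ρ m k ζ‖ ≤ ‖omg ρ m k (r : ℂ)‖ := by
    rw [norm_omg hρ, norm_omg hρ, Complex.norm_of_nonneg hr]
    gcongr
  have h1 : ‖omg ρ m k (r : ℂ)‖ ≤ r ^ m := by
    rw [norm_omg hρ, Complex.norm_of_nonneg hr]
    gcongr
    exact div_le_self hr (one_le_pow₀ hρ)
  refine mul_le_mul_of_nonneg_left ((norm_exp_sub_one_le_mul_exp _).trans ?_) (by positivity)
  rw [norm_neg]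
  gcongr
  exact h0.trans h1

lemma Admissible.summable_gterm_bound {ρ Λ : ℝ} {m : ℕ} {a : ℕ → ℕ} (h : Admissible ρ Λ m a)
    (r : ℝ) : Summable fun k => a k * ‖omg ρ m k (r : ℂ)‖ * Real.exp (r ^ m) := by
  refine Summable.mul_right _ (Summable.of_nonneg_of_le (fun k => by positivity) (fun k => ?_)
    ((summable_geometric_of_lt_one (r := (1 / 100 : ℝ)) (by norm_num) (by norm_num)).mul_left
      (a 0 * ‖omg ρ m 0 (r : ℂ)‖)))
  simpa using h.a_mul_norm_omg_add_le 0 k (r : ℂ)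

lemma Admissible.summable_gterm {ρ Λ : ℝ} {m : ℕ} {a : ℕ → ℕ} (h : Admissible ρ Λ m a)
    (ζ : ℂ) : Summable fun k => gterm ρ m a k ζ :=
  Summable.of_norm_bounded (h.summable_gterm_bound ‖ζ‖)
    fun k => norm_gterm_le h.one_le_rho m a k le_rfl

lemma Admissible.differentiable_gsum {ρ Λ : ℝ} {m : ℕ} {a : ℕ → ℕ} (h : Admissible ρ Λ m a) :
    Differentiable ℂ (gsum ρ m a) := by
  intro ζ
  have hd : DifferentiableOn ℂ (gsum ρ m a) (Metric.ball 0 (‖ζ‖ + 1)) := by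
    refine Complex.differentiableOn_tsum_of_summable_norm (h.summable_gterm_bound (‖ζ‖ + 1))
      (fun k => Differentiable.differentiableOn ?_) Metric.isOpen_ball fun k w hw =>
      norm_gterm_le h.one_le_rho m a k (by simpa using (Metric.mem_ball.1 hw).le)
    have := differentiable_omg ρ m k
    unfold gterm
    fun_prop
  exact hd.differentiableAt (Metric.isOpen_ball.mem_nhds (by simp))

lemma Admissible.norm_gsum_le {ρ Λ : ℝ} {m : ℕ} {a : ℕ → ℕ} (h : Admissible ρ Λ m a)
    (hm : Even m) {ζ : ℂ} (hζ : Good ρ m ζ) (K : ℕ) :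
    ‖gsum ρ m a ζ‖ ≤ 4 * a K + a K * ‖omg ρ m K ζ‖ / 16 := by
  have hρ := h.one_le_rho
  rw [gsum, ← (h.summable_gterm ζ).sum_add_tsum_nat_add (K + 1)]
  refine (norm_add_le _ _).trans (add_le_add ?_ ?_)
  · calc ‖∑ k ∈ Finset.range (K + 1), gterm ρ m a k ζ‖
        ≤ ∑ k ∈ Finset.range (K + 1), (a k : ℝ) * 2 := by
          refine norm_sum_le_of_le _ fun k _ => ?_
          rw [gterm, norm_mul, Complex.norm_natCast]
          exact mul_le_mul_of_nonneg_left (hζ.norm_one_sub_exp_le hρ hm k).1 (by positivity)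
      _ = ((∑ k ∈ Finset.range (K + 1), a k : ℕ) : ℝ) * 2 := by
          rw [← Finset.sum_mul]; push_cast; rfl
      _ ≤ ((2 * a K : ℕ) : ℝ) * 2 := by
          gcongr
          rw [Finset.sum_range_succ]
          have := h.sum_le K
          omega
      _ = 4 * a K := by push_cast; ring
  · have hs : HasSum (fun j : ℕ => a K * ‖omg ρ m K ζ‖ * (1 / 50) * (1 / 100 : ℝ) ^ j)
        (a K * ‖omg ρ m K ζ‖ * (1 / 50) * (1 - 1 / 100)⁻¹) :=
      (hasSum_geometric_of_lt_one (by norm_num) (by norm_num)).mul_left _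
    refine (tsum_of_norm_bounded hs fun j => ?_).trans ?_
    · rw [gterm, norm_mul, Complex.norm_natCast]
      have h1 := (hζ.norm_one_sub_exp_le hρ hm (j + (K + 1))).2
      have h2 := h.a_mul_norm_omg_add_le K (j + 1) ζ
      rw [show K + (j + 1) = j + (K + 1) by ring] at h2
      have h3 := mul_le_mul_of_nonneg_left h1 (Nat.cast_nonneg (α := ℝ) (a (j + (K + 1))))
      rw [pow_succ] at h2
      linarith
    · have : 0 ≤ a K * ‖omg ρ m K ζ‖ := by positivity
      norm_num
      linarith

lemma Admissible.le_re_gsum {ρ Λ : ℝ} {m : ℕ} {a : ℕ → ℕ} (h : Admissible ρ Λ m a)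
    (hm : Even m) {ζ : ℂ} (hζ : 4 * m * |ζ.im| ≤ ‖ζ‖) {K : ℕ} (hK : ρ ^ (K + 1) ≤ ‖ζ‖) :
    (a K : ℝ) / 4 ≤ (gsum ρ m a ζ).re := by
  have hρ := h.one_le_rho
  have hlow : ∀ k, a k * (1 - Real.exp (-(‖omg ρ m k ζ‖ / 2))) ≤ (gterm ρ m a k ζ).re := by
    intro k
    have h1 := half_norm_omg_le_re hρ hm k hζ
    have h2 := Complex.re_le_norm (Complex.exp (-omg ρ m k ζ))
    rw [Complex.norm_exp, Complex.neg_re] at h2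
    have h3 : Real.exp (-(omg ρ m k ζ).re) ≤ Real.exp (-(‖omg ρ m k ζ‖ / 2)) :=
      Real.exp_le_exp.2 (by linarith)
    rw [gterm, ← Complex.ofReal_natCast, Complex.re_ofReal_mul, Complex.sub_re, Complex.one_re]
    gcongr
    linarith
  have hs : Summable fun k => (gterm ρ m a k ζ).re :=
    (Complex.hasSum_re (h.summable_gterm ζ).hasSum).summable
  have h0 : ∀ k, 0 ≤ (gterm ρ m a k ζ).re := fun k => by
    refine le_trans (mul_nonneg (by positivity) ?_) (hlow k)
    have : Real.exp (-(‖omg ρ m k ζ‖ / 2)) ≤ 1 :=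
      Real.exp_le_one_iff.2 (by linarith [norm_nonneg (omg ρ m k ζ)])
    linarith
  rw [gsum, Complex.re_tsum (h.summable_gterm ζ)]
  refine le_trans (le_trans ?_ (hlow K)) (hs.le_tsum K fun k _ => h0 k)
  have h1 := one_le_norm_omg hρ (m := m) hK
  have h2 : Real.exp (-(‖omg ρ m K ζ‖ / 2)) ≤ 3 / 4 := by
    have h3 : 1 + 1 / 2 ≤ Real.exp (‖omg ρ m K ζ‖ / 2) :=
      le_trans (by linarith) (Real.add_one_le_exp (‖omg ρ m K ζ‖ / 2))
    rw [Real.exp_neg]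
    calc _ ≤ (1 + 1 / 2 : ℝ)⁻¹ := by gcongr
      _ ≤ _ := by norm_num
  have h4 : (0 : ℝ) ≤ a K := by positivity
  nlinarith

/-- The truncated exponential `e^{-w} ∑_{i<q} w^i / i!`. -/
def texp (q : ℕ) (w : ℂ) : ℂ := Complex.exp (-w) * ∑ i ∈ Finset.range q, w ^ i / i.factorial

/-- The function `R` with `1 - texp q w = w^q R w`. -/
def rexp (q : ℕ) (w : ℂ) : ℂ := Complex.exp (-w) * ∑' i : ℕ, w ^ i / (i + q).factorial

lemma one_sub_texp (q : ℕ) (w : ℂ) : 1 - texp q w = w ^ q * rexp q w := by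
  have hs : Summable fun i : ℕ => w ^ i / i.factorial := NormedSpace.expSeries_div_summable w
  have h1 : Complex.exp w = ∑' i : ℕ, w ^ i / i.factorial := by
    rw [Complex.exp_eq_exp_ℂ, NormedSpace.exp_eq_tsum_div]
  have h2 := hs.sum_add_tsum_nat_add q
  rw [← h1] at h2
  have h3 : ∑' i : ℕ, w ^ (i + q) / (i + q).factorial =
      w ^ q * ∑' i : ℕ, w ^ i / (i + q).factorial := by
    rw [← tsum_mul_left]
    congr 1
    ext i
    ring
  rw [h3] at h2
  have h4 : Complex.exp (-w) * Complex.exp w = 1 := by rw [← Complex.exp_add]; simp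
  rw [texp, rexp]
  linear_combination -Complex.exp (-w) * h2 - h4

lemma norm_rexp_term_le (q i : ℕ) {w : ℂ} {r : ℝ} (hw : ‖w‖ ≤ r) :
    ‖w ^ i / ((i + q).factorial : ℂ)‖ ≤ r ^ i / i.factorial / q.factorial := by
  rw [norm_div, norm_pow, Complex.norm_natCast, div_div]
  have h1 : ((i.factorial * q.factorial : ℕ) : ℝ) ≤ (i + q).factorial :=
    Nat.cast_le.2 (Nat.le_of_dvd (Nat.factorial_pos _)
      (Nat.factorial_mul_factorial_dvd_factorial_add i q))
  push_cast at h1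
  have hr : 0 ≤ r := (norm_nonneg w).trans hw
  gcongr

lemma norm_rexp_le (q : ℕ) (w : ℂ) :
    ‖rexp q w‖ ≤ Real.exp (‖w‖ - w.re) / q.factorial := by
  have hs : HasSum (fun i : ℕ => ‖w‖ ^ i / i.factorial / q.factorial)
      (Real.exp ‖w‖ / q.factorial) := by
    refine HasSum.div_const ?_ _
    rw [Real.exp_eq_exp_ℝ]
    exact NormedSpace.expSeries_div_hasSum_exp ‖w‖
  have h := tsum_of_norm_bounded hs fun i => norm_rexp_term_le q i (le_refl ‖w‖)
  rw [rexp, norm_mul, Complex.norm_exp, Complex.neg_re, sub_eq_add_neg, add_comm, Real.exp_add,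
    mul_div_assoc]
  gcongr

lemma differentiable_rexp (q : ℕ) : Differentiable ℂ (rexp q) := by
  have h : Differentiable ℂ fun w : ℂ => ∑' i : ℕ, w ^ i / ((i + q).factorial : ℂ) := by
    intro w
    have hd : DifferentiableOn ℂ (fun w : ℂ => ∑' i : ℕ, w ^ i / ((i + q).factorial : ℂ))
        (Metric.ball 0 (‖w‖ + 1)) := by
      refine Complex.differentiableOn_tsum_of_summable_norm
        (u := fun i => (‖w‖ + 1) ^ i / i.factorial / q.factorial)
        ((NormedSpace.expSeries_div_summable (‖w‖ + 1)).div_const _) (fun k => by fun_prop)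
        Metric.isOpen_ball fun k z hz =>
        norm_rexp_term_le q k (by simpa using (Metric.mem_ball.1 hz).le)
    exact hd.differentiableAt (Metric.isOpen_ball.mem_nhds (by simp))
  unfold rexp
  fun_prop

lemma differentiable_texp (q : ℕ) : Differentiable ℂ (texp q) := by
  unfold texp
  fun_prop

lemma sum_pow_div_factorial_le (q : ℕ) {x : ℝ} (hx : 0 ≤ x) :
    ∑ i ∈ Finset.range q, x ^ i / i.factorial ≤ 4 ^ q * Real.exp (x / 4) := by
  calc ∑ i ∈ Finset.range q, x ^ i / i.factorial
      ≤ ∑ i ∈ Finset.range q, 4 ^ q * ((x / 4) ^ i / i.factorial) := by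
        refine Finset.sum_le_sum fun i hi => ?_
        have h1 : x ^ i = 4 ^ i * (x / 4) ^ i := by rw [← mul_pow]; congr 1; ring
        rw [h1, mul_div_assoc]
        have := (Finset.mem_range.1 hi).le
        gcongr
        norm_num
    _ = 4 ^ q * ∑ i ∈ Finset.range q, (x / 4) ^ i / i.factorial := by rw [Finset.mul_sum]
    _ ≤ _ := by
        gcongr
        exact Real.sum_le_exp_of_nonneg (by positivity) q

lemma norm_texp_le (q : ℕ) (w : ℂ) :
    ‖texp q w‖ ≤ 4 ^ q * Real.exp (‖w‖ / 4 - w.re) := by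
  have h : ‖∑ i ∈ Finset.range q, w ^ i / (i.factorial : ℂ)‖ ≤ 4 ^ q * Real.exp (‖w‖ / 4) := by
    refine le_trans (norm_sum_le_of_le _ fun i _ => ?_)
      (sum_pow_div_factorial_le q (norm_nonneg w))
    rw [norm_div, norm_pow, Complex.norm_natCast]
  rw [texp, norm_mul, Complex.norm_exp, Complex.neg_re, sub_eq_add_neg, add_comm (‖w‖ / 4),
    Real.exp_add]
  calc _ ≤ Real.exp (-w.re) * (4 ^ q * Real.exp (‖w‖ / 4)) := by gcongr
    _ = _ := by ring

/-- Cut-off functions concentrated on `‖ζ‖ ≲ ρ^(k+1)`. -/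
def eta (ρ : ℝ) (m : ℕ) (a : ℕ → ℕ) (k : ℕ) (ζ : ℂ) : ℂ := texp (a k) (a k * omg ρ m k ζ)

/-- The function `S` with `1 - eta = ζ^(m a_k) S`. -/
def sfac (ρ : ℝ) (m : ℕ) (a : ℕ → ℕ) (k : ℕ) (ζ : ℂ) : ℂ :=
  (a k : ℂ) ^ a k / ((ρ : ℂ) ^ (k + 1)) ^ (m * a k) * rexp (a k) (a k * omg ρ m k ζ)

lemma differentiable_eta (ρ : ℝ) (m : ℕ) (a : ℕ → ℕ) (k : ℕ) :
    Differentiable ℂ (eta ρ m a k) := by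
  have h1 := differentiable_texp (a k)
  have h2 := differentiable_omg ρ m k
  unfold eta
  exact h1.comp (h2.const_mul _)

lemma differentiable_sfac (ρ : ℝ) (m : ℕ) (a : ℕ → ℕ) (k : ℕ) :
    Differentiable ℂ (sfac ρ m a k) := by
  have h1 := differentiable_rexp (a k)
  have h2 := differentiable_omg ρ m k
  unfold sfac
  exact (h1.comp (h2.const_mul _)).const_mul _

lemma one_sub_eta {ρ : ℝ} (m : ℕ) (a : ℕ → ℕ) (k : ℕ) (ζ : ℂ) :
    1 - eta ρ m a k ζ = ζ ^ (m * a k) * sfac ρ m a k ζ := by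
  rw [eta, one_sub_texp, sfac, omg, mul_pow, ← pow_mul, div_pow]
  ring

lemma exp_two_le : Real.exp 2 ≤ 15 / 2 := by
  have h := Real.exp_one_lt_d9.le
  have : Real.exp 2 = Real.exp 1 * Real.exp 1 := by rw [← Real.exp_add]; norm_num
  rw [this]
  nlinarith [Real.exp_pos 1]

lemma exp_nat_mul_two_le (n : ℕ) : Real.exp (n * 2) ≤ (15 / 2) ^ n := by
  rw [Real.exp_nat_mul]
  exact pow_le_pow_left₀ (Real.exp_nonneg _) exp_two_le n

lemma norm_eta_le {ρ : ℝ} (hρ : 1 ≤ ρ) {m : ℕ} (hm : Even m) (a : ℕ → ℕ) (k : ℕ) {ζ : ℂ}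
    (hζ : Good ρ m ζ) :
    ‖eta ρ m a k ζ‖ ≤ 30 ^ a k * Real.exp (-(a k * ‖omg ρ m k ζ‖ / 4)) := by
  have h1 := hζ.le_re_omg hρ hm k
  have h2 : ((a k : ℂ) * omg ρ m k ζ).re = a k * (omg ρ m k ζ).re := by
    rw [← Complex.ofReal_natCast, Complex.re_ofReal_mul]
  have h3 := mul_le_mul_of_nonneg_left h1 (Nat.cast_nonneg (α := ℝ) (a k))
  refine (norm_texp_le _ _).trans ?_
  rw [h2, norm_mul, Complex.norm_natCast]
  calc _ ≤ 4 ^ a k * Real.exp (a k * 2 + -(a k * ‖omg ρ m k ζ‖ / 4)) := by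
        gcongr; linarith
    _ ≤ 4 ^ a k * ((15 / 2) ^ a k * Real.exp (-(a k * ‖omg ρ m k ζ‖ / 4))) := by
        rw [Real.exp_add]
        gcongr
        exact exp_nat_mul_two_le _
    _ = _ := by rw [← mul_assoc, ← mul_pow]; norm_num

lemma norm_one_sub_eta_le {ρ : ℝ} (hρ : 1 ≤ ρ) {m : ℕ} (hm : Even m) {a : ℕ → ℕ} {k : ℕ}
    (ha : 1 ≤ a k) {ζ : ℂ} (hζ : Good ρ m ζ) : ‖1 - eta ρ m a k ζ‖ ≤ 31 ^ a k := by
  have h1 := norm_eta_le hρ hm a k hζ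
  have h2 : Real.exp (-(a k * ‖omg ρ m k ζ‖ / 4)) ≤ 1 :=
    Real.exp_le_one_iff.2 (by have : 0 ≤ a k * ‖omg ρ m k ζ‖ := by positivity
                              linarith)
  have h3 : (30 : ℝ) ^ a k * Real.exp (-(a k * ‖omg ρ m k ζ‖ / 4)) ≤ 30 ^ a k * 1 := by gcongr
  have h4 : (1 : ℝ) + 30 ^ a k ≤ 31 ^ a k := by
    have := pow_add_pow_le (x := (1 : ℝ)) (y := 30) (by norm_num) (by norm_num)
      (n := a k) (by omega)
    norm_num at this
    linarith
  refine (norm_sub_le _ _).trans ?_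
  rw [norm_one]
  linarith

lemma norm_sfac_le {ρ : ℝ} (hρ : 1 ≤ ρ) {m : ℕ} (hm : Even m) {a : ℕ → ℕ} {k : ℕ}
    (ha : 1 ≤ a k) {ζ : ℂ} (hζ : Good ρ m ζ) :
    ‖sfac ρ m a k ζ‖ ≤ 31 ^ a k / (ρ ^ (k + 1)) ^ (m * a k) := by
  have hp : 0 < ρ ^ (k + 1) := by positivity
  rcases le_total (ρ ^ (k + 1)) ‖ζ‖ with h | h
  · have h1 := norm_one_sub_eta_le hρ hm ha hζ
    rw [one_sub_eta, norm_mul, norm_pow] at h1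
    rw [le_div_iff₀ (by positivity), mul_comm]
    exact le_trans (by gcongr) h1
  · have h1 := norm_omg_le_one hρ (m := m) h
    have h2 : -(omg ρ m k ζ).re ≤ 1 := by
      have := (abs_le.1 (Complex.abs_re_le_norm (omg ρ m k ζ))).1
      linarith
    have h3 : ((a k : ℂ) * omg ρ m k ζ).re = a k * (omg ρ m k ζ).re := by
      rw [← Complex.ofReal_natCast, Complex.re_ofReal_mul]
    have h4 := norm_rexp_le (a k) (a k * omg ρ m k ζ)
    rw [h3, norm_mul, Complex.norm_natCast] at h4
    have h5 : Real.exp (a k * ‖omg ρ m k ζ‖ - a k * (omg ρ m k ζ).re) ≤ (15 / 2) ^ a k := by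
      refine le_trans (Real.exp_le_exp.2 ?_) (exp_nat_mul_two_le _)
      rw [← mul_sub]
      gcongr
      linarith
    have h6 : (a k : ℝ) ^ a k / (a k).factorial ≤ 3 ^ a k := by
      refine (Real.pow_div_factorial_le_exp (a k : ℝ) (by positivity) (a k)).trans ?_
      rw [← mul_one (a k : ℝ), Real.exp_nat_mul]
      gcongr
      linarith [Real.exp_one_lt_d9]
    rw [sfac, norm_mul, norm_div, norm_pow, norm_pow, norm_pow, Complex.norm_natCast,
      Complex.norm_of_nonneg (by linarith : (0 : ℝ) ≤ ρ)]
    calc _ ≤ (a k : ℝ) ^ a k / (ρ ^ (k + 1)) ^ (m * a k) *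
          ((15 / 2) ^ a k / (a k).factorial) := by
          gcongr
          exact h4.trans (by gcongr)
      _ = ((a k : ℝ) ^ a k / (a k).factorial) * (15 / 2) ^ a k / (ρ ^ (k + 1)) ^ (m * a k) := by
          ring
      _ ≤ 3 ^ a k * (15 / 2) ^ a k / (ρ ^ (k + 1)) ^ (m * a k) := by gcongr
      _ ≤ _ := by
          rw [← mul_pow]
          gcongr
          norm_num

/-- The function `R` with `∏_{j ≤ K} (1 - eta_j) = ζ^(m a_K) R`. -/
def rfac (ρ : ℝ) (m : ℕ) (a : ℕ → ℕ) (K : ℕ) (ζ : ℂ) : ℂ :=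
  sfac ρ m a K ζ * ∏ j ∈ Finset.range K, (1 - eta ρ m a j ζ)

lemma prod_one_sub_eta {ρ : ℝ} (m : ℕ) (a : ℕ → ℕ) (K : ℕ) (ζ : ℂ) :
    ∏ j ∈ Finset.range (K + 1), (1 - eta ρ m a j ζ) = ζ ^ (m * a K) * rfac ρ m a K ζ := by
  rw [Finset.prod_range_succ, one_sub_eta m a K, rfac]
  ring

lemma differentiable_rfac (ρ : ℝ) (m : ℕ) (a : ℕ → ℕ) (K : ℕ) :
    Differentiable ℂ (rfac ρ m a K) := by
  unfold rfac
  refine (differentiable_sfac ρ m a K).mul ?_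
  refine Differentiable.fun_finsetProd fun j _ => ?_
  exact (differentiable_const _).sub (differentiable_eta ρ m a j)

/-- Telescoping: the pieces `eta_0`, `ζ^(m a_K) rfac_K eta_{K+1}` form a partition of unity. -/
lemma eta_add_sum {ρ : ℝ} (m : ℕ) (a : ℕ → ℕ) (K : ℕ) (ζ : ℂ) :
    eta ρ m a 0 ζ +
      ∑ k ∈ Finset.range K, ζ ^ (m * a k) * (rfac ρ m a k ζ * eta ρ m a (k + 1) ζ) =
    1 - ζ ^ (m * a K) * rfac ρ m a K ζ := by
  simp_rw [← mul_assoc, ← prod_one_sub_eta]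
  induction K with
  | zero => simp
  | succ K ih =>
    rw [Finset.sum_range_succ, ← add_assoc, ih, Finset.prod_range_succ _ (K + 1)]
    ring

namespace Admissible

variable {ρ Λ : ℝ} {m : ℕ} {a : ℕ → ℕ}

lemma norm_prod_le (h : Admissible ρ Λ m a) (hm : Even m) (K : ℕ) {ζ : ℂ} (hζ : Good ρ m ζ) :
    ‖∏ j ∈ Finset.range K, (1 - eta ρ m a j ζ)‖ ≤ 31 ^ a K := by
  rw [norm_prod]
  calc _ ≤ ∏ j ∈ Finset.range K, (31 : ℝ) ^ a j :=
        Finset.prod_le_prod (fun _ _ => norm_nonneg _) fun j _ =>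
          norm_one_sub_eta_le h.one_le_rho hm ((Nat.le_add_left 1 j).trans (h.lt_a j)) hζ
    _ = 31 ^ ∑ j ∈ Finset.range K, a j := Finset.prod_pow_eq_pow_sum _ _ _
    _ ≤ _ := pow_le_pow_right₀ (by norm_num) (h.sum_le K)

lemma norm_rfac_le (h : Admissible ρ Λ m a) (hm : Even m) (K : ℕ) {ζ : ℂ} (hζ : Good ρ m ζ) :
    ‖rfac ρ m a K ζ‖ ≤ 961 ^ a K / (ρ ^ (K + 1)) ^ (m * a K) := by
  have hp := h.rho_pow_pos (K + 1)
  rw [rfac, norm_mul]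
  calc _ ≤ 31 ^ a K / (ρ ^ (K + 1)) ^ (m * a K) * 31 ^ a K := by
        gcongr
        · exact norm_sfac_le h.one_le_rho hm ((Nat.le_add_left 1 K).trans (h.lt_a K)) hζ
        · exact h.norm_prod_le hm K hζ
    _ = _ := by rw [div_mul_eq_mul_div, ← mul_pow]; norm_num

lemma norm_exp_gsum_mul_eta_le (h : Admissible ρ Λ m a) (hm : Even m) (K : ℕ) {ζ : ℂ}
    (hζ : Good ρ m ζ) :
    ‖Complex.exp (gsum ρ m a ζ) * eta ρ m a K ζ‖ ≤
      1680 ^ a K * Real.exp (-(3 / 16 * (a K * ‖omg ρ m K ζ‖))) := by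
  have h1 := h.norm_gsum_le hm hζ K
  have h2 := norm_eta_le h.one_le_rho hm a K hζ
  have h3 := (Complex.norm_exp_le_exp_norm (gsum ρ m a ζ)).trans (Real.exp_le_exp.2 h1)
  have h4 : Real.exp (4 * a K) ≤ 56 ^ a K := by
    rw [mul_comm, Real.exp_nat_mul]
    gcongr
    have h4 : Real.exp 4 = Real.exp 2 * Real.exp 2 := by rw [← Real.exp_add]; norm_num
    rw [h4]
    have h5 := Real.exp_one_lt_d9.le
    have h6 : Real.exp 2 = Real.exp 1 * Real.exp 1 := by rw [← Real.exp_add]; norm_num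
    have h7 : Real.exp 2 ≤ 7.39 := by rw [h6]; nlinarith [Real.exp_pos 1]
    nlinarith [Real.exp_pos 2]
  rw [norm_mul]
  calc _ ≤ Real.exp (4 * a K + a K * ‖omg ρ m K ζ‖ / 16) *
        (30 ^ a K * Real.exp (-(a K * ‖omg ρ m K ζ‖ / 4))) := by gcongr
    _ = Real.exp (4 * a K) * 30 ^ a K * Real.exp (-(3 / 16 * (a K * ‖omg ρ m K ζ‖))) := by
        rw [Real.exp_add, mul_mul_mul_comm, ← Real.exp_add]
        ring_nf
    _ ≤ 56 ^ a K * 30 ^ a K * Real.exp (-(3 / 16 * (a K * ‖omg ρ m K ζ‖))) := by gcongr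
    _ = _ := by rw [← mul_pow]; norm_num

lemma good_of_im_le {Y : ℝ} (hY : 4 * m * Y ≤ ρ) {ζ : ℂ} (hζ : |ζ.im| ≤ Y) : Good ρ m ζ := by
  by_cases h : ‖ζ‖ ≤ ρ
  · exact Or.inr h
  · refine Or.inl (le_trans ?_ (hY.trans (not_le.1 h).le))
    gcongr

lemma one_add_sq_le (h : Admissible ρ Λ m a) (K : ℕ) (ζ : ℂ) :
    (1 + ζ.re ^ 2) * Real.exp (-(3 / 16 * (a K * ‖omg ρ m K ζ‖))) ≤ (240 * ρ ^ 2) ^ a K := by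
  have hρ := h.one_le_rho
  have ha : 1 ≤ a K := (Nat.le_add_left 1 K).trans (h.lt_a K)
  have hp := h.rho_pow_pos (K + 1)
  set t := ‖omg ρ m K ζ‖ with ht
  have ht0 : 0 ≤ t := norm_nonneg _
  have h1 : ‖ζ‖ ≤ ρ ^ (K + 1) * (1 + t) := by
    rw [← div_le_iff₀' hp]
    by_cases hc : ‖ζ‖ / ρ ^ (K + 1) ≤ 1
    · linarith
    · have : ‖ζ‖ / ρ ^ (K + 1) ≤ t := by
        rw [ht, norm_omg hρ]
        exact le_self_pow₀ (not_le.1 hc).le (by have := h.one_le_m; omega)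
      linarith
  have h2 : ζ.re ^ 2 ≤ (ρ ^ (K + 1) * (1 + t)) ^ 2 := by
    rw [← sq_abs ζ.re]
    gcongr
    exact (Complex.abs_re_le_norm ζ).trans h1
  have h3 : 1 ≤ (ρ ^ (K + 1) * (1 + t)) ^ 2 :=
    one_le_pow₀ (one_le_mul_of_one_le_of_one_le (one_le_pow₀ hρ) (by linarith))
  have h4 : 1 + ζ.re ^ 2 ≤ 2 * (ρ ^ 2) ^ a K * (1 + t) ^ 2 := by
    have : (ρ ^ (K + 1)) ^ 2 ≤ (ρ ^ 2) ^ a K := by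
      rw [← pow_mul, ← pow_mul]
      exact pow_le_pow_right₀ hρ (by have := h.lt_a K; omega)
    rw [mul_pow] at h2 h3
    have := mul_le_mul_of_nonneg_right this (sq_nonneg (1 + t))
    linarith
  have h5 : (1 + t) ^ 2 * Real.exp (-(3 / 16 * (a K * t))) ≤ 120 := by
    have h6 : Real.exp (-(3 / 16 * (a K * t))) ≤ Real.exp (-(3 / 16 * t)) := by
      refine Real.exp_le_exp.2 ?_
      have : (1 : ℝ) ≤ a K := by exact_mod_cast ha
      nlinarith
    have h7 := Real.quadratic_le_exp_of_nonneg (show 0 ≤ 3 / 16 * t by positivity)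
    calc _ ≤ (1 + t) ^ 2 * Real.exp (-(3 / 16 * t)) := by gcongr
      _ ≤ 120 := by
        rw [Real.exp_neg, ← div_eq_mul_inv, div_le_iff₀ (Real.exp_pos _)]
        nlinarith
  calc _ ≤ 2 * (ρ ^ 2) ^ a K * (1 + t) ^ 2 * Real.exp (-(3 / 16 * (a K * t))) := by gcongr
    _ = 2 * (ρ ^ 2) ^ a K * ((1 + t) ^ 2 * Real.exp (-(3 / 16 * (a K * t)))) := by ring
    _ ≤ 2 * (ρ ^ 2) ^ a K * 120 := by gcongr
    _ = 240 * (ρ ^ 2) ^ a K := by ring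
    _ ≤ 240 ^ a K * (ρ ^ 2) ^ a K := by
        gcongr
        exact le_self_pow₀ (by norm_num) (by omega)
    _ = _ := by rw [mul_pow]

/-- The `K`-th piece of the partition, divided by `ζ^(m a_K)` and multiplied by the multiplier. -/
lemma stripBound_piece (h : Admissible ρ Λ m a) (hm : Even m) {Y : ℝ} (hY : 4 * m * Y ≤ ρ)
    {L : ℕ} (hL : Λ ≤ L) (K : ℕ) :
    StripBound Y ((961 * (1680 * (240 * ρ ^ 2)) ^ L) ^ a K / (ρ ^ (K + 1)) ^ (m * a K))
      (fun ζ => rfac ρ m a K ζ * (Complex.exp (gsum ρ m a ζ) * eta ρ m a (K + 1) ζ)) := by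
  have hρ := h.one_le_rho
  refine ⟨(differentiable_rfac ρ m a K).mul
    (h.differentiable_gsum.cexp.mul (differentiable_eta ρ m a (K + 1))), fun ζ hζ => ?_⟩
  have hg := good_of_im_le hY hζ
  have hp := h.rho_pow_pos (K + 1)
  have h1 := h.norm_rfac_le hm K hg
  have h2 := h.norm_exp_gsum_mul_eta_le hm (K + 1) hg
  have h3 := h.one_add_sq_le (K + 1) ζ
  have h4 : a (K + 1) ≤ L * a K := by
    have : (a (K + 1) : ℝ) ≤ (L * a K : ℕ) := by
      push_cast
      exact (h.le_mul K).trans (by gcongr)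
    exact_mod_cast this
  rw [norm_mul]
  set u := Real.exp (-(3 / 16 * (a (K + 1) * ‖omg ρ m (K + 1) ζ‖)))
  calc _ ≤ 961 ^ a K / (ρ ^ (K + 1)) ^ (m * a K) * (1680 ^ a (K + 1) * u) * (1 + ζ.re ^ 2) := by
        gcongr
    _ = 961 ^ a K / (ρ ^ (K + 1)) ^ (m * a K) * (1680 ^ a (K + 1) * ((1 + ζ.re ^ 2) * u)) := by
        ring
    _ ≤ 961 ^ a K / (ρ ^ (K + 1)) ^ (m * a K) *
        (1680 ^ a (K + 1) * (240 * ρ ^ 2) ^ a (K + 1)) := by gcongr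
    _ = 961 ^ a K * (1680 * (240 * ρ ^ 2)) ^ a (K + 1) / (ρ ^ (K + 1)) ^ (m * a K) := by
        rw [← mul_pow]; ring
    _ ≤ 961 ^ a K * (1680 * (240 * ρ ^ 2)) ^ (L * a K) / (ρ ^ (K + 1)) ^ (m * a K) := by
        gcongr
        nlinarith
    _ = _ := by rw [mul_pow 961, pow_mul (1680 * (240 * ρ ^ 2))]

lemma stripBdd_rfac (h : Admissible ρ Λ m a) (hm : Even m) (k : ℕ) :
    StripBdd (rfac ρ m a k) :=
  stripBdd_of_eventually (differentiable_rfac ρ m a k) fun Y =>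
    ⟨4 * m * Y, _, fun ζ hζ hR => h.norm_rfac_le hm k (Or.inl (le_trans (by gcongr) hR))⟩

lemma stripDecay_exp_gsum_mul_eta (h : Admissible ρ Λ m a) (hm : Even m) (k : ℕ) :
    StripDecay (fun ζ => Complex.exp (gsum ρ m a ζ) * eta ρ m a k ζ) := by
  have hρ := h.one_le_rho
  have hp := h.rho_pow_pos (k + 1)
  refine stripDecay_of_eventually
    (h.differentiable_gsum.cexp.mul (differentiable_eta ρ m a k)) fun Y n => ?_
  refine ⟨max (4 * m * Y) (ρ ^ (k + 1)),
    (ρ ^ (k + 1)) ^ n * (1680 ^ a k * (n.factorial * 16 ^ n)), fun ζ hζ hR => ?_⟩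
  have h1 := h.norm_exp_gsum_mul_eta_le hm k
    (Or.inl (le_trans (by gcongr) ((le_max_left _ _).trans hR)))
  have hge := (le_max_right _ _).trans hR
  set t := ‖omg ρ m k ζ‖ with ht
  have ht0 : 0 ≤ t := norm_nonneg _
  have h2 : ‖ζ‖ ≤ ρ ^ (k + 1) * t := by
    rw [← div_le_iff₀' hp, ht, norm_omg hρ]
    exact le_self_pow₀ ((one_le_div hp).2 hge) (by have := h.one_le_m; omega)
  have h3 : t ^ n * Real.exp (-(3 / 16 * (a k * t))) ≤ n.factorial * 16 ^ n := by
    have ha : (1 : ℝ) ≤ a k := by exact_mod_cast (Nat.le_add_left 1 k).trans (h.lt_a k)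
    have h4 := Real.pow_div_factorial_le_exp (t / 16) (by positivity) n
    rw [div_le_iff₀ (by positivity), div_pow, div_le_iff₀ (by positivity)] at h4
    have h5 : Real.exp (t / 16) ≤ Real.exp (3 / 16 * (a k * t)) :=
      Real.exp_le_exp.2 (by nlinarith)
    rw [Real.exp_neg, ← div_eq_mul_inv, div_le_iff₀ (Real.exp_pos _)]
    calc _ ≤ Real.exp (t / 16) * n.factorial * 16 ^ n := h4
      _ ≤ Real.exp (3 / 16 * (a k * t)) * n.factorial * 16 ^ n := by gcongr
      _ = _ := by ring
  calc _ ≤ (ρ ^ (k + 1) * t) ^ n * (1680 ^ a k * Real.exp (-(3 / 16 * (a k * t)))) := by gcongr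
    _ = (ρ ^ (k + 1)) ^ n * (1680 ^ a k * (t ^ n * Real.exp (-(3 / 16 * (a k * t))))) := by
        rw [mul_pow]; ring
    _ ≤ _ := by gcongr

end Admissible

/-- Functions on the line in the Beurling class with exponential decay of all derivatives. -/
def BeuLine (M : ℕ → ℝ) (ψ : ℝ → ℂ) : Prop :=
  ContDiff ℝ (⊤ : ℕ∞) ψ ∧ ∀ h : ℝ, 0 < h → ∀ n : ℕ, ∃ C : ℝ, ∀ (p : ℕ) (x : ℝ),
    h ^ p * ‖iteratedDeriv p ψ x‖ * Real.exp (n * |x|) ≤ C * M p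

/-- Unbounded sequences of naturals growing by at most one at each step. -/
def SlowSeq (l : ℕ → ℕ) : Prop :=
  (∀ k, l k ≤ l (k + 1) ∧ l (k + 1) ≤ l k + 1) ∧ ∀ n, ∃ k₀, ∀ k ≥ k₀, n ≤ l k

lemma pow_two_mul_count_le {M : ℕ → ℝ} {C₀ H : ℝ} (hM : IsWeightSeq M) (h2 : HasM2 M C₀ H)
    {t ρ : ℝ} (ht : 1 ≤ t) (hρ : C₀ * H ^ 3 ≤ ρ) (hρ1 : 1 ≤ ρ) (j : ℕ) :
    2 ^ j * count M t ≤ count M (ρ ^ j * t) := by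
  induction j with
  | zero => simp
  | succ j ih =>
    have := two_mul_count_le hM h2 (t := ρ ^ j * t)
      (one_le_mul_of_one_le_of_one_le (one_le_pow₀ hρ1) ht) hρ
    rw [pow_succ', pow_succ', mul_assoc, mul_assoc]
    omega

lemma HasM2.one_le {M : ℕ → ℝ} {C₀ H : ℝ} (h2 : HasM2 M C₀ H) : 1 ≤ C₀ * H ^ 3 :=
  one_le_mul_of_one_le_of_one_le h2.1 (one_le_pow₀ h2.2.1)

/-- A function decaying like the associated function on strips has a kernel in the class. -/
lemma beuLine_fker {M : ℕ → ℝ} {C₀ H : ℝ} (hM : IsWeightSeq M) (h2 : HasM2 M C₀ H) {Q : ℂ → ℂ}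
    (hd : Differentiable ℂ Q)
    (hQ : ∀ Y h : ℝ, 0 < h → ∃ C : ℝ, ∀ (p : ℕ) (ζ : ℂ), |ζ.im| ≤ Y →
      (h * ‖ζ‖) ^ p * ‖Q ζ‖ ≤ C * M p) : StripDecay Q ∧ BeuLine M (fker Q) := by
  have hdec : StripDecay Q := ⟨hd, fun Y n => by
    obtain ⟨C, hC⟩ := hQ Y 1 one_pos
    exact ⟨C * M n, fun ζ hζ => by simpa using hC n ζ hζ⟩⟩
  refine ⟨hdec, contDiff_fker hdec, fun h hh n => ?_⟩
  obtain ⟨hC₀, hH, h2'⟩ := h2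
  have hH0 : 0 < H := by linarith
  set b := 2 * Real.pi * h * H + 1 with hb
  have hb1 : 1 ≤ b := by have : 0 ≤ 2 * Real.pi * h * H := by positivity
                         linarith
  obtain ⟨C, hC⟩ := hQ n b (by linarith)
  have hC0 : 0 ≤ C := by
    have := hC 0 0 (by simp)
    rw [hM.2.1, pow_zero, one_mul, mul_one] at this
    exact (norm_nonneg _).trans this
  have hM2 := hM.1 2
  refine ⟨Real.pi * (C + C * C₀ * H ^ 2 * M 2), fun p x => ?_⟩
  have hMp := hM.1 p
  rw [iteratedDeriv_fker hdec]
  have hsb : StripBound n ((C + C * C₀ * H ^ 2 * M 2) * M p / h ^ p)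
      (fun ζ => (2 * Real.pi * Complex.I * ζ) ^ p * Q ζ) := by
    refine ⟨by fun_prop, fun ζ hζ => ?_⟩
    have h1 := hC p ζ hζ
    have h2 := hC (p + 2) ζ hζ
    have h3 := h2' p 2
    have h4 : ζ.re ^ 2 ≤ ‖ζ‖ ^ 2 := by
      rw [← sq_abs ζ.re]; gcongr; exact Complex.abs_re_le_norm ζ
    have h5 : (2 * Real.pi * h * H) ^ p ≤ b ^ p := by gcongr; linarith
    have h6 : b ^ p ≤ b ^ (p + 2) := pow_le_pow_right₀ hb1 (by omega)
    have h7 : (2 * Real.pi * h) ^ p ≤ (2 * Real.pi * h * H) ^ p :=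
      pow_le_pow_left₀ (by positivity) (le_mul_of_one_le_right (by positivity) hH) _
    have e1 : (2 * Real.pi * h) ^ p * (‖ζ‖ ^ p * ‖Q ζ‖) ≤ C * M p := by
      refine le_trans ?_ h1
      rw [mul_pow b, mul_assoc (b ^ p)]
      exact mul_le_mul_of_nonneg_right (h7.trans h5) (by positivity)
    have e2 : (2 * Real.pi * h) ^ p * (‖ζ‖ ^ (p + 2) * ‖Q ζ‖) ≤ C * C₀ * H ^ 2 * M 2 * M p := by
      have : H ^ p * ((2 * Real.pi * h) ^ p * (‖ζ‖ ^ (p + 2) * ‖Q ζ‖)) ≤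
          H ^ p * (C * C₀ * H ^ 2 * M 2 * M p) := by
        calc _ = (2 * Real.pi * h * H) ^ p * (‖ζ‖ ^ (p + 2) * ‖Q ζ‖) := by rw [mul_pow _ H]; ring
          _ ≤ b ^ (p + 2) * (‖ζ‖ ^ (p + 2) * ‖Q ζ‖) := by gcongr; exact h5.trans h6
          _ = (b * ‖ζ‖) ^ (p + 2) * ‖Q ζ‖ := by rw [mul_pow]; ring
          _ ≤ C * M (p + 2) := h2
          _ ≤ C * (C₀ * H ^ (p + 2) * M p * M 2) := by gcongr
          _ = _ := by ring
      exact le_of_mul_le_mul_left this (by positivity)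
    have hn : ‖(2 * Real.pi * Complex.I * ζ) ^ p * Q ζ‖ = (2 * Real.pi) ^ p * (‖ζ‖ ^ p * ‖Q ζ‖) := by
      simp [mul_pow, abs_of_pos Real.pi_pos, mul_assoc]
    rw [le_div_iff₀ (by positivity), hn]
    calc _ = (2 * Real.pi * h) ^ p * (‖ζ‖ ^ p * ‖Q ζ‖) * (1 + ζ.re ^ 2) := by
          rw [mul_pow _ h]; ring
      _ ≤ (2 * Real.pi * h) ^ p * (‖ζ‖ ^ p * ‖Q ζ‖) * (1 + ‖ζ‖ ^ 2) := by gcongr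
      _ = (2 * Real.pi * h) ^ p * (‖ζ‖ ^ p * ‖Q ζ‖) +
          (2 * Real.pi * h) ^ p * (‖ζ‖ ^ (p + 2) * ‖Q ζ‖) := by ring
      _ ≤ _ := by linarith
  have hk := norm_fker_le (Nat.cast_nonneg n) hsb x
  set K := (C + C * C₀ * H ^ 2 * M 2) with hK
  have hK0 : 0 ≤ K := by positivity
  calc _ ≤ h ^ p * (Real.pi * (K * M p / h ^ p) * Real.exp (-(2 * Real.pi * n * |x|))) *
        Real.exp (n * |x|) := by gcongr
    _ = Real.pi * K * M p * (Real.exp (-(2 * Real.pi * n * |x|)) * Real.exp (n * |x|)) := by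
        field_simp
    _ ≤ Real.pi * K * M p * 1 := by
        gcongr
        rw [← Real.exp_add, Real.exp_le_one_iff]
        have : 0 ≤ n * |x| := by positivity
        nlinarith [Real.pi_gt_three]
    _ = _ := by ring

lemma exists_admissible_parameters {M : ℕ → ℝ} {C₀ H : ℝ} (hM : IsWeightSeq M)
    (h2 : HasM2 M C₀ H) (h2s : M2star M) (Y : ℝ) :
    ∃ (r L : ℕ) (ρ : ℝ), Even (2 ^ r) ∧ 2 ≤ ρ ∧ C₀ * H ^ 3 ≤ ρ ∧ 4 * (2 ^ r : ℕ) * Y ≤ ρ ∧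
      ∀ l, SlowSeq l → Admissible ρ L (2 ^ r) fun k => count M (ρ ^ (k + 1 + l k)) := by
  obtain ⟨N, hN, hdouble⟩ := count_two_mul_le hM h2s
  obtain ⟨r, hr⟩ : ∃ r : ℕ, 100 * N ^ 2 ≤ 2 ^ (2 ^ (r + 1)) := by
    refine ⟨100 * N ^ 2, ?_⟩
    have h1 : ∀ n : ℕ, n ≤ 2 ^ n := fun n => Nat.lt_two_pow_self.le
    calc 100 * N ^ 2 ≤ 100 * N ^ 2 + 1 := by omega
      _ ≤ 2 ^ (100 * N ^ 2 + 1) := h1 _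
      _ ≤ _ := h1 _
  obtain ⟨s, hs⟩ := pow_unbounded_of_one_lt (max (C₀ * H ^ 3) (4 * (2 ^ (r + 1) : ℕ) * Y))
    (one_lt_two (α := ℝ))
  have hs' : (2 : ℝ) ^ s ≤ 2 ^ (s + 1) := pow_le_pow_right₀ one_le_two (by omega)
  have hρ2 : (2 : ℝ) ≤ 2 ^ (s + 1) := by
    simpa using pow_le_pow_right₀ (one_le_two (α := ℝ)) (show 1 ≤ s + 1 by omega)
  have hρ1 : (1 : ℝ) ≤ 2 ^ (s + 1) := by linarith
  have hρD : C₀ * H ^ 3 ≤ 2 ^ (s + 1) := ((le_max_left _ _).trans hs.le).trans hs'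
  refine ⟨r + 1, N ^ (2 * (s + 1)), 2 ^ (s + 1), ⟨2 ^ r, by rw [pow_succ]; ring⟩, hρ2, hρD,
    ((le_max_right _ _).trans hs.le).trans hs', fun l hl => ?_⟩
  refine ⟨hρ1, Nat.one_le_two_pow, by exact_mod_cast Nat.one_le_pow _ _ hN, ?_, ?_, fun k => ?_,
    fun k => ?_⟩
  · have h1 : 100 * N ^ (2 * (s + 1)) ≤ (2 ^ (s + 1)) ^ 2 ^ (r + 1) := by
      calc 100 * N ^ (2 * (s + 1)) ≤ 100 ^ (s + 1) * (N ^ 2) ^ (s + 1) := by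
            rw [pow_mul]
            gcongr
            exact Nat.le_self_pow (by omega) _
        _ = (100 * N ^ 2) ^ (s + 1) := by rw [mul_pow]
        _ ≤ (2 ^ 2 ^ (r + 1)) ^ (s + 1) := by gcongr
        _ = _ := by rw [← pow_mul, ← pow_mul, mul_comm]
    exact_mod_cast h1
  · exact (count_spec hM (one_le_pow₀ hρ1)).1
  · refine (two_mul_count_le hM h2 (one_le_pow₀ hρ1) hρD).trans
      (count_mono hM (one_le_mul_of_one_le_of_one_le hρ1 (one_le_pow₀ hρ1)) ?_)
    rw [← pow_succ']
    exact pow_le_pow_right₀ hρ1 (by have := (hl.1 k).1; omega)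
  · have h1 : (2 ^ (s + 1) : ℝ) ^ (k + 1 + 1 + l (k + 1)) ≤
        2 ^ (2 * (s + 1)) * (2 ^ (s + 1)) ^ (k + 1 + l k) := by
      rw [show 2 * (s + 1) = (s + 1) * 2 by ring, pow_mul, ← pow_add]
      exact pow_le_pow_right₀ hρ1 (by have := (hl.1 k).2; omega)
    have h3 := (count_mono hM (one_le_pow₀ hρ1) h1).trans
      (count_two_pow_mul_le hdouble (2 * (s + 1)) (one_le_pow₀ hρ1))
    exact_mod_cast h3

lemma exp_neg_gsum_decay {M : ℕ → ℝ} {C₀ H : ℝ} (hM : IsWeightSeq M) (h2 : HasM2 M C₀ H)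
    {ρ L : ℝ} {m : ℕ} (hm : Even m) (hρ2 : 2 ≤ ρ) (hρD : C₀ * H ^ 3 ≤ ρ) {l : ℕ → ℕ}
    (hl : SlowSeq l) (ha : Admissible ρ L m fun k => count M (ρ ^ (k + 1 + l k)))
    (Y h : ℝ) (hh : 0 < h) :
    ∃ C : ℝ, ∀ (p : ℕ) (ζ : ℂ), |ζ.im| ≤ Y →
      (h * ‖ζ‖) ^ p * ‖Complex.exp (-gsum ρ m (fun k => count M (ρ ^ (k + 1 + l k))) ζ)‖ ≤
        C * M p := by
  have hρ1 : 1 ≤ ρ := by linarith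
  set a := fun k => count M (ρ ^ (k + 1 + l k)) with hadef
  set D := C₀ * H ^ 3 with hD
  have hD1 : 1 ≤ D := h2.one_le
  obtain ⟨n, hn⟩ := pow_unbounded_of_one_lt h (show 1 < ρ by linarith)
  obtain ⟨J, hJ⟩ := pow_unbounded_of_one_lt (4 * D) (one_lt_two (α := ℝ))
  obtain ⟨k₁, hk₁⟩ := hl.2 (J + n + 1)
  set R := max (4 * m * Y) (ρ ^ (k₁ + 1)) with hR
  have hR1 : 1 ≤ R := (one_le_pow₀ hρ1).trans (le_max_right _ _)
  have hcont : Continuous fun ζ => ‖Complex.exp (-gsum ρ m a ζ)‖ :=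
    ha.differentiable_gsum.neg.cexp.continuous.norm
  obtain ⟨B, hB⟩ := (isCompact_closedBall (0 : ℂ) R).bddAbove_image hcont.continuousOn
  set t₀ := max (h * R) 1
  refine ⟨max 1 (D ^ count M t₀ * B), fun p ζ hζ => ?_⟩
  have hMp := hM.1 p
  rcases le_total ‖ζ‖ R with hc | hc
  · have h1 : ‖Complex.exp (-gsum ρ m a ζ)‖ ≤ B := hB ⟨ζ, by simpa using hc, rfl⟩
    have h3 := pow_le_pow_count_mul_weight hM h2 (le_max_right (h * R) 1) p
    calc _ ≤ t₀ ^ p * B := by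
          gcongr
          exact le_trans (by gcongr) (le_max_left _ _)
      _ ≤ D ^ count M t₀ * M p * B := by
          have hB0 := (norm_nonneg _).trans h1
          gcongr
      _ = D ^ count M t₀ * B * M p := by ring
      _ ≤ _ := by
          gcongr
          exact le_max_right _ _
  · have hz1 : 1 ≤ ‖ζ‖ := hR1.trans hc
    obtain ⟨K', hK1, hK2⟩ := exists_nat_pow_near hz1 (show 1 < ρ by linarith)
    have hK : k₁ + 1 ≤ K' := by
      have h1 : ρ ^ (k₁ + 1) < ρ ^ (K' + 1) := ((le_max_right _ _).trans hc).trans_lt hK2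
      have := (pow_lt_pow_iff_right₀ (show 1 < ρ by linarith)).1 h1
      omega
    obtain ⟨K, rfl⟩ : ∃ K, K' = K + 1 := ⟨K' - 1, by omega⟩
    have hg := ha.le_re_gsum hm (le_trans (by gcongr) ((le_max_left _ _).trans hc)) hK1
    have hlK := hk₁ K (by omega)
    set t := ρ ^ (n + K + 2) with ht
    have ht1 : 1 ≤ t := one_le_pow₀ hρ1
    have h3 : 2 ^ J * count M t ≤ a K := by
      refine (pow_two_mul_count_le hM h2 ht1 hρD hρ1 J).trans (count_mono hM
        (one_le_mul_of_one_le_of_one_le (one_le_pow₀ hρ1) ht1) ?_)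
      rw [ht, ← pow_add]
      exact pow_le_pow_right₀ hρ1 (by omega)
    have h4 := pow_le_pow_count_mul_weight hM h2 ht1 p
    have h5 : D ^ count M t ≤ Real.exp (a K / 4) := by
      have h6 : D ≤ Real.exp D := by linarith [Real.add_one_le_exp D]
      calc D ^ count M t ≤ Real.exp D ^ count M t := by gcongr
        _ = Real.exp (count M t * D) := by rw [Real.exp_nat_mul]
        _ ≤ _ := by
          refine Real.exp_le_exp.2 ?_
          have h7 : ((2 ^ J * count M t : ℕ) : ℝ) ≤ a K := Nat.cast_le.2 h3
          push_cast at h7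
          have h8 : (0 : ℝ) ≤ count M t := Nat.cast_nonneg _
          nlinarith
    have h6 : h * ‖ζ‖ ≤ t := by
      rw [ht, show n + K + 2 = n + (K + 1 + 1) by ring, pow_add]
      gcongr
    calc _ ≤ t ^ p * Real.exp (-(a K / 4)) := by
          rw [Complex.norm_exp, Complex.neg_re]
          gcongr
      _ ≤ D ^ count M t * M p * Real.exp (-(a K / 4)) := by gcongr
      _ ≤ Real.exp (a K / 4) * M p * Real.exp (-(a K / 4)) := by gcongr
      _ = M p := by rw [mul_right_comm, ← Real.exp_add]; simp
      _ ≤ _ := le_mul_of_one_le_left hMp.le (le_max_left _ _)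

/-- The data produced by the construction of the multiplier and the partition of unity. -/
structure SpectralPartition (M : ℕ → ℝ) (Y c ρ : ℝ) (l : ℕ → ℕ) where
  Q : ℂ → ℂ
  lead : ℂ → ℂ
  piece : ℕ → ℂ → ℂ
  rest : ℕ → ℂ → ℂ
  deg : ℕ → ℕ
  bnd : ℕ → ℝ
  decay_Q : StripDecay Q
  beuLine_Q : BeuLine M (fker Q)
  decay_lead : StripDecay lead
  decay_piece : ∀ k, StripDecay (piece k)
  bound_piece : ∀ k, StripBound Y (bnd k) (piece k)
  bdd_rest : ∀ k, StripBdd (rest k)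
  norm_rest_le : ∀ k ζ, |ζ.im| ≤ Y → ‖rest k ζ‖ ≤ bnd k
  lt_deg : ∀ k, k < deg k
  bnd_mul_le : ∀ k, bnd k * M (deg k) ≤ (c * ρ ^ l k) ^ deg k
  sum_eq : ∀ K ζ, Q ζ * lead ζ + ∑ k ∈ Finset.range K, ζ ^ deg k * (Q ζ * piece k ζ) =
    1 - ζ ^ deg K * rest K ζ
  Q_zero_ne : Q 0 ≠ 0

lemma exists_spectralPartition {M : ℕ → ℝ} (hM : IsWeightSeq M) (hM2 : M2 M) (h2s : M2star M)
    (Y : ℝ) : ∃ c ρ : ℝ, 1 ≤ c ∧ 2 ≤ ρ ∧ ∀ l, SlowSeq l → Nonempty (SpectralPartition M Y c ρ l) := by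
  obtain ⟨C₀, H, h2⟩ := hM2
  obtain ⟨r, L, ρ, hm, hρ2, hρD, hY, hadm⟩ := exists_admissible_parameters hM h2 h2s Y
  have hρ1 : 1 ≤ ρ := by linarith
  have hD1 := h2.one_le
  set D := C₀ * H ^ 3 with hD
  set b := 961 * (1680 * (240 * ρ ^ 2)) ^ L with hb
  have h240 : 1 ≤ 1680 * (240 * ρ ^ 2) := by nlinarith
  have hb961 : 961 ≤ b := le_mul_of_one_le_right (by norm_num) (one_le_pow₀ h240)
  refine ⟨b * D ^ r, ρ, one_le_mul_of_one_le_of_one_le (by linarith) (one_le_pow₀ hD1), hρ2,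
    fun l hl => ?_⟩
  have ha := hadm l hl
  have hdecay := exp_neg_gsum_decay hM h2 hm hρ2 hρD hl ha
  obtain ⟨hQ1, hQ2⟩ := beuLine_fker hM h2 ha.differentiable_gsum.neg.cexp hdecay
  set a := fun k => count M (ρ ^ (k + 1 + l k)) with hadef
  have hcancel : ∀ ζ u : ℂ, Complex.exp (-gsum ρ (2 ^ r) a ζ) *
      (Complex.exp (gsum ρ (2 ^ r) a ζ) * u) = u := fun ζ u => by
    rw [← mul_assoc, ← Complex.exp_add]; simp
  refine ⟨{
    Q := fun ζ => Complex.exp (-gsum ρ (2 ^ r) a ζ)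
    lead := fun ζ => Complex.exp (gsum ρ (2 ^ r) a ζ) * eta ρ (2 ^ r) a 0 ζ
    piece := fun k ζ => rfac ρ (2 ^ r) a k ζ *
      (Complex.exp (gsum ρ (2 ^ r) a ζ) * eta ρ (2 ^ r) a (k + 1) ζ)
    rest := rfac ρ (2 ^ r) a
    deg := fun k => 2 ^ r * a k
    bnd := fun k => b ^ a k / (ρ ^ (k + 1)) ^ (2 ^ r * a k)
    decay_Q := hQ1
    beuLine_Q := hQ2
    decay_lead := ha.stripDecay_exp_gsum_mul_eta hm 0
    decay_piece := fun k => (ha.stripBdd_rfac hm k).mul_decay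
      (ha.stripDecay_exp_gsum_mul_eta hm (k + 1))
    bound_piece := fun k => ha.stripBound_piece hm hY le_rfl k
    bdd_rest := fun k => ha.stripBdd_rfac hm k
    norm_rest_le := fun k ζ hζ => (ha.norm_rfac_le hm k
      (Admissible.good_of_im_le hY hζ)).trans (by gcongr)
    lt_deg := fun k => (ha.lt_a k).trans (Nat.le_mul_of_pos_left _ (by positivity))
    bnd_mul_le := fun k => ?_
    sum_eq := fun K ζ => ?_
    Q_zero_ne := Complex.exp_ne_zero _ }⟩
  · have h1 := weight_two_pow_mul_count_le hM h2 (t := ρ ^ (k + 1 + l k)) (one_le_pow₀ hρ1) r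
    have hp := ha.rho_pow_pos (k + 1)
    have h3 : b ^ a k ≤ b ^ (2 ^ r * a k) :=
      pow_le_pow_right₀ (by linarith) (Nat.le_mul_of_pos_left _ (by positivity))
    have hMp := hM.1 (2 ^ r * a k)
    calc _ ≤ b ^ (2 ^ r * a k) / (ρ ^ (k + 1)) ^ (2 ^ r * a k) *
          (D ^ r * ρ ^ (k + 1 + l k)) ^ (2 ^ r * a k) := by gcongr
      _ = (b * D ^ r * ρ ^ l k) ^ (2 ^ r * a k) := by
          rw [← div_pow, ← mul_pow, pow_add ρ (k + 1) (l k)]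
          congr 1
          field_simp
  · have h1 := eta_add_sum (ρ := ρ) (2 ^ r) a K ζ
    rw [← h1]
    simp only [hcancel]
    congr 1
    refine Finset.sum_congr rfl fun k _ => ?_
    rw [mul_left_comm (Complex.exp _) (rfac ρ (2 ^ r) a k ζ), hcancel]

/-! ### Multi-indexed iteration of operators -/

/-- Iterate a family of operators according to a multi-index. -/
def multiIter {X : Type*} {d : ℕ} (D : Fin d → X → X) (α : Fin d → ℕ) (x : X) : X :=
  (List.finRange d).foldr (fun j y => (D j)^[α j] y) x

/-- A set stable under a family of operators that commute on it. -/
structure StableSet {X : Type*} {d : ℕ} (D : Fin d → X → X) (S : Set X) : Prop where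
  mem : ∀ x ∈ S, ∀ j, D j x ∈ S
  comm : ∀ x ∈ S, ∀ i j, D i (D j x) = D j (D i x)

lemma iterate_semiconj_on {X Y : Type*} {D : X → X} {D' : Y → Y} {S : Set X}
    (hS : ∀ x ∈ S, D x ∈ S) (φ : X → Y) (hφ : ∀ x ∈ S, φ (D x) = D' (φ x)) (n : ℕ) :
    ∀ x ∈ S, D^[n] x ∈ S ∧ φ (D^[n] x) = D'^[n] (φ x) := by
  induction n with
  | zero => exact fun x hx => ⟨hx, rfl⟩
  | succ n ih =>
    intro x hx
    rw [Function.iterate_succ_apply, Function.iterate_succ_apply, ← hφ x hx]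
    exact ih _ (hS x hx)

lemma foldr_iterate_semiconj {X Y : Type*} {d : ℕ} {D : Fin d → X → X} {D' : Fin d → Y → Y}
    {S : Set X} (hS : ∀ x ∈ S, ∀ j, D j x ∈ S) (φ : X → Y)
    (hφ : ∀ x ∈ S, ∀ j, φ (D j x) = D' j (φ x)) (α : Fin d → ℕ) (s : List (Fin d)) :
    ∀ x ∈ S, s.foldr (fun j y => (D j)^[α j] y) x ∈ S ∧
      φ (s.foldr (fun j y => (D j)^[α j] y) x) = s.foldr (fun j y => (D' j)^[α j] y) (φ x) := by
  induction s with
  | nil => exact fun x hx => ⟨hx, rfl⟩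
  | cons a s ih =>
    intro x hx
    have h1 := ih x hx
    have h2 := iterate_semiconj_on (fun x hx => hS x hx a) φ (fun x hx => hφ x hx a) (α a) _ h1.1
    exact ⟨h2.1, by rw [List.foldr_cons, h2.2, h1.2, List.foldr_cons]⟩

lemma multiIter_mem {X : Type*} {d : ℕ} {D : Fin d → X → X} {S : Set X}
    (hS : ∀ x ∈ S, ∀ j, D j x ∈ S) (α : Fin d → ℕ) {x : X} (hx : x ∈ S) :
    multiIter D α x ∈ S :=
  (foldr_iterate_semiconj (D' := D) hS id (fun _ _ _ => rfl) α _ x hx).1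

lemma multiIter_semiconj {X Y : Type*} {d : ℕ} {D : Fin d → X → X} {D' : Fin d → Y → Y}
    {S : Set X} (hS : ∀ x ∈ S, ∀ j, D j x ∈ S) (φ : X → Y)
    (hφ : ∀ x ∈ S, ∀ j, φ (D j x) = D' j (φ x)) (α : Fin d → ℕ) {x : X} (hx : x ∈ S) :
    φ (multiIter D α x) = multiIter D' α (φ x) :=
  (foldr_iterate_semiconj hS φ hφ α _ x hx).2

namespace StableSet

variable {X : Type*} {d : ℕ} {D : Fin d → X → X} {S : Set X}

lemma apply_multiIter (h : StableSet D S) (j : Fin d) (α : Fin d → ℕ) {x : X} (hx : x ∈ S) :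
    D j (multiIter D α x) = multiIter D α (D j x) :=
  multiIter_semiconj h.mem (D j) (fun x hx i => h.comm x hx j i) α hx

lemma foldr_add_single (h : StableSet D S) (j : Fin d) (α : Fin d → ℕ) {x : X} (hx : x ∈ S)
    (s : List (Fin d)) (hs : s.Nodup) :
    s.foldr (fun i y => (D i)^[(α + Pi.single j 1 : Fin d → ℕ) i] y) x =
      if j ∈ s then D j (s.foldr (fun i y => (D i)^[α i] y) x)
      else s.foldr (fun i y => (D i)^[α i] y) x := by
  induction s with
  | nil => simp
  | cons a s ih =>
    have hmem := (foldr_iterate_semiconj (D' := D) h.mem id (fun _ _ _ => rfl) α s x hx).1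
    rw [List.nodup_cons] at hs
    rw [List.foldr_cons, ih hs.2, List.foldr_cons]
    by_cases haj : a = j
    · subst haj
      simp [hs.1, Function.iterate_succ_apply']
    · have h1 : (α + Pi.single j 1 : Fin d → ℕ) a = α a := by simp [haj]
      rw [h1]
      have h2 : (j ∈ a :: s) ↔ j ∈ s := by simp [Ne.symm haj]
      by_cases hj : j ∈ s
      · simp only [h2, hj, if_true]
        exact (iterate_semiconj_on (D' := D a) (fun x hx => h.mem x hx a) (D j)
          (fun x hx => h.comm x hx j a) (α a) _ hmem).2.symm
      · simp only [h2, hj, if_false]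

lemma multiIter_add_single (h : StableSet D S) (j : Fin d) (α : Fin d → ℕ) {x : X} (hx : x ∈ S) :
    multiIter D (α + Pi.single j 1) x = D j (multiIter D α x) := by
  have := h.foldr_add_single j α hx _ (List.nodup_finRange d)
  simpa only [List.mem_finRange, if_true, multiIter] using this

lemma multiIter_apply (h : StableSet D S) (j : Fin d) (α : Fin d → ℕ) {x : X} (hx : x ∈ S) :
    multiIter D α (D j x) = multiIter D (α + Pi.single j 1) x := by
  rw [h.multiIter_add_single j α hx, h.apply_multiIter j α hx]

lemma multiIter_add_nsmul_single (h : StableSet D S) (j : Fin d) (α : Fin d → ℕ) {x : X}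
    (hx : x ∈ S) (n : ℕ) :
    multiIter D (α + n • Pi.single j 1) x = (D j)^[n] (multiIter D α x) := by
  induction n with
  | zero => simp
  | succ n ih =>
    rw [succ_nsmul, ← add_assoc, h.multiIter_add_single j _ hx, ih, Function.iterate_succ_apply']

end StableSet

lemma multiIter_zero {X : Type*} {d : ℕ} (D : Fin d → X → X) (x : X) : multiIter D 0 x = x := by
  unfold multiIter
  induction List.finRange d with
  | nil => rfl
  | cons a s ih => simp

lemma msize_add_nsmul_single {d : ℕ} (α : Fin d → ℕ) (j : Fin d) (n : ℕ) :
    msize (α + n • Pi.single j 1) = msize α + n := by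
  simp [msize, Finset.sum_add_distrib, ← Finset.mul_sum]

lemma pD_eq_multiIter {d : ℕ} {E : Type*} [NormedAddCommGroup E] [NormedSpace ℝ E]
    (α : Fin d → ℕ) (f : Rd d → E) : pD α f = multiIter dop α f := rfl

/-! ### Smooth functions -/

/-- The standard basis vectors. -/
abbrev bv {d : ℕ} (j : Fin d) : Rd d := EuclideanSpace.single j (1 : ℝ)

lemma sum_smul_bv {d : ℕ} (x : Rd d) : x = ∑ j, x j • bv j := by
  ext i
  simp [Finset.sum_apply, Pi.single_apply]

lemma contDiff_dop {d : ℕ} {E : Type*} [NormedAddCommGroup E] [NormedSpace ℝ E] {f : Rd d → E}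
    (hf : ContDiff ℝ (⊤ : ℕ∞) f) (j : Fin d) : ContDiff ℝ (⊤ : ℕ∞) (dop j f) := by
  have : ContDiff ℝ (⊤ : ℕ∞) (fderiv ℝ f) := hf.fderiv_right (by simp)
  exact this.clm_apply contDiff_const

lemma stableSet_dop {d : ℕ} {E : Type*} [NormedAddCommGroup E] [NormedSpace ℝ E] :
    StableSet (dop (d := d) (E := E)) {f | ContDiff ℝ (⊤ : ℕ∞) f} := by
  refine ⟨fun f hf j => contDiff_dop hf j, fun f hf i j => ?_⟩
  have hf : ContDiff ℝ (⊤ : ℕ∞) f := hf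
  have h1 : ContDiff ℝ (⊤ : ℕ∞) (fderiv ℝ f) := hf.fderiv_right (by simp)
  have h2 : ∀ i j : Fin d, ∀ x, dop i (dop j f) x = fderiv ℝ (fderiv ℝ f) x (bv i) (bv j) := by
    intro i j x
    have h3 : DifferentiableAt ℝ (fderiv ℝ f) x := h1.differentiable (by simp) x
    have := h3.hasFDerivAt.clm_apply (hasFDerivAt_const (bv j) x)
    change fderiv ℝ (fun x => fderiv ℝ f x (bv j)) x (bv i) = _
    rw [this.fderiv]
    simp
  ext x
  rw [h2, h2]
  have h4 : IsSymmSndFDerivAt ℝ f x := hf.contDiffAt.isSymmSndFDerivAt (by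
    rw [minSmoothness_of_isRCLikeNormedField]
    exact WithTop.coe_le_coe.2 (le_top : (2 : ℕ∞) ≤ ⊤))
  exact h4 _ _

/-! ### Smooth vectors of representations of exponential growth -/

/-- A continuous representation of `(ℝ^d, +)` of exponential growth. -/
structure IsExpRep {d : ℕ} {E : Type*} [NormedAddCommGroup E] [NormedSpace ℂ E]
    (π : Rd d → E →L[ℂ] E) (C κ : ℝ) : Prop where
  zero : π 0 = ContinuousLinearMap.id ℂ E
  add : ∀ x y : Rd d, π (x + y) = (π x).comp (π y)
  cont : Continuous fun p : Rd d × E => π p.1 p.2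
  C_pos : 0 < C
  κ_pos : 0 < κ
  growth : ∀ (x : Rd d) (e : E), ‖π x e‖ ≤ C * Real.exp (κ * ‖x‖) * ‖e‖

/-- The infinitesimal action in the `j`-th direction. -/
def infAct {d : ℕ} {E : Type*} [NormedAddCommGroup E] [NormedSpace ℂ E]
    (π : Rd d → E →L[ℂ] E) (j : Fin d) (e : E) : E := dop j (orbit π e) 0

/-- The set of smooth vectors. -/
def smoothVec {d : ℕ} {E : Type*} [NormedAddCommGroup E] [NormedSpace ℂ E]
    (π : Rd d → E →L[ℂ] E) : Set E := {e | ContDiff ℝ (⊤ : ℕ∞) (orbit π e)}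

namespace IsExpRep

variable {d : ℕ} {E : Type*} [NormedAddCommGroup E] [NormedSpace ℂ E]
  {π : Rd d → E →L[ℂ] E} {C κ : ℝ}

lemma apply_zero (h : IsExpRep π C κ) (e : E) : π 0 e = e := by simp [h.zero]

lemma apply_add (h : IsExpRep π C κ) (x y : Rd d) (e : E) : π (x + y) e = π x (π y e) := by
  simp [h.add]

lemma comm (h : IsExpRep π C κ) (x y : Rd d) (e : E) : π x (π y e) = π y (π x e) := by
  rw [← h.apply_add, ← h.apply_add, add_comm]

lemma continuous_orbit (h : IsExpRep π C κ) (e : E) : Continuous (orbit π e) :=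
  h.cont.comp (continuous_id.prodMk continuous_const)

lemma hasFDerivAt_orbit (h : IsExpRep π C κ) {e : E} {L : Rd d →L[ℝ] E}
    (hL : HasFDerivAt (orbit π e) L 0) (x : Rd d) :
    HasFDerivAt (orbit π e) (((π x).restrictScalars ℝ).comp L) x := by
  have h1 : HasFDerivAt (fun y : Rd d => y - x) (ContinuousLinearMap.id ℝ (Rd d)) x :=
    (hasFDerivAt_id x).sub_const x
  have h2 : HasFDerivAt (fun y => orbit π e (y - x)) (L.comp (ContinuousLinearMap.id ℝ (Rd d))) x :=
    HasFDerivAt.comp (g := orbit π e) (f := fun y => y - x) x (by simpa using hL) h1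
  have h3 := ((π x).restrictScalars ℝ).hasFDerivAt.comp x h2
  have h4 : orbit π e = ⇑((π x).restrictScalars ℝ) ∘ fun y => orbit π e (y - x) := by
    ext y
    simp only [orbit, Function.comp, ContinuousLinearMap.coe_restrictScalars']
    rw [← h.apply_add]
    simp
  rw [h4]
  simpa using h3

lemma infAct_eq {e : E} {L : Rd d →L[ℝ] E}
    (hL : HasFDerivAt (orbit π e) L 0) (j : Fin d) : infAct π j e = L (bv j) := by
  rw [infAct, dop, hL.fderiv]

lemma differentiable_orbit {e : E} (he : e ∈ smoothVec π) : Differentiable ℝ (orbit π e) :=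
  ContDiff.differentiable (show ContDiff ℝ (⊤ : ℕ∞) (orbit π e) from he) (by simp)

lemma dop_orbit (h : IsExpRep π C κ) {e : E} (he : e ∈ smoothVec π) (j : Fin d) :
    dop j (orbit π e) = orbit π (infAct π j e) := by
  ext x
  rw [dop, (h.hasFDerivAt_orbit (differentiable_orbit he 0).hasFDerivAt x).fderiv]
  rfl

lemma infAct_mem (h : IsExpRep π C κ) {e : E} (he : e ∈ smoothVec π) (j : Fin d) :
    infAct π j e ∈ smoothVec π := by
  change ContDiff ℝ (⊤ : ℕ∞) (orbit π (infAct π j e))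
  rw [← h.dop_orbit he]
  exact contDiff_dop he j

lemma stableSet (h : IsExpRep π C κ) : StableSet (infAct π) (smoothVec π) := by
  refine ⟨fun e he j => h.infAct_mem he j, fun e he i j => ?_⟩
  have h1 := congrFun (stableSet_dop.comm (orbit π e) he i j) 0
  rw [h.dop_orbit he, h.dop_orbit he, h.dop_orbit (h.infAct_mem he j),
    h.dop_orbit (h.infAct_mem he i)] at h1
  simpa [orbit, h.zero] using h1

lemma pD_orbit (h : IsExpRep π C κ) {e : E} (he : e ∈ smoothVec π) (α : Fin d → ℕ) :
    pD α (orbit π e) = orbit π (multiIter (infAct π) α e) :=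
  (multiIter_semiconj h.stableSet.mem (orbit π)
    (fun _ he j => (h.dop_orbit he j).symm) α he).symm

lemma pD_orbit_zero (h : IsExpRep π C κ) {e : E} (he : e ∈ smoothVec π) (α : Fin d → ℕ) :
    pD α (orbit π e) 0 = multiIter (infAct π) α e := by
  rw [h.pD_orbit he, orbit, h.apply_zero]

/-- A criterion for smoothness of all vectors of a set. -/
lemma mem_smoothVec (h : IsExpRep π C κ) {W : Set E}
    (hW : ∀ w ∈ W, ∃ L : Rd d →L[ℝ] E, HasFDerivAt (orbit π w) L 0 ∧ ∀ j, L (bv j) ∈ W) {w : E}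
    (hw : w ∈ W) : w ∈ smoothVec π := by
  have key : ∀ n : ℕ, ∀ w ∈ W, ContDiff ℝ n (orbit π w) := by
    intro n
    induction n with
    | zero => exact fun w _ => contDiff_zero.2 (h.continuous_orbit w)
    | succ n ih =>
      intro w hw
      obtain ⟨L, hL, hLW⟩ := hW w hw
      have hd := fun x => h.hasFDerivAt_orbit hL x
      rw [Nat.cast_succ, contDiff_succ_iff_fderiv]
      refine ⟨fun x => (hd x).differentiableAt, by simp, ?_⟩
      rw [contDiff_clm_apply_iff]
      intro y
      have : (fun x => fderiv ℝ (orbit π w) x y) =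
          fun x => ∑ j, y j • orbit π (L (bv j)) x := by
        ext x
        rw [(hd x).fderiv]
        conv_lhs => rw [sum_smul_bv y]
        simp [orbit]
      rw [this]
      exact ContDiff.sum fun j _ => contDiff_const.smul (ih _ (hLW j))
  exact contDiff_infty.2 fun n => key n w hw

lemma hasDerivAt_orbit_smul (h : IsExpRep π C κ) {e : E} (he : e ∈ smoothVec π) (j : Fin d)
    (t : ℝ) : HasDerivAt (fun t : ℝ => π (t • bv j) e) (π (t • bv j) (infAct π j e)) t := by
  have h1 := h.hasFDerivAt_orbit (differentiable_orbit he 0).hasFDerivAt (t • bv j)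
  have h2 : HasDerivAt (fun t : ℝ => t • bv j) (bv j : Rd d) t := by
    simpa using (hasDerivAt_id t).smul_const (bv j : Rd d)
  exact h1.comp_hasDerivAt t h2

end IsExpRep

/-! ### Operators given by kernels along a coordinate axis -/

lemma exp_mul_norm_fker_le {F : ℂ → ℂ} {A κ : ℝ} (hκ : 0 < κ) (hF : StripBound (κ + 1) A F)
    (t : ℝ) : Real.exp (κ * |t|) * ‖fker F t‖ ≤ Real.pi * A * Real.exp (-(1 * |t|)) := by
  have h1 := norm_fker_le (by linarith) hF t
  have hA := hF.nonneg (by linarith)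
  calc _ ≤ Real.exp (κ * |t|) *
        (Real.pi * A * Real.exp (-(2 * Real.pi * (κ + 1) * |t|))) := by gcongr
    _ = Real.pi * A * Real.exp (κ * |t| + -(2 * Real.pi * (κ + 1) * |t|)) := by
        rw [Real.exp_add]; ring
    _ ≤ _ := by
        gcongr
        nlinarith [mul_nonneg (show 0 ≤ 2 * Real.pi - 1 by linarith [Real.pi_gt_three])
          (mul_nonneg (show 0 ≤ κ + 1 by linarith) (abs_nonneg t))]

lemma integrable_exp_mul_norm_fker {F : ℂ → ℂ} (hF : StripDecay F) {κ : ℝ} (hκ : 0 < κ) :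
    Integrable fun t : ℝ => Real.exp (κ * |t|) * ‖fker F t‖ := by
  obtain ⟨A, hA⟩ := hF.stripBound (κ + 1)
  have hc := continuous_fker hF
  refine ((integrable_exp_neg_mul_abs (b := 1) one_pos).const_mul (Real.pi * A)).mono'
    (by fun_prop) (Eventually.of_forall fun t => ?_)
  rw [Real.norm_of_nonneg (by positivity)]
  exact exp_mul_norm_fker_le hκ hA t

lemma fker_add {F G : ℂ → ℂ} (hF : StripDecay F) (hG : StripDecay G) (x : ℝ) :
    fker (fun ζ => F ζ + G ζ) x = fker F x + fker G x := by
  have hi : ∀ {F : ℂ → ℂ}, StripDecay F →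
      Integrable fun ξ : ℝ => Complex.exp (2 * Real.pi * ξ * x * Complex.I) * F ξ := by
    intro F hF
    refine hF.integrable.bdd_mul (c := 1) (by fun_prop) (Eventually.of_forall fun ξ => ?_)
    rw [Complex.norm_exp]
    simp
  simp only [fker_eq_integral, mul_add]
  exact integral_add (hi hF) (hi hG)

lemma fker_const_mul {F : ℂ → ℂ} (c : ℂ) (x : ℝ) :
    fker (fun ζ => c * F ζ) x = c * fker F x := by
  simp only [fker_eq_integral, ← integral_const_mul]
  congr 1
  ext ξ
  ring

lemma integral_fker {F : ℂ → ℂ} (hF : StripDecay F) : ∫ t, fker F t = F 0 := by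
  have := congrFun (fourier_fker hF) 0
  simpa [Real.fourier_eq'] using this

/-- Dilating the symbol. -/
lemma fker_dilate {F : ℂ → ℂ} {δ : ℝ} (hδ : 0 < δ) (x : ℝ) :
    fker (fun ζ => F (δ * ζ)) x = (δ⁻¹ : ℝ) • fker F (δ⁻¹ * x) := by
  simp only [fker_eq_integral]
  have := Measure.integral_comp_mul_left
    (fun ξ : ℝ => Complex.exp (2 * Real.pi * ξ * (δ⁻¹ * x : ℝ) * Complex.I) * F ξ) δ
  rw [abs_of_pos (inv_pos.2 hδ)] at this
  rw [← this]
  congr 1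
  ext ξ
  have : (δ : ℂ) ≠ 0 := by exact_mod_cast hδ.ne'
  push_cast
  congr 2
  field_simp

lemma StripDecay.dilate {F : ℂ → ℂ} (hF : StripDecay F) {δ : ℝ} (hδ : 0 < δ) :
    StripDecay fun ζ => F (δ * ζ) := by
  refine ⟨hF.1.comp (by fun_prop), fun Y n => ?_⟩
  obtain ⟨A, hA⟩ := hF.2 (δ * Y) n
  refine ⟨A / δ ^ n, fun ζ hζ => ?_⟩
  have := hA (δ * ζ) (by
    rw [Complex.im_ofReal_mul, abs_mul, abs_of_pos hδ]; gcongr)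
  rw [le_div_iff₀ (by positivity)]
  rw [norm_mul, Complex.norm_real, Real.norm_of_nonneg hδ.le, mul_pow] at this
  linarith

/-- The operator with symbol `F` acting along the `j`-th axis. -/
def axisOp {d : ℕ} {E : Type*} [NormedAddCommGroup E] [NormedSpace ℂ E]
    (π : Rd d → E →L[ℂ] E) (j : Fin d) (F : ℂ → ℂ) (e : E) : E :=
  ∫ t : ℝ, fker F t • π (t • bv j) e

namespace IsExpRep

variable {d : ℕ} {E : Type*} [NormedAddCommGroup E] [NormedSpace ℂ E]
  {π : Rd d → E →L[ℂ] E} {C κ : ℝ}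

lemma norm_smul_bv (t : ℝ) (j : Fin d) : ‖t • (bv j : Rd d)‖ = |t| := by
  simp [norm_smul]

lemma norm_apply_smul_bv_le (h : IsExpRep π C κ) (t : ℝ) (j : Fin d) (e : E) :
    ‖π (t • bv j) e‖ ≤ C * Real.exp (κ * |t|) * ‖e‖ := by
  simpa only [norm_smul_bv] using h.growth (t • bv j) e

lemma continuous_apply_smul_bv (h : IsExpRep π C κ) (j : Fin d) (e : E) :
    Continuous fun t : ℝ => π (t • bv j) e :=
  (h.continuous_orbit e).comp (continuous_id.smul continuous_const)

lemma integrable_axisOp (h : IsExpRep π C κ) {F : ℂ → ℂ} (hF : StripDecay F) (j : Fin d) (e : E) :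
    Integrable fun t : ℝ => fker F t • π (t • bv j) e := by
  have hc := continuous_fker hF
  have hc' := h.continuous_apply_smul_bv j e
  refine ((integrable_exp_mul_norm_fker hF h.κ_pos).const_mul (C * ‖e‖)).mono'
    (hc.smul hc').aestronglyMeasurable (Eventually.of_forall fun t => ?_)
  rw [norm_smul]
  calc _ ≤ ‖fker F t‖ * (C * Real.exp (κ * |t|) * ‖e‖) := by
        gcongr; exact h.norm_apply_smul_bv_le t j e
    _ = _ := by ring

/-- The constant in the norm estimate of `axisOp`. -/
def opConst (C : ℝ) : ℝ := C * Real.pi * ∫ t : ℝ, Real.exp (-(1 * |t|))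

lemma opConst_nonneg (h : IsExpRep π C κ) : 0 ≤ opConst C := by
  have := h.C_pos
  have h1 : 0 ≤ ∫ t : ℝ, Real.exp (-(1 * |t|)) := integral_nonneg fun t => (Real.exp_pos _).le
  unfold opConst
  positivity

lemma norm_axisOp_le (h : IsExpRep π C κ) {F : ℂ → ℂ} {A : ℝ} (hF : StripBound (κ + 1) A F)
    (j : Fin d) (e : E) : ‖axisOp π j F e‖ ≤ opConst C * A * ‖e‖ := by
  have hC := h.C_pos
  calc ‖axisOp π j F e‖ ≤ ∫ t : ℝ, C * Real.pi * A * ‖e‖ * Real.exp (-(1 * |t|)) := by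
        refine norm_integral_le_of_norm_le
          ((integrable_exp_neg_mul_abs one_pos).const_mul _) (Eventually.of_forall fun t => ?_)
        rw [norm_smul]
        calc _ ≤ ‖fker F t‖ * (C * Real.exp (κ * |t|) * ‖e‖) := by
              gcongr; exact h.norm_apply_smul_bv_le t j e
          _ = C * ‖e‖ * (Real.exp (κ * |t|) * ‖fker F t‖) := by ring
          _ ≤ C * ‖e‖ * (Real.pi * A * Real.exp (-(1 * |t|))) := by
              exact mul_le_mul_of_nonneg_left (exp_mul_norm_fker_le h.κ_pos hF t) (by positivity)
          _ = _ := by ring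
    _ = _ := by rw [integral_const_mul, opConst]; ring

lemma exists_axisOp_clm (h : IsExpRep π C κ) {F : ℂ → ℂ} (hF : StripDecay F) (j : Fin d) :
    ∃ T : E →L[ℂ] E, ∀ e, T e = axisOp π j F e := by
  obtain ⟨A, hA⟩ := hF.stripBound (κ + 1)
  refine ⟨LinearMap.mkContinuousOfExistsBound
    { toFun := axisOp π j F
      map_add' := fun e e' => ?_
      map_smul' := fun c e => ?_ } ⟨_, h.norm_axisOp_le hA j⟩, fun e => rfl⟩
  · simp only [axisOp, map_add, smul_add]
    exact integral_add (h.integrable_axisOp hF j e) (h.integrable_axisOp hF j e')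
  · simp only [axisOp, map_smul, RingHom.id_apply, ← integral_smul]
    simp only [smul_comm c]

lemma axisOp_add_symbol (h : IsExpRep π C κ) {F G : ℂ → ℂ} (hF : StripDecay F) (hG : StripDecay G)
    (j : Fin d) (e : E) :
    axisOp π j (fun ζ => F ζ + G ζ) e = axisOp π j F e + axisOp π j G e := by
  simp only [axisOp, fker_add hF hG, add_smul]
  exact integral_add (h.integrable_axisOp hF j e) (h.integrable_axisOp hG j e)

lemma axisOp_const_mul_symbol {F : ℂ → ℂ} (c : ℂ) (j : Fin d) (e : E) :
    axisOp π j (fun ζ => c * F ζ) e = c • axisOp π j F e := by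
  simp only [axisOp, fker_const_mul, mul_smul, integral_smul]

lemma orbit_clm_comp {T : E →L[ℂ] E} (hT : ∀ x e, π x (T e) = T (π x e)) (e : E) :
    orbit π (T e) = T.restrictScalars ℝ ∘ orbit π e := by
  ext x
  simp [orbit, hT]

lemma clm_mem_smoothVec {T : E →L[ℂ] E} (hT : ∀ x e, π x (T e) = T (π x e)) {e : E}
    (he : e ∈ smoothVec π) : T e ∈ smoothVec π := by
  change ContDiff ℝ (⊤ : ℕ∞) (orbit π (T e))
  rw [orbit_clm_comp hT]
  exact (T.restrictScalars ℝ).contDiff.comp he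

lemma infAct_clm {T : E →L[ℂ] E} (hT : ∀ x e, π x (T e) = T (π x e)) {e : E}
    (he : e ∈ smoothVec π) (j : Fin d) : infAct π j (T e) = T (infAct π j e) := by
  have h1 := (T.restrictScalars ℝ).hasFDerivAt.comp (0 : Rd d)
    (differentiable_orbit he 0).hasFDerivAt
  rw [← orbit_clm_comp hT] at h1
  rw [infAct_eq h1]
  rfl

lemma axisOp_deriv_symbol (h : IsExpRep π C κ) {F : ℂ → ℂ} (hF : StripDecay F) (j : Fin d) {e : E}
    (he : e ∈ smoothVec π) :
    axisOp π j (fun ζ => 2 * Real.pi * Complex.I * ζ * F ζ) e =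
      -axisOp π j F (infAct π j e) := by
  have hF' : StripDecay fun ζ => 2 * Real.pi * Complex.I * ζ * F ζ := by
    simpa only [mul_assoc] using hF.id_mul.const_mul (2 * (Real.pi * Complex.I))
  have := integral_bilinear_hasDerivAt_right_eq_neg_left_of_integrable
    (L := ContinuousLinearMap.lsmul ℝ ℂ (E := E))
    (u := fker F) (v := fun t : ℝ => π (t • bv j) e)
    (fun t _ => hasDerivAt_fker hF t) (fun t _ => h.hasDerivAt_orbit_smul he j t)
    (h.integrable_axisOp hF j _) (h.integrable_axisOp hF' j e) (h.integrable_axisOp hF j e)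
  simp only [ContinuousLinearMap.lsmul_apply] at this
  rw [axisOp, axisOp, this, neg_neg]

lemma axisOp_pow_mul_symbol (h : IsExpRep π C κ) {F : ℂ → ℂ} (hF : StripDecay F) (j : Fin d)
    (n : ℕ) {e : E} (he : e ∈ smoothVec π) :
    axisOp π j (fun ζ => ζ ^ n * F ζ) e =
      (-(2 * Real.pi * Complex.I)⁻¹) ^ n • axisOp π j F ((infAct π j)^[n] e) := by
  induction n generalizing e with
  | zero => simp
  | succ n ih =>
    have h0 : (2 * Real.pi * Complex.I) ≠ 0 := by simp [Real.pi_ne_zero]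
    have h1 : (fun ζ : ℂ => ζ ^ (n + 1) * F ζ) = fun ζ => (2 * Real.pi * Complex.I)⁻¹ *
        (2 * Real.pi * Complex.I * ζ * (ζ ^ n * F ζ)) := by
      ext ζ
      rw [mul_assoc _ ζ, inv_mul_cancel_left₀ h0]
      ring
    rw [h1, axisOp_const_mul_symbol, h.axisOp_deriv_symbol (hF.pow_mul n) j he,
      ih (h.infAct_mem he j), Function.iterate_succ_apply, pow_succ', mul_smul, smul_neg, neg_smul]

lemma norm_axisOp_pow_mul_symbol_le (h : IsExpRep π C κ) {F : ℂ → ℂ} (hF : StripDecay F) {A : ℝ}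
    (hA : StripBound (κ + 1) A F) (j : Fin d) (n : ℕ) {e : E} (he : e ∈ smoothVec π) :
    ‖axisOp π j (fun ζ => ζ ^ n * F ζ) e‖ ≤ opConst C * A * ‖(infAct π j)^[n] e‖ := by
  rw [h.axisOp_pow_mul_symbol hF j n he, norm_smul, norm_pow, norm_neg, norm_inv]
  refine (mul_le_of_le_one_left (norm_nonneg _) (pow_le_one₀ (by positivity) ?_)).trans
    (h.norm_axisOp_le hA j _)
  refine inv_le_one_of_one_le₀ ?_
  simp only [norm_mul, Complex.norm_I, Complex.norm_real, Complex.norm_two, mul_one,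
    Real.norm_of_nonneg Real.pi_pos.le]
  linarith [Real.pi_gt_three]

lemma axisOp_dilate {F : ℂ → ℂ} (j : Fin d) (e : E) {δ : ℝ} (hδ : 0 < δ) :
    axisOp π j (fun ζ => F (δ * ζ)) e = ∫ s : ℝ, fker F s • π ((δ * s) • bv j) e := by
  have := Measure.integral_comp_mul_left (fun s : ℝ => fker F s • π ((δ * s) • bv j) e) δ⁻¹
  rw [abs_of_pos (by simpa using hδ), inv_inv] at this
  have h2 : ∫ s : ℝ, fker F s • π ((δ * s) • bv j) e =
      δ⁻¹ • ∫ x : ℝ, fker F (δ⁻¹ * x) • π ((δ * (δ⁻¹ * x)) • bv j) e := by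
    rw [this, inv_smul_smul₀ hδ.ne']
  rw [h2, axisOp, ← integral_smul]
  congr 1
  ext t
  rw [fker_dilate hδ, mul_inv_cancel_left₀ hδ.ne', smul_assoc]

variable [CompleteSpace E]

lemma apply_axisOp (h : IsExpRep π C κ) {F : ℂ → ℂ} (hF : StripDecay F) (j : Fin d) (x : Rd d)
    (e : E) : π x (axisOp π j F e) = axisOp π j F (π x e) := by
  rw [axisOp, ← ContinuousLinearMap.integral_comp_comm _ (h.integrable_axisOp hF j e), axisOp]
  simp only [map_smul, h.comm x]

lemma axisOp_axisOp (h : IsExpRep π C κ) {F G : ℂ → ℂ} (hF : StripDecay F) (hG : StripDecay G)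
    (j : Fin d) (e : E) :
    axisOp π j F (axisOp π j G e) = axisOp π j (fun ζ => F ζ * G ζ) e := by
  have hcF := continuous_fker hF
  have hcG := continuous_fker hG
  have hC := h.C_pos
  have hκ := h.κ_pos
  have hc := h.continuous_apply_smul_bv j e
  have hint : Integrable (Function.uncurry fun s t : ℝ =>
      (fker F t * fker G (s - t)) • π (s • bv j) e) (volume.prod volume) := by
    have h1 := ((integrable_exp_mul_norm_fker hF hκ).convolution_integrand
      (ContinuousLinearMap.mul ℝ ℝ) (μ := volume) (integrable_exp_mul_norm_fker hG hκ)).const_mul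
        (C * ‖e‖)
    refine h1.mono' (Continuous.aestronglyMeasurable ?_) (Eventually.of_forall fun p => ?_)
    · simp only [Function.uncurry_def]
      exact ((hcF.comp continuous_snd).mul
        (hcG.comp (continuous_fst.sub continuous_snd))).smul (hc.comp continuous_fst)
    · obtain ⟨s, t⟩ := p
      simp only [Function.uncurry_apply_pair, norm_smul, norm_mul, ContinuousLinearMap.mul_apply']
      have h2 : Real.exp (κ * |s|) ≤ Real.exp (κ * |t|) * Real.exp (κ * |s - t|) := by
        rw [← Real.exp_add, ← mul_add]
        gcongr
        have := abs_add_le t (s - t)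
        simpa using this
      calc _ ≤ ‖fker F t‖ * ‖fker G (s - t)‖ * (C * Real.exp (κ * |s|) * ‖e‖) := by
            gcongr; exact h.norm_apply_smul_bv_le s j e
        _ ≤ ‖fker F t‖ * ‖fker G (s - t)‖ *
            (C * (Real.exp (κ * |t|) * Real.exp (κ * |s - t|)) * ‖e‖) := by gcongr
        _ = _ := by ring
  calc axisOp π j F (axisOp π j G e)
      = ∫ t : ℝ, ∫ s : ℝ, (fker F t * fker G (s - t)) • π (s • bv j) e := by
        rw [axisOp]
        congr 1
        ext t
        rw [h.apply_axisOp hG, axisOp, ← integral_smul, ← integral_sub_right_eq_self _ t]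
        congr 1
        ext s
        rw [← h.apply_add, ← add_smul, sub_add_cancel, mul_smul]
    _ = ∫ s : ℝ, ∫ t : ℝ, (fker F t * fker G (s - t)) • π (s • bv j) e :=
        (integral_integral_swap hint).symm
    _ = _ := by
        rw [axisOp]
        congr 1
        ext s
        rw [integral_smul_const, fker_mul hF hG]

lemma tendsto_axisOp_dilate (h : IsExpRep π C κ) {F : ℂ → ℂ} (hF : StripDecay F) (j : Fin d)
    (e : E) :
    Tendsto (fun n : ℕ => axisOp π j (fun ζ => F ((1 / ((n : ℝ) + 1) : ℝ) * ζ)) e) atTop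
      (nhds (F 0 • e)) := by
  have hC := h.C_pos
  have hκ := h.κ_pos
  have hc := h.continuous_apply_smul_bv j e
  have hcF := continuous_fker hF
  have hδ : ∀ n : ℕ, 0 < 1 / ((n : ℝ) + 1) := fun n => Nat.one_div_pos_of_nat
  simp only [axisOp_dilate j e (hδ _)]
  rw [← integral_fker hF, ← integral_smul_const]
  refine tendsto_integral_of_dominated_convergence
    (fun s => C * ‖e‖ * (Real.exp (κ * |s|) * ‖fker F s‖)) (fun n => ?_)
    ((integrable_exp_mul_norm_fker hF hκ).const_mul _) (fun n => Eventually.of_forall fun s => ?_)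
    (Eventually.of_forall fun s => ?_)
  · exact (hcF.smul (hc.comp (continuous_const.mul continuous_id))).aestronglyMeasurable
  · rw [norm_smul]
    have h1 : |1 / ((n : ℝ) + 1) * s| ≤ |s| := by
      rw [abs_mul, abs_of_pos (hδ n)]
      refine mul_le_of_le_one_left (abs_nonneg s) ?_
      rw [div_le_one (by positivity)]
      linarith [(Nat.cast_nonneg n : (0 : ℝ) ≤ n)]
    calc _ ≤ ‖fker F s‖ * (C * Real.exp (κ * |1 / ((n : ℝ) + 1) * s|) * ‖e‖) := by
          gcongr; exact h.norm_apply_smul_bv_le _ j e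
      _ ≤ ‖fker F s‖ * (C * Real.exp (κ * |s|) * ‖e‖) := by gcongr
      _ = _ := by ring
  · refine Tendsto.const_smul ?_ _
    have h1 : Tendsto (fun n : ℕ => 1 / ((n : ℝ) + 1) * s) atTop (nhds 0) := by
      simpa using tendsto_one_div_add_atTop_nhds_zero_nat.mul_const s
    have h2 := (hc.tendsto 0).comp h1
    simpa [h.apply_zero, Function.comp_def] using h2

end IsExpRep

/-! ### Series of operators -/

/-- Smooth vectors all of whose derivatives are summable along a sequence of operators. -/
def summableVec {d : ℕ} {E : Type*} [NormedAddCommGroup E] [NormedSpace ℂ E]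
    (π : Rd d → E →L[ℂ] E) (T : ℕ → E →L[ℂ] E) : Set E :=
  {e | e ∈ smoothVec π ∧ ∀ α, Summable fun k => ‖T k (multiIter (infAct π) α e)‖}

namespace IsExpRep

variable {d : ℕ} {E : Type*} [NormedAddCommGroup E] [NormedSpace ℂ E]
  {π : Rd d → E →L[ℂ] E} {C κ : ℝ}

lemma infAct_mem_summableVec (h : IsExpRep π C κ) {T : ℕ → E →L[ℂ] E} {e : E}
    (he : e ∈ summableVec π T) (j : Fin d) : infAct π j e ∈ summableVec π T :=
  ⟨h.infAct_mem he.1 j, fun α => by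
    simpa only [h.stableSet.multiIter_apply j α he.1] using he.2 (α + Pi.single j 1)⟩

variable [CompleteSpace E]

lemma hasFDerivAt_orbit_tsum (h : IsExpRep π C κ) {T : ℕ → E →L[ℂ] E}
    (hT : ∀ k x e, π x (T k e) = T k (π x e)) {e : E} (he : e ∈ summableVec π T) :
    ∃ L : Rd d →L[ℝ] E, HasFDerivAt (orbit π (∑' k, T k e)) L 0 ∧
      ∀ j, L (bv j) = ∑' k, T k (infAct π j e) := by
  have hC := h.C_pos
  have hκ := h.κ_pos
  have hsum0 : Summable fun k => ‖T k e‖ := by simpa only [multiIter_zero] using he.2 0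
  have hsum1 : ∀ j, Summable fun k => ‖T k (infAct π j e)‖ := fun j => by
    simpa only [multiIter_zero] using (h.infAct_mem_summableVec he j).2 0
  set L := fun k => fderiv ℝ (orbit π (T k e)) 0 with hLdef
  have hL : ∀ k, HasFDerivAt (orbit π (T k e)) (L k) 0 := fun k =>
    (differentiable_orbit (clm_mem_smoothVec (hT k) he.1) 0).hasFDerivAt
  have hLb : ∀ k j, L k (bv j) = T k (infAct π j e) := fun k j => by
    rw [← infAct_eq (hL k), infAct_clm (hT k) he.1]
  have hLn : ∀ k, ‖L k‖ ≤ ∑ j, ‖T k (infAct π j e)‖ := fun k => by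
    refine ContinuousLinearMap.opNorm_le_bound _ (by positivity) fun y => ?_
    conv_lhs => rw [sum_smul_bv y]
    rw [map_sum, Finset.sum_mul]
    refine norm_sum_le_of_le _ fun j _ => ?_
    rw [map_smul, hLb, norm_smul, mul_comm]
    gcongr
    exact PiLp.norm_apply_le y j
  have hsumL : Summable fun k => ‖L k‖ :=
    Summable.of_nonneg_of_le (fun k => norm_nonneg _) hLn (summable_sum fun j _ => hsum1 j)
  have key := hasFDerivAt_tsum_of_isPreconnected (𝕜 := ℝ) (f := fun k => orbit π (T k e))
    (f' := fun k x => ((π x).restrictScalars ℝ).comp (L k))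
    (u := fun k => C * Real.exp κ * ‖L k‖) (x₀ := 0) (x := 0)
    (hsumL.mul_left _) (Metric.isOpen_ball (x := (0 : Rd d)) (ε := 1))
    (convex_ball (0 : Rd d) 1).isPreconnected
    (fun k x _ => h.hasFDerivAt_orbit (hL k) x) (fun k x hx => ?_)
    (Metric.mem_ball_self one_pos) ?_ (Metric.mem_ball_self one_pos)
  · have h1 : orbit π (∑' k, T k e) = fun x => ∑' k, orbit π (T k e) x := by
      ext x
      exact (π x).map_tsum hsum0.of_norm
    refine ⟨_, by rw [h1]; exact key, fun j => ?_⟩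
    have h2 : ∀ k, ((π 0).restrictScalars ℝ).comp (L k) = L k := fun k => by
      ext y
      simp [h.zero]
    simp only [h2]
    have h3 := (ContinuousLinearMap.apply ℝ E (bv j : Rd d)).map_tsum hsumL.of_norm
    simpa only [ContinuousLinearMap.apply_apply, hLb] using h3
  · refine ContinuousLinearMap.opNorm_le_bound _ (by positivity) fun y => ?_
    rw [mem_ball_zero_iff] at hx
    calc ‖π x (L k y)‖ ≤ C * Real.exp (κ * ‖x‖) * ‖L k y‖ := h.growth _ _
      _ ≤ C * Real.exp κ * (‖L k‖ * ‖y‖) := by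
          gcongr
          · exact mul_le_of_le_one_right hκ.le hx.le
          · exact (L k).le_opNorm y
      _ = _ := by ring
  · simpa only [orbit, h.apply_zero] using hsum0.of_norm

lemma tsum_mem_smoothVec (h : IsExpRep π C κ) {T : ℕ → E →L[ℂ] E}
    (hT : ∀ k x e, π x (T k e) = T k (π x e)) {e : E} (he : e ∈ summableVec π T) :
    ∑' k, T k e ∈ smoothVec π := by
  refine h.mem_smoothVec (W := (fun e => ∑' k, T k e) '' summableVec π T) ?_
    (Set.mem_image_of_mem _ he)
  rintro _ ⟨e, he, rfl⟩
  obtain ⟨L, hL, hLj⟩ := h.hasFDerivAt_orbit_tsum hT he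
  exact ⟨L, hL, fun j => ⟨_, h.infAct_mem_summableVec he j, (hLj j).symm⟩⟩

lemma multiIter_tsum (h : IsExpRep π C κ) {T : ℕ → E →L[ℂ] E}
    (hT : ∀ k x e, π x (T k e) = T k (π x e)) {e : E} (he : e ∈ summableVec π T) (α : Fin d → ℕ) :
    multiIter (infAct π) α (∑' k, T k e) = ∑' k, T k (multiIter (infAct π) α e) := by
  refine (multiIter_semiconj (S := summableVec π T) (D := infAct π)
    (fun e he j => h.infAct_mem_summableVec he j) (fun e => ∑' k, T k e) (fun e he j => ?_) α
    he).symm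
  obtain ⟨L, hL, hLj⟩ := h.hasFDerivAt_orbit_tsum hT he
  rw [infAct_eq hL, hLj]

end IsExpRep

/-! ### Factorization along one axis -/

lemma StripDecay.zero : StripDecay fun _ => (0 : ℂ) :=
  ⟨differentiable_const _, fun _ _ => ⟨0, fun _ _ => by simp⟩⟩

lemma StripDecay.sum {F : ℕ → ℂ → ℂ} (hF : ∀ k, StripDecay (F k)) (n : ℕ) :
    StripDecay fun ζ => ∑ k ∈ Finset.range n, F k ζ := by
  induction n with
  | zero => simpa using StripDecay.zero
  | succ n ih => simpa only [Finset.sum_range_succ] using ih.add (hF n)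

namespace SpectralPartition

variable {M : ℕ → ℝ} {Y c ρ : ℝ} {l : ℕ → ℕ}

/-- The symbols whose sum is the reciprocal of `Q`. -/
def symb (P : SpectralPartition M Y c ρ l) : ℕ → ℂ → ℂ
  | 0 => P.lead
  | k + 1 => fun ζ => ζ ^ P.deg k * P.piece k ζ

lemma stripDecay_symb (P : SpectralPartition M Y c ρ l) : ∀ k, StripDecay (P.symb k)
  | 0 => P.decay_lead
  | k + 1 => (P.decay_piece k).pow_mul _

lemma sum_symb (P : SpectralPartition M Y c ρ l) (K : ℕ) (ζ : ℂ) :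
    ∑ k ∈ Finset.range (K + 1), P.Q ζ * P.symb k ζ = 1 - ζ ^ P.deg K * P.rest K ζ := by
  rw [Finset.sum_range_succ', ← P.sum_eq K ζ, add_comm]
  simp only [symb]
  congr 1
  exact Finset.sum_congr rfl fun k _ => by ring

lemma bnd_nonneg (P : SpectralPartition M Y c ρ l) (hY : 0 ≤ Y) (k : ℕ) : 0 ≤ P.bnd k :=
  (P.bound_piece k).nonneg hY

end SpectralPartition

lemma exists_thresholds {d : ℕ} {M : ℕ → ℝ} (hM : IsWeightSeq M) {ι : Type*}
    (a : ι → (Fin d → ℕ) → ℝ)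
    (ha : ∀ h : ℝ, 0 < h → ∃ C : ℝ, ∀ e α, h ^ msize α * a e α ≤ C * M (msize α))
    {L ρ : ℝ} (hL : 0 < L) (hρ : 0 < ρ) :
    ∃ K : ℕ → ℕ, ∀ l e α, K l ≤ msize α → (L * ρ ^ l) ^ msize α * a e α ≤ M (msize α) := by
  have : ∀ l : ℕ, ∃ K : ℕ, ∀ e α, K ≤ msize α → (L * ρ ^ l) ^ msize α * a e α ≤ M (msize α) := by
    intro l
    obtain ⟨C, hC⟩ := ha (2 * (L * ρ ^ l)) (by positivity)
    obtain ⟨K, hK⟩ := pow_unbounded_of_one_lt C one_lt_two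
    refine ⟨K, fun e α hα => ?_⟩
    have hMp := hM.1 (msize α)
    have h1 : C ≤ 2 ^ msize α := hK.le.trans (pow_le_pow_right₀ one_le_two hα)
    have h2 := (hC e α).trans (mul_le_mul_of_nonneg_right h1 hMp.le)
    rw [mul_pow, mul_assoc] at h2
    exact le_of_mul_le_mul_left h2 (by positivity)
  choose K hK using this
  exact ⟨K, hK⟩

/-- The summability estimate behind the factorization. -/
lemma exists_summable_bound {d : ℕ} {M : ℕ → ℝ} {C₀ H c ρ : ℝ} (hM : IsWeightSeq M)
    (h2 : HasM2 M C₀ H) (hc : 1 ≤ c) (hρ : 2 ≤ ρ) {ι : Type*}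
    (a : ι → (Fin d → ℕ) → ℝ) (ha0 : ∀ e α, 0 ≤ a e α)
    (ha : ∀ h : ℝ, 0 < h → ∃ C : ℝ, ∀ e α, h ^ msize α * a e α ≤ C * M (msize α)) :
    ∃ l : ℕ → ℕ, SlowSeq l ∧ ∀ (b : ℕ → ℝ) (q : ℕ → ℕ), (∀ k, 0 ≤ b k) → (∀ k, k < q k) →
      (∀ k, b k * M (q k) ≤ (c * ρ ^ l k) ^ q k) → ∀ (j : Fin d) (h : ℝ), 0 < h →
      ∃ u : ℕ → ℝ, Summable u ∧ ∀ k e α,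
        h ^ msize α * (b k * a e (α + q k • Pi.single j 1)) ≤ u k * M (msize α) := by
  obtain ⟨hC₀, hH, h2'⟩ := h2
  set L := 2 * c * H with hLdef
  have hL : 0 < L := by positivity
  obtain ⟨K, hK⟩ := exists_thresholds hM a ha hL (show 0 < ρ by linarith)
  obtain ⟨l, -, hl1, hl2, k₀, hk₀⟩ := exists_slow_sequence K
  refine ⟨l, ⟨hl1, hl2⟩, fun b q hb hq hbM j h hh => ?_⟩
  obtain ⟨n, hn⟩ := pow_unbounded_of_one_lt h (show 1 < ρ by linarith)
  obtain ⟨k₁, hk₁⟩ := hl2 n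
  obtain ⟨A, hA⟩ := ha (h * H) (by positivity)
  set v : ℕ → ℝ := fun k => if k < max k₀ k₁ then b k * (|A| * C₀ * M (q k) / h ^ q k) else 0
    with hv
  have hv0 : ∀ k, 0 ≤ v k := fun k => by
    have h1 := hM.1 (q k)
    have h2 := hb k
    simp only [hv]
    split_ifs
    · positivity
    · exact le_rfl
  refine ⟨fun k => C₀ * (1 / 2) ^ k + v k, ?_, fun k e α => ?_⟩
  · refine (summable_geometric_two.mul_left C₀).add
      (summable_of_ne_finset_zero (s := Finset.range (max k₀ k₁)) fun k hk => ?_)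
    rw [Finset.mem_range] at hk
    simp only [hv, if_neg hk]
  have hMp := hM.1 (msize α)
  have hMq := hM.1 (q k)
  have hbk := hb k
  have hm := h2' (msize α) (q k)
  have hae := ha0 e (α + q k • Pi.single j 1)
  by_cases hk : k < max k₀ k₁
  · have h3 := hA e (α + q k • Pi.single j 1)
    rw [msize_add_nsmul_single] at h3
    have h4 : H ^ (msize α + q k) * (h ^ q k * (h ^ msize α * a e (α + q k • Pi.single j 1))) ≤
        H ^ (msize α + q k) * (|A| * C₀ * M (q k) * M (msize α)) := by
      calc _ = (h * H) ^ (msize α + q k) * a e (α + q k • Pi.single j 1) := by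
            rw [mul_pow, pow_add h]; ring
        _ ≤ |A| * M (msize α + q k) := h3.trans (by
            gcongr
            · exact (hM.1 _).le
            · exact le_abs_self A)
        _ ≤ |A| * (C₀ * H ^ (msize α + q k) * M (msize α) * M (q k)) := by gcongr
        _ = _ := by ring
    have h5 := le_of_mul_le_mul_left h4 (by positivity)
    rw [← le_div_iff₀' (by positivity)] at h5
    calc _ = b k * (h ^ msize α * a e (α + q k • Pi.single j 1)) := by ring
      _ ≤ b k * (|A| * C₀ * M (q k) * M (msize α) / h ^ q k) := by gcongr
      _ = v k * M (msize α) := by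
          simp only [hv, hk, if_true]; ring
      _ ≤ _ := by gcongr; exact le_add_of_nonneg_left (by positivity)
  · rw [not_lt, max_le_iff] at hk
    have hkq := hq k
    have h3 := hK (l k) e (α + q k • Pi.single j 1) (by
      rw [msize_add_nsmul_single]
      have := hk₀ k hk.1
      omega)
    rw [msize_add_nsmul_single] at h3
    have hh1 : h ≤ ρ ^ l k := hn.le.trans (pow_le_pow_right₀ (by linarith) (hk₁ k hk.2))
    have hρ0 : 0 < ρ ^ l k := by positivity
    set a' := a e (α + q k • Pi.single j 1) with ha'
    set r := ρ ^ l k with hr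
    set p := msize α with hp
    have h4 : (2 * c * r) ^ q k * (h ^ p * (b k * a')) ≤
        (2 * c * r) ^ q k * (C₀ * (1 / 2) ^ q k * M p) := by
      have h5 : H ^ (p + q k) * ((2 * c * r) ^ q k * (h ^ p * (b k * a'))) ≤
          H ^ (p + q k) * ((c * r) ^ q k * C₀ * M p) := by
        have h6 : h ^ p ≤ (2 * c * r) ^ p := by
          gcongr
          nlinarith
        calc _ ≤ H ^ (p + q k) * ((2 * c * r) ^ q k * ((2 * c * r) ^ p * (b k * a'))) := by gcongr
          _ = b k * ((L * r) ^ (p + q k) * a') := by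
              rw [hLdef, show 2 * c * H * r = H * (2 * c * r) by ring, mul_pow H,
                pow_add (2 * c * r)]
              ring
          _ ≤ b k * (C₀ * H ^ (p + q k) * M p * M (q k)) := mul_le_mul_of_nonneg_left (h3.trans hm) hbk
          _ = H ^ (p + q k) * ((b k * M (q k)) * C₀ * M p) := by ring
          _ ≤ _ := by gcongr; exact hbM k
      refine (le_of_mul_le_mul_left h5 (by positivity)).trans_eq ?_
      rw [show 2 * c * r = 2 * (c * r) by ring, mul_pow 2, one_div, inv_pow]
      field_simp
    refine (le_of_mul_le_mul_left h4 (by positivity)).trans ?_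
    gcongr
    refine le_add_of_le_of_nonneg ?_ (hv0 k)
    have : ((1 : ℝ) / 2) ^ q k ≤ (1 / 2) ^ k :=
      pow_le_pow_of_le_one (by norm_num) (by norm_num) hkq.le
    gcongr

namespace IsExpRep

variable {d : ℕ} {E : Type*} [NormedAddCommGroup E] [NormedSpace ℂ E]
  {π : Rd d → E →L[ℂ] E} {C κ : ℝ}

lemma axisOp_sum_symbol (h : IsExpRep π C κ) {F : ℕ → ℂ → ℂ} (hF : ∀ k, StripDecay (F k))
    (j : Fin d) (e : E) (n : ℕ) :
    axisOp π j (fun ζ => ∑ k ∈ Finset.range n, F k ζ) e =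
      ∑ k ∈ Finset.range n, axisOp π j (F k) e := by
  induction n with
  | zero =>
    simpa using axisOp_const_mul_symbol (π := π) (F := fun _ => 0) 0 j e
  | succ n ih =>
    simp only [Finset.sum_range_succ]
    rw [h.axisOp_add_symbol (StripDecay.sum hF n) (hF n), ih]

lemma uvBeuBdd_iff (h : IsExpRep π C κ) {M : ℕ → ℝ} {B : Set E} :
    UVBeuBdd d M π B ↔ (∀ e ∈ B, e ∈ smoothVec π) ∧ ∀ k : ℝ, 0 < k → ∃ A : ℝ,
      ∀ e ∈ B, ∀ α, k ^ msize α * ‖multiIter (infAct π) α e‖ ≤ A * M (msize α) := by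
  constructor
  · rintro ⟨h1, h2⟩
    refine ⟨fun e he => (h1 e he).1, fun k hk => ?_⟩
    obtain ⟨A, hA⟩ := h2 k hk
    exact ⟨A, fun e he α => by rw [← h.pD_orbit_zero (h1 e he).1]; exact hA e he α⟩
  · rintro ⟨h1, h2⟩
    have h3 : ∀ k : ℝ, 0 < k → ∃ A : ℝ, ∀ e ∈ B, ∀ α,
        k ^ msize α * ‖pD α (orbit π e) 0‖ ≤ A * M (msize α) := fun k hk => by
      obtain ⟨A, hA⟩ := h2 k hk
      exact ⟨A, fun e he α => by rw [h.pD_orbit_zero (h1 e he)]; exact hA e he α⟩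
    refine ⟨fun e he => ⟨h1 e he, fun k hk => ?_⟩, h3⟩
    obtain ⟨A, hA⟩ := h3 k hk
    exact ⟨A, hA e he⟩

variable [CompleteSpace E]

/-- If `∑ symb k` is reciprocal to `Q` in the sense of `SpectralPartition`, the associated series
of operators inverts the operator with symbol `Q`. -/
lemma axisOp_tsum_eq (h : IsExpRep π C κ) {M : ℕ → ℝ} {c ρ : ℝ} {l : ℕ → ℕ}
    (P : SpectralPartition M (κ + 1) c ρ l) (j : Fin d) {e : E} (he : e ∈ smoothVec π)
    (hsum : Summable fun k => axisOp π j (P.symb k) e)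
    (hlim : Tendsto (fun k => P.bnd k * ‖(infAct π j)^[P.deg k] e‖) atTop (nhds 0)) :
    axisOp π j P.Q (∑' k, axisOp π j (P.symb k) e) = e := by
  have hκ := h.κ_pos
  set v := ∑' k, axisOp π j (P.symb k) e with hv
  have key : ∀ {G : ℂ → ℂ}, StripDecay G → axisOp π j G (axisOp π j P.Q v) = axisOp π j G e := by
    intro G hG
    obtain ⟨T, hT⟩ := h.exists_axisOp_clm (hG.mul P.decay_Q) j
    obtain ⟨A, hA⟩ := hG.stripBound (κ + 1)
    have hA0 := hA.nonneg (by linarith)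
    have hR : ∀ K, StripDecay fun ζ => ζ ^ P.deg K * (P.rest K ζ * G ζ) := fun K =>
      ((P.bdd_rest K).mul_decay hG).pow_mul _
    have hRb : ∀ K, StripBound (κ + 1) (P.bnd K * A) fun ζ => P.rest K ζ * G ζ := fun K => by
      refine ⟨((P.bdd_rest K).mul_decay hG).1, fun ζ hζ => ?_⟩
      rw [norm_mul, mul_assoc]
      exact mul_le_mul (P.norm_rest_le K ζ hζ) (hA.2 ζ hζ) (by positivity)
        (P.bnd_nonneg (by linarith) K)
    have hS : ∀ k, StripDecay fun ζ => G ζ * P.Q ζ * P.symb k ζ := fun k =>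
      (hG.mul P.decay_Q).mul (P.stripDecay_symb k)
    have hpart : ∀ K, ∑ k ∈ Finset.range (K + 1), T (axisOp π j (P.symb k) e) =
        axisOp π j G e - axisOp π j (fun ζ => ζ ^ P.deg K * (P.rest K ζ * G ζ)) e := by
      intro K
      rw [eq_sub_iff_add_eq]
      have h1 : ∀ k, T (axisOp π j (P.symb k) e) =
          axisOp π j (fun ζ => G ζ * P.Q ζ * P.symb k ζ) e := fun k => by
        rw [hT, h.axisOp_axisOp (hG.mul P.decay_Q) (P.stripDecay_symb k)]
      simp only [h1]
      rw [← h.axisOp_sum_symbol hS, ← h.axisOp_add_symbol (StripDecay.sum hS _) (hR K)]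
      congr 1
      ext ζ
      have := P.sum_symb K ζ
      simp only [mul_assoc, ← Finset.mul_sum] at this ⊢
      rw [this]
      ring
    have hlim1 : Tendsto (fun K => ∑ k ∈ Finset.range (K + 1), T (axisOp π j (P.symb k) e)) atTop
        (nhds (T v)) := by
      have := (hsum.hasSum.mapL T).tendsto_sum_nat
      exact this.comp (tendsto_add_atTop_nat 1)
    have hlim2 : Tendsto (fun K => axisOp π j (fun ζ => ζ ^ P.deg K * (P.rest K ζ * G ζ)) e) atTop
        (nhds 0) := by
      refine squeeze_zero_norm (fun K => h.norm_axisOp_pow_mul_symbol_le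
        ((P.bdd_rest K).mul_decay hG) (hRb K) j (P.deg K) he) ?_
      have := hlim.const_mul (opConst C * A)
      rw [mul_zero] at this
      exact this.congr fun K => by ring
    simp only [hpart] at hlim1
    have hlim3 := tendsto_const_nhds (x := axisOp π j G e) (f := atTop (α := ℕ)) |>.sub hlim2
    rw [sub_zero] at hlim3
    rw [h.axisOp_axisOp hG P.decay_Q, ← hT]
    exact tendsto_nhds_unique hlim1 hlim3
  have h1 := h.tendsto_axisOp_dilate P.decay_Q j (axisOp π j P.Q v)
  have h2 := h.tendsto_axisOp_dilate P.decay_Q j e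
  have h3 : ∀ n : ℕ, StripDecay fun ζ => P.Q ((1 / ((n : ℝ) + 1) : ℝ) * ζ) := fun n =>
    P.decay_Q.dilate Nat.one_div_pos_of_nat
  simp only [key (h3 _)] at h1
  have h4 := tendsto_nhds_unique h1 h2
  exact smul_right_injective E P.Q_zero_ne h4

/-- Bounded sets of ultradifferentiable vectors factorize along each coordinate axis. -/
lemma exists_axis_factorization (h : IsExpRep π C κ) {M : ℕ → ℝ} (hM : IsWeightSeq M)
    (hM2 : M2 M) (h2s : M2star M) (j : Fin d) {B : Set E} (hB : UVBeuBdd d M π B) :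
    ∃ (Q : ℂ → ℂ) (v : E → E), StripDecay Q ∧ BeuLine M (fker Q) ∧ UVBeuBdd d M π (v '' B) ∧
      ∀ e ∈ B, axisOp π j Q (v e) = e := by
  have hκ := h.κ_pos
  rw [h.uvBeuBdd_iff] at hB
  obtain ⟨hsm, hbd⟩ := hB
  obtain ⟨c, ρ, hc, hρ, hP⟩ := exists_spectralPartition hM hM2 h2s (κ + 1)
  obtain ⟨C₀, H, h2⟩ := hM2
  obtain ⟨l, hl, hest⟩ := exists_summable_bound hM h2 hc hρ
    (fun (e : B) α => ‖multiIter (infAct π) α (e : E)‖)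
    (fun _ _ => norm_nonneg _) fun k hk => by
      obtain ⟨A, hA⟩ := hbd k hk
      exact ⟨A, fun e α => hA e e.2 α⟩
  obtain ⟨P⟩ := hP l hl
  have hest := hest P.bnd P.deg (P.bnd_nonneg (by linarith)) P.lt_deg P.bnd_mul_le j
  have hoc : 0 ≤ opConst C := h.opConst_nonneg
  obtain ⟨A₀, hA₀⟩ := P.decay_lead.stripBound (κ + 1)
  have hA₀0 := hA₀.nonneg (by linarith)
  choose T hT using fun k => h.exists_axisOp_clm (P.stripDecay_symb k) j
  have hTc : ∀ k x e, π x (T k e) = T k (π x e) := fun k x e => by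
    rw [hT, hT, h.apply_axisOp (P.stripDecay_symb k)]
  have hnorm : ∀ k, ∀ e ∈ B, ∀ α, ‖T (k + 1) (multiIter (infAct π) α e)‖ ≤
      opConst C * (P.bnd k * ‖multiIter (infAct π) (α + P.deg k • Pi.single j 1) e‖) := by
    intro k e he α
    rw [hT, h.stableSet.multiIter_add_nsmul_single j α (hsm e he), ← mul_assoc]
    exact h.norm_axisOp_pow_mul_symbol_le (P.decay_piece k) (P.bound_piece k) j _
      (multiIter_mem h.stableSet.mem α (hsm e he))
  have hbound : ∀ k : ℝ, 0 < k → ∃ u : ℕ → ℝ, Summable u ∧ ∀ i, ∀ e ∈ B, ∀ α,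
      k ^ msize α * ‖T i (multiIter (infAct π) α e)‖ ≤ u i * M (msize α) := by
    intro k hk
    obtain ⟨u, hu, hub⟩ := hest k hk
    obtain ⟨A, hA⟩ := hbd k hk
    refine ⟨fun i => Nat.casesOn i (opConst C * A₀ * A) fun i => opConst C * u i, ?_, ?_⟩
    · rw [← summable_nat_add_iff 1]
      exact hu.mul_left _
    · rintro (_ | i) e he α
      · have h1 : ‖T 0 (multiIter (infAct π) α e)‖ ≤
            opConst C * A₀ * ‖multiIter (infAct π) α e‖ := by
          rw [hT]; exact h.norm_axisOp_le hA₀ j _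
        calc _ ≤ k ^ msize α * (opConst C * A₀ * ‖multiIter (infAct π) α e‖) := by gcongr
          _ = opConst C * A₀ * (k ^ msize α * ‖multiIter (infAct π) α e‖) := by ring
          _ ≤ opConst C * A₀ * (A * M (msize α)) :=
              mul_le_mul_of_nonneg_left (hA e he α) (mul_nonneg hoc hA₀0)
          _ = opConst C * A₀ * A * M (msize α) := by ring
      · calc _ ≤ k ^ msize α * (opConst C *
              (P.bnd i * ‖multiIter (infAct π) (α + P.deg i • Pi.single j 1) e‖)) := by
              gcongr; exact hnorm i e he α
          _ = opConst C * (k ^ msize α *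
              (P.bnd i * ‖multiIter (infAct π) (α + P.deg i • Pi.single j 1) e‖)) := by ring
          _ ≤ opConst C * (u i * M (msize α)) := mul_le_mul_of_nonneg_left (hub i ⟨e, he⟩ α) hoc
          _ = opConst C * u i * M (msize α) := by ring
  have hsv : ∀ e ∈ B, e ∈ summableVec π T := fun e he => by
    obtain ⟨u, hu, hub⟩ := hbound 1 one_pos
    refine ⟨hsm e he, fun α => Summable.of_nonneg_of_le (fun i => norm_nonneg _) (fun i => ?_)
      (hu.mul_right (M (msize α)))⟩
    simpa using hub i e he α
  refine ⟨P.Q, fun e => ∑' k, T k e, P.decay_Q, P.beuLine_Q, ?_, fun e he => ?_⟩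
  · rw [h.uvBeuBdd_iff]
    refine ⟨?_, fun k hk => ?_⟩
    · rintro _ ⟨e, he, rfl⟩
      exact h.tsum_mem_smoothVec hTc (hsv e he)
    · obtain ⟨u, hu, hub⟩ := hbound k hk
      refine ⟨∑' i, u i, ?_⟩
      rintro _ ⟨e, he, rfl⟩ α
      rw [h.multiIter_tsum hTc (hsv e he)]
      have h1 := (hsv e he).2 α
      calc _ ≤ k ^ msize α * ∑' i, ‖T i (multiIter (infAct π) α e)‖ := by
            gcongr; exact norm_tsum_le_tsum_norm h1
        _ = ∑' i, k ^ msize α * ‖T i (multiIter (infAct π) α e)‖ := tsum_mul_left.symm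
        _ ≤ ∑' i, u i * M (msize α) :=
            Summable.tsum_le_tsum (fun i => hub i e he α) (h1.mul_left _) (hu.mul_right _)
        _ = _ := tsum_mul_right
  · have h1 : Summable fun k => axisOp π j (P.symb k) e := by
      have := (hsv e he).2 0
      simp only [multiIter_zero, hT] at this
      exact this.of_norm
    simp only [hT]
    refine h.axisOp_tsum_eq P j (hsm e he) h1 ?_
    obtain ⟨u, hu, hub⟩ := hest 1 one_pos
    refine squeeze_zero (fun k => mul_nonneg (P.bnd_nonneg (by linarith) k) (norm_nonneg _))
      (fun k => ?_) hu.tendsto_atTop_zero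
    have h2 := hub k ⟨e, he⟩ 0
    rw [h.stableSet.multiIter_add_nsmul_single j 0 (hsm e he), multiIter_zero] at h2
    simpa [msize, hM.2.1] using h2

end IsExpRep

/-! ### Tensor products of functions of one variable -/

/-- The tensor product of functions of one real variable. -/
def tensorFun {d : ℕ} (g : Fin d → ℝ → ℂ) (x : Rd d) : ℂ := ∏ i, g i (x i)

/-- Differentiation of the `j`-th factor of a family of functions. -/
def derivFactor {d : ℕ} (j : Fin d) (g : Fin d → ℝ → ℂ) : Fin d → ℝ → ℂ :=
  Function.update g j (deriv (g j))

lemma derivFactor_iterate {d : ℕ} (j : Fin d) (g : Fin d → ℝ → ℂ) (n : ℕ) :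
    (derivFactor j)^[n] g = Function.update g j (iteratedDeriv n (g j)) := by
  induction n with
  | zero => simp
  | succ n ih =>
    rw [Function.iterate_succ_apply', ih, derivFactor, iteratedDeriv_succ]
    simp

lemma foldr_derivFactor {d : ℕ} (α : Fin d → ℕ) (g : Fin d → ℝ → ℂ) (s : List (Fin d))
    (hs : s.Nodup) (i : Fin d) :
    s.foldr (fun j y => (derivFactor j)^[α j] y) g i =
      if i ∈ s then iteratedDeriv (α i) (g i) else g i := by
  induction s with
  | nil => simp
  | cons a s ih =>
    rw [List.nodup_cons] at hs
    have ih := ih hs.2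
    rw [List.foldr_cons, derivFactor_iterate]
    rcases eq_or_ne i a with rfl | hia
    · rw [if_neg hs.1] at ih
      simp [ih]
    · rw [Function.update_of_ne hia, ih]
      simp [hia]

lemma multiIter_derivFactor {d : ℕ} (α : Fin d → ℕ) (g : Fin d → ℝ → ℂ) :
    multiIter derivFactor α g = fun i => iteratedDeriv (α i) (g i) := by
  ext1 i
  have := foldr_derivFactor α g _ (List.nodup_finRange d) i
  rwa [if_pos (List.mem_finRange i)] at this

lemma contDiff_tensorFun {d : ℕ} {g : Fin d → ℝ → ℂ} (hg : ∀ i, ContDiff ℝ (⊤ : ℕ∞) (g i)) :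
    ContDiff ℝ (⊤ : ℕ∞) (tensorFun g) := by
  unfold tensorFun
  refine contDiff_prod fun i _ => (hg i).comp ?_
  fun_prop

lemma dop_tensorFun {d : ℕ} {g : Fin d → ℝ → ℂ} (hg : ∀ i, ContDiff ℝ (⊤ : ℕ∞) (g i))
    (j : Fin d) : dop j (tensorFun g) = tensorFun (derivFactor j g) := by
  ext x
  have h1 : ∀ i ∈ Finset.univ, HasFDerivAt (fun x : Rd d => g i (x i))
      ((ContinuousLinearMap.toSpanSingleton ℝ (deriv (g i) (x i))).comp
        (EuclideanSpace.proj i : Rd d →L[ℝ] ℝ)) x := fun i _ => by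
    have h2 : HasDerivAt (g i) (deriv (g i) (x i)) (x i) :=
      ((hg i).differentiable (by simp) _).hasDerivAt
    exact h2.hasFDerivAt.comp x (EuclideanSpace.proj i : Rd d →L[ℝ] ℝ).hasFDerivAt
  have h3 := HasFDerivAt.finsetProd h1
  rw [dop, show tensorFun g = fun x : Rd d => ∏ i, g i (x i) from rfl, h3.fderiv]
  simp only [_root_.sum_apply, _root_.smul_apply,
    ContinuousLinearMap.comp_apply, PiLp.proj_apply, PiLp.single_apply,
    ContinuousLinearMap.toSpanSingleton_apply]
  rw [Finset.sum_eq_single j (fun i _ hij => by simp [hij]) (by simp)]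
  rw [tensorFun, ← Finset.mul_prod_erase _ _ (Finset.mem_univ j)]
  simp only [derivFactor, Function.update_self, if_true, one_smul, smul_eq_mul]
  rw [mul_comm]
  congr 1
  refine Finset.prod_congr rfl fun i hi => ?_
  rw [Function.update_of_ne (Finset.ne_of_mem_erase hi)]

lemma pD_tensorFun {d : ℕ} {g : Fin d → ℝ → ℂ} (hg : ∀ i, ContDiff ℝ (⊤ : ℕ∞) (g i))
    (α : Fin d → ℕ) : pD α (tensorFun g) = tensorFun fun i => iteratedDeriv (α i) (g i) := by
  rw [pD_eq_multiIter, ← multiIter_derivFactor]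
  refine (multiIter_semiconj (S := {g : Fin d → ℝ → ℂ | ∀ i, ContDiff ℝ (⊤ : ℕ∞) (g i)}) ?_
    tensorFun ?_ α hg).symm
  · intro g hg j i
    rcases eq_or_ne i j with rfl | hij
    · simpa [derivFactor] using (contDiff_infty_iff_deriv.1 (hg i)).2
    · simpa [derivFactor, Function.update_of_ne hij] using hg i
  · exact fun g hg j => (dop_tensorFun hg j).symm

lemma norm_le_sum_abs {d : ℕ} (x : Rd d) : ‖x‖ ≤ ∑ i, |x i| := by
  conv_lhs => rw [sum_smul_bv x]
  refine (norm_sum_le _ _).trans (Finset.sum_le_sum fun i _ => ?_)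
  simp [norm_smul]

lemma BeuLine.kBeu_tensorFun {d : ℕ} {M : ℕ → ℝ} (hM : IsWeightSeq M) {g : Fin d → ℝ → ℂ}
    (hg : ∀ i, BeuLine M (g i)) : KBeu d M (tensorFun g) := by
  refine ⟨contDiff_tensorFun fun i => (hg i).1, fun k hk n => ?_⟩
  choose A hA using fun i => (hg i).2 k hk n
  have hA0 : ∀ i, 0 ≤ A i := fun i => by
    have h1 := hA i 0 0
    rw [hM.2.1, mul_one] at h1
    exact le_trans (by positivity) h1
  refine ⟨∏ i, A i, fun α x => ?_⟩
  rw [pD_tensorFun (fun i => (hg i).1), tensorFun, norm_prod, msize, ← Finset.prod_pow_eq_pow_sum]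
  calc _ ≤ (∏ i, k ^ α i) * (∏ i, ‖iteratedDeriv (α i) (g i) (x i)‖) *
        Real.exp (∑ i, n * |x i|) := by
        rw [← Finset.mul_sum]
        gcongr
        exact norm_le_sum_abs x
    _ = ∏ i, (k ^ α i * ‖iteratedDeriv (α i) (g i) (x i)‖ * Real.exp (n * |x i|)) := by
        rw [Real.exp_sum, Finset.prod_mul_distrib, Finset.prod_mul_distrib]
    _ ≤ ∏ i, (A i * M (α i)) :=
        Finset.prod_le_prod (fun i _ => by positivity) fun i _ => hA i (α i) (x i)
    _ = (∏ i, A i) * ∏ i, M (α i) := Finset.prod_mul_distrib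
    _ ≤ (∏ i, A i) * M (∑ i, α i) :=
        mul_le_mul_of_nonneg_left (weight_prod_le hM _ _) (Finset.prod_nonneg fun i _ => hA0 i)

lemma BeuLine.integrable {M : ℕ → ℝ} (hM : IsWeightSeq M) {ψ : ℝ → ℂ} (hψ : BeuLine M ψ) (κ : ℝ) :
    Integrable fun t : ℝ => ‖ψ t‖ * Real.exp (κ * |t|) := by
  obtain ⟨n, hn⟩ := exists_nat_ge (κ + 1)
  obtain ⟨A, hA⟩ := hψ.2 1 one_pos n
  have hc : Continuous ψ := hψ.1.continuous
  refine ((integrable_exp_neg_mul_abs (b := 1) one_pos).const_mul A).mono'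
    (by fun_prop) (Eventually.of_forall fun t => ?_)
  rw [Real.norm_of_nonneg (by positivity)]
  have h1 := hA 0 t
  simp only [pow_zero, one_mul, iteratedDeriv_zero, hM.2.1, mul_one] at h1
  calc _ ≤ ‖ψ t‖ * (Real.exp (n * |t|) * Real.exp (-(1 * |t|))) := by
        rw [← Real.exp_add]
        gcongr
        nlinarith [abs_nonneg t]
    _ = ‖ψ t‖ * Real.exp (n * |t|) * Real.exp (-(1 * |t|)) := by ring
    _ ≤ _ := by gcongr

namespace IsExpRep

variable {d : ℕ} {E : Type*} [NormedAddCommGroup E] [NormedSpace ℂ E]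
  {π : Rd d → E →L[ℂ] E} {C κ : ℝ}

lemma integrable_prod_smul (h : IsExpRep π C κ) {M : ℕ → ℝ} (hM : IsWeightSeq M) {n : ℕ}
    (c : Fin n → Fin d) {ψ : Fin n → ℝ → ℂ} (hψ : ∀ i, BeuLine M (ψ i)) (e : E) :
    Integrable fun x : Fin n → ℝ => (∏ i, ψ i (x i)) • π (∑ i, x i • bv (c i)) e := by
  have h1 : Integrable fun x : Fin n → ℝ => ∏ i, (‖ψ i (x i)‖ * Real.exp (κ * |x i|)) :=
    Integrable.fintype_prod fun i => (hψ i).integrable hM κ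
  have hc : ∀ i, Continuous (ψ i) := fun i => (hψ i).1.continuous
  have hc' : Continuous fun x : Fin n → ℝ => π (∑ i, x i • bv (c i)) e :=
    (h.continuous_orbit e).comp (by fun_prop)
  refine (h1.const_mul (C * ‖e‖)).mono'
    ((continuous_finsetProd _ fun i _ => (hc i).comp (continuous_apply i)).smul
      hc').aestronglyMeasurable (Eventually.of_forall fun x => ?_)
  have hC := h.C_pos
  have hκ := h.κ_pos
  have h2 : ‖∑ i, x i • (bv (c i) : Rd d)‖ ≤ ∑ i, |x i| :=
    (norm_sum_le _ _).trans (Finset.sum_le_sum fun i _ => by rw [norm_smul_bv])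
  rw [norm_smul, norm_prod, Finset.prod_mul_distrib, ← Real.exp_sum, ← Finset.mul_sum]
  calc _ ≤ (∏ i, ‖ψ i (x i)‖) * (C * Real.exp (κ * ∑ i, |x i|) * ‖e‖) := by
        refine mul_le_mul_of_nonneg_left ((h.growth _ e).trans ?_)
          (Finset.prod_nonneg fun i _ => norm_nonneg _)
        gcongr
    _ = _ := by ring

variable [CompleteSpace E]

lemma exists_multi_axis_factorization (h : IsExpRep π C κ) {M : ℕ → ℝ} (hM : IsWeightSeq M)
    (hM2 : M2 M) (h2s : M2star M) {n : ℕ} (c : Fin n → Fin d) {B : Set E}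
    (hB : UVBeuBdd d M π B) :
    ∃ (ψ : Fin n → ℝ → ℂ) (v : E → E), (∀ i, BeuLine M (ψ i)) ∧ UVBeuBdd d M π (v '' B) ∧
      ∀ e ∈ B, ∫ x : Fin n → ℝ, (∏ i, ψ i (x i)) • π (∑ i, x i • bv (c i)) (v e) = e := by
  induction n generalizing B with
  | zero =>
    refine ⟨Fin.elim0, id, fun i => i.elim0, by simpa using hB, fun e _ => ?_⟩
    simp [h.apply_zero, Measure.volume_pi_eq_dirac (0 : Fin 0 → ℝ)]
  | succ n ih =>
    obtain ⟨Q, u, hQ, hQM, hu, hQu⟩ := h.exists_axis_factorization hM hM2 h2s (c 0) hB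
    obtain ⟨ψ, w, hψ, hw, hψw⟩ := ih (fun i => c i.succ) hu
    have hψ' : ∀ i, BeuLine M ((Fin.cons (fker Q) ψ : Fin (n + 1) → ℝ → ℂ) i) :=
      Fin.cases hQM hψ
    refine ⟨Fin.cons (fker Q) ψ, fun e => w (u e), hψ', by rwa [Set.image_image] at hw,
      fun e he => ?_⟩
    have hint := h.integrable_prod_smul hM c hψ' (w (u e))
    have hmp := (volume_preserving_piFinSuccAbove (fun _ : Fin (n + 1) => ℝ) 0).symm
    rw [← hmp.integral_comp']
    have hint' := (hmp.integrable_comp_emb (MeasurableEquiv.measurableEmbedding _)).2 hint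
    have hform : ∀ p : ℝ × (Fin n → ℝ),
        (fun x : Fin (n + 1) → ℝ => (∏ i, (Fin.cons (fker Q) ψ : Fin (n + 1) → ℝ → ℂ) i (x i)) •
          π (∑ i, x i • bv (c i)) (w (u e)))
          ((MeasurableEquiv.piFinSuccAbove (fun _ : Fin (n + 1) => ℝ) 0).symm p) =
        fker Q p.1 • π (p.1 • bv (c 0))
          ((∏ i, ψ i (p.2 i)) • π (∑ i, p.2 i • bv (c i.succ)) (w (u e))) := by
      intro p
      simp [Fin.prod_univ_succ, Fin.sum_univ_succ, h.apply_add, mul_smul,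
        MeasurableEquiv.piFinSuccAbove]
    have hint'' := hint'.congr (Eventually.of_forall hform)
    refine (integral_congr_ae (Eventually.of_forall hform)).trans ?_
    refine (integral_prod _ hint'').trans ?_
    have h1 : ∀ t : ℝ, ∫ y : Fin n → ℝ, fker Q t • π (t • bv (c 0))
          ((∏ i, ψ i (y i)) • π (∑ i, y i • bv (c i.succ)) (w (u e))) =
        fker Q t • π (t • bv (c 0)) (u e) := fun t => by
      rw [integral_smul, ContinuousLinearMap.integral_comp_comm _
        (h.integrable_prod_smul hM (fun i => c i.succ) hψ _), hψw _ (Set.mem_image_of_mem u he)]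
    simp only [h1]
    exact hQu e he

/-- Bounded sets of ultradifferentiable vectors factorize. -/
lemma exists_factorization (h : IsExpRep π C κ) {M : ℕ → ℝ} (hM : IsWeightSeq M)
    (hM2 : M2 M) (h2s : M2star M) {B : Set E} (hB : UVBeuBdd d M π B) :
    ∃ (ψ : Rd d → ℂ) (v : E → E), KBeu d M ψ ∧ UVBeuBdd d M π (v '' B) ∧
      ∀ e ∈ B, PiOp π ψ (v e) = e := by
  obtain ⟨ψ, v, hψ, hv, hψv⟩ := h.exists_multi_axis_factorization hM hM2 h2s id hB
  refine ⟨tensorFun ψ, v, BeuLine.kBeu_tensorFun hM hψ, hv, fun e he => ?_⟩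
  have hmp := EuclideanSpace.volume_preserving_symm_measurableEquiv_toLp (Fin d)
  have h1 := hmp.integral_comp'
    fun x : Fin d → ℝ => (∏ i, ψ i (x i)) • π (∑ i, x i • bv i) (v e)
  rw [PiOp]
  refine Eq.trans ?_ (h1.trans (hψv e he))
  refine integral_congr_ae (Eventually.of_forall fun x => ?_)
  conv_lhs => rw [sum_smul_bv x]
  simp [tensorFun, Pi.single_apply]

end IsExpRep

/-! ### Smoothing by rapidly decaying kernels -/

lemma integrable_exp_neg_norm (d : ℕ) : Integrable fun x : Rd d => Real.exp (-‖x‖) := by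
  have h1 : Integrable fun x : Rd d => (1 + ‖x‖) ^ (-((d + 1 : ℕ) : ℝ)) :=
    integrable_one_add_norm (by simp)
  refine (h1.const_mul (Real.exp 1 * (d + 1).factorial)).mono' (by fun_prop)
    (Eventually.of_forall fun x => ?_)
  rw [Real.norm_of_nonneg (Real.exp_pos _).le, Real.rpow_neg (by positivity), Real.rpow_natCast,
    ← div_eq_mul_inv, le_div_iff₀ (by positivity)]
  have h2 := Real.pow_div_factorial_le_exp (1 + ‖x‖) (by positivity) (d + 1)
  rw [div_le_iff₀ (by positivity)] at h2
  calc _ ≤ Real.exp (-‖x‖) * (Real.exp (1 + ‖x‖) * (d + 1).factorial) := by gcongr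
    _ = Real.exp (-‖x‖ + (1 + ‖x‖)) * (d + 1).factorial := by rw [Real.exp_add (-‖x‖)]; ring
    _ = _ := by rw [neg_add_cancel_comm_assoc]

/-- Smooth functions all of whose derivatives decay faster than any exponential. -/
def rapidFun (d : ℕ) : Set (Rd d → ℂ) :=
  {f | ContDiff ℝ (⊤ : ℕ∞) f ∧ ∀ (α : Fin d → ℕ) (n : ℕ), ∃ A : ℝ, ∀ x,
    ‖pD α f x‖ * Real.exp (n * ‖x‖) ≤ A}

lemma dop_mem_rapidFun {d : ℕ} {f : Rd d → ℂ} (hf : f ∈ rapidFun d) (j : Fin d) :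
    dop j f ∈ rapidFun d := by
  refine ⟨contDiff_dop hf.1 j, fun α n => ?_⟩
  rw [pD_eq_multiIter, stableSet_dop.multiIter_apply j α hf.1]
  exact hf.2 _ n

lemma KBeu.mem_rapidFun {d : ℕ} {M : ℕ → ℝ} {f : Rd d → ℂ} (hf : KBeu d M f) :
    f ∈ rapidFun d := by
  refine ⟨hf.1, fun α n => ?_⟩
  obtain ⟨A, hA⟩ := hf.2 1 one_pos n
  exact ⟨A * M (msize α), fun x => by simpa using hA α x⟩

lemma norm_fderiv_le_sum_dop {d : ℕ} (f : Rd d → ℂ) (x : Rd d) :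
    ‖fderiv ℝ f x‖ ≤ ∑ j, ‖dop j f x‖ := by
  refine ContinuousLinearMap.opNorm_le_bound _ (Finset.sum_nonneg fun j _ => norm_nonneg _)
    fun y => ?_
  conv_lhs => rw [sum_smul_bv y]
  rw [map_sum, Finset.sum_mul]
  refine (norm_sum_le _ _).trans (Finset.sum_le_sum fun j _ => ?_)
  rw [map_smul, norm_smul, mul_comm]
  exact mul_le_mul_of_nonneg_left (PiLp.norm_apply_le y j) (norm_nonneg _)

lemma exists_norm_fderiv_le {d : ℕ} {f : Rd d → ℂ} (hf : f ∈ rapidFun d) (n : ℕ) :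
    ∃ A, ∀ x, ‖fderiv ℝ f x‖ * Real.exp (n * ‖x‖) ≤ A := by
  choose A hA using fun j => (dop_mem_rapidFun hf j).2 0 n
  refine ⟨∑ j, A j, fun x => ?_⟩
  calc _ ≤ (∑ j, ‖dop j f x‖) * Real.exp (n * ‖x‖) := by
        gcongr; exact norm_fderiv_le_sum_dop f x
    _ ≤ _ := by
        rw [Finset.sum_mul]
        refine Finset.sum_le_sum fun j _ => ?_
        simpa only [pD_eq_multiIter, multiIter_zero] using hA j x

namespace IsExpRep

variable {d : ℕ} {E : Type*} [NormedAddCommGroup E] [NormedSpace ℂ E]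
  {π : Rd d → E →L[ℂ] E} {C κ : ℝ}

lemma mul_norm_apply_le (h : IsExpRep π C κ) {n : ℕ} (hn : κ + 1 ≤ n) {a A : ℝ} {x : Rd d}
    (ha : 0 ≤ a) (hA : a * Real.exp (n * ‖x‖) ≤ A) (e : E) :
    a * ‖π x e‖ ≤ C * A * ‖e‖ * Real.exp (-‖x‖) := by
  have hC := h.C_pos
  calc a * ‖π x e‖ ≤ a * (C * (Real.exp (n * ‖x‖) * Real.exp (-‖x‖)) * ‖e‖) := by
        refine mul_le_mul_of_nonneg_left ((h.growth x e).trans ?_) ha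
        rw [← Real.exp_add]
        gcongr
        nlinarith [norm_nonneg x]
    _ = C * (a * Real.exp (n * ‖x‖)) * ‖e‖ * Real.exp (-‖x‖) := by ring
    _ ≤ _ := by gcongr

lemma integrable_smul_orbit (h : IsExpRep π C κ) {f : Rd d → ℂ} (hf : f ∈ rapidFun d) (e : E) :
    Integrable fun x => f x • π x e := by
  obtain ⟨n, hn⟩ := exists_nat_ge (κ + 1)
  obtain ⟨A, hA⟩ := hf.2 0 n
  simp only [pD_eq_multiIter, multiIter_zero] at hA
  refine ((integrable_exp_neg_norm d).const_mul (C * A * ‖e‖)).mono'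
    (hf.1.continuous.smul (h.continuous_orbit e)).aestronglyMeasurable
    (Eventually.of_forall fun x => ?_)
  rw [norm_smul]
  exact h.mul_norm_apply_le hn (norm_nonneg _) (hA x) e

variable [CompleteSpace E]

lemma norm_piOp_le (h : IsExpRep π C κ) {n : ℕ} (hn : κ + 1 ≤ n) {f : Rd d → ℂ} {A : ℝ}
    (hA : ∀ x, ‖f x‖ * Real.exp (n * ‖x‖) ≤ A) (e : E) :
    ‖PiOp π f e‖ ≤ C * A * ‖e‖ * ∫ x : Rd d, Real.exp (-‖x‖) := by
  rw [← integral_const_mul]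
  refine norm_integral_le_of_norm_le ((integrable_exp_neg_norm d).const_mul _)
    (Eventually.of_forall fun x => ?_)
  rw [norm_smul]
  exact h.mul_norm_apply_le hn (norm_nonneg _) (hA x) e

lemma orbit_piOp (h : IsExpRep π C κ) {f : Rd d → ℂ} (hf : f ∈ rapidFun d) (e : E) :
    orbit π (PiOp π f e) = fun y => ∫ x, f (x - y) • π x e := by
  ext y
  rw [orbit, PiOp, ← ContinuousLinearMap.integral_comp_comm _ (h.integrable_smul_orbit hf e),
    ← integral_add_right_eq_self (fun x => f (x - y) • π x e) y]
  simp [h.apply_add, h.comm y]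

lemma hasFDerivAt_orbit_piOp (h : IsExpRep π C κ) {f : Rd d → ℂ} (hf : f ∈ rapidFun d) (e : E) :
    ∃ L : Rd d →L[ℝ] E, HasFDerivAt (orbit π (PiOp π f e)) L 0 ∧
      ∀ j, L (bv j) = PiOp π (dop j f) (-e) := by
  obtain ⟨n, hn⟩ := exists_nat_ge (κ + 1)
  obtain ⟨A, hA⟩ := exists_norm_fderiv_le hf n
  have hfd : Continuous (fderiv ℝ f) := hf.1.continuous_fderiv (by simp)
  have hfc := hf.1.continuous
  have hπ : Continuous fun x => π x e := h.continuous_orbit e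
  let F' : Rd d → Rd d → Rd d →L[ℝ] E := fun y x => -(fderiv ℝ f (x - y)).smulRight (π x e)
  have hF'c : Continuous (F' 0) := by
    have h1 : Continuous fun x : Rd d => (fderiv ℝ f x).smulRight (π x e) := by
      rw [continuous_clm_apply]
      intro y
      exact (hfd.clm_apply continuous_const).smul hπ
    simpa only [F', sub_zero] using Continuous.fun_neg h1
  have hbound : ∀ x, ∀ y ∈ Metric.ball (0 : Rd d) 1,
      ‖F' y x‖ ≤ C * (A * Real.exp n) * ‖e‖ * Real.exp (-‖x‖) := by
    intro x y hy
    rw [mem_ball_zero_iff] at hy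
    rw [norm_neg]
    have h0 : ‖(fderiv ℝ f (x - y)).smulRight (π x e)‖ ≤ ‖fderiv ℝ f (x - y)‖ * ‖π x e‖ := by
      refine ContinuousLinearMap.opNorm_le_bound _ (by positivity) fun z => ?_
      rw [ContinuousLinearMap.smulRight_apply, norm_smul]
      calc _ ≤ ‖fderiv ℝ f (x - y)‖ * ‖z‖ * ‖π x e‖ := by
            gcongr; exact ContinuousLinearMap.le_opNorm _ _
        _ = _ := by ring
    refine h0.trans (h.mul_norm_apply_le hn (norm_nonneg _) ?_ e)
    have h1 : ‖x‖ ≤ ‖x - y‖ + 1 := by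
      have := norm_add_le (x - y) y
      rw [sub_add_cancel] at this
      linarith
    calc _ ≤ ‖fderiv ℝ f (x - y)‖ * Real.exp (n * (‖x - y‖ + 1)) := by gcongr
      _ = ‖fderiv ℝ f (x - y)‖ * Real.exp (n * ‖x - y‖) * Real.exp n := by
          rw [mul_add, mul_one, Real.exp_add]; ring
      _ ≤ _ := by gcongr; exact hA _
  have hbi : Integrable fun x : Rd d => C * (A * Real.exp n) * ‖e‖ * Real.exp (-‖x‖) :=
    (integrable_exp_neg_norm d).const_mul _
  have hderiv := hasFDerivAt_integral_of_dominated_of_fderiv_le (𝕜 := ℝ) (μ := volume)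
    (F := fun y x => f (x - y) • π x e) (F' := F') (x₀ := 0) (Metric.ball_mem_nhds 0 one_pos)
    (Eventually.of_forall fun y => Continuous.aestronglyMeasurable (by fun_prop))
    (by simpa using h.integrable_smul_orbit hf e) hF'c.aestronglyMeasurable
    (Eventually.of_forall hbound) hbi
    (Eventually.of_forall fun x y _ => by
      have h1 : HasFDerivAt (fun y : Rd d => x - y) (-ContinuousLinearMap.id ℝ (Rd d)) y :=
        (hasFDerivAt_id y).const_sub x
      have h2 : HasFDerivAt f (fderiv ℝ f (x - y)) (x - y) :=
        (hf.1.differentiable (by simp) _).hasFDerivAt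
      have h3 := (h2.comp y h1).smul_const (π x e)
      refine h3.congr_fderiv ?_
      ext z
      simp [F'])
  refine ⟨_, by rw [h.orbit_piOp hf e]; exact hderiv, fun j => ?_⟩
  have hint : Integrable (F' 0) := hbi.mono' hF'c.aestronglyMeasurable
    (Eventually.of_forall fun x => hbound x 0 (by simp))
  rw [ContinuousLinearMap.integral_apply hint, PiOp]
  refine integral_congr_ae (Eventually.of_forall fun x => ?_)
  simp [F', dop]

lemma piOp_mem_smoothVec (h : IsExpRep π C κ) {f : Rd d → ℂ} (hf : f ∈ rapidFun d) (e : E) :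
    PiOp π f e ∈ smoothVec π := by
  refine h.mem_smoothVec (W := {w | ∃ f ∈ rapidFun d, ∃ e, w = PiOp π f e}) ?_ ⟨f, hf, e, rfl⟩
  rintro _ ⟨f, hf, e, rfl⟩
  obtain ⟨L, hL, hLj⟩ := h.hasFDerivAt_orbit_piOp hf e
  exact ⟨L, hL, fun j => ⟨_, dop_mem_rapidFun hf j, -e, hLj j⟩⟩

lemma infAct_piOp (h : IsExpRep π C κ) {f : Rd d → ℂ} (hf : f ∈ rapidFun d) (e : E) (j : Fin d) :
    infAct π j (PiOp π f e) = PiOp π (dop j f) (-e) := by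
  obtain ⟨L, hL, hLj⟩ := h.hasFDerivAt_orbit_piOp hf e
  rw [infAct_eq hL, hLj]

lemma exists_multiIter_piOp (h : IsExpRep π C κ) {f : Rd d → ℂ} (hf : f ∈ rapidFun d) (e : E)
    (α : Fin d → ℕ) :
    ∃ e', ‖e'‖ = ‖e‖ ∧ multiIter (infAct π) α (PiOp π f e) = PiOp π (pD α f) e' := by
  let D : Fin d → (Rd d → ℂ) × E → (Rd d → ℂ) × E := fun j p => (dop j p.1, -p.2)
  let S : Set ((Rd d → ℂ) × E) := {p | p.1 ∈ rapidFun d ∧ ‖p.2‖ = ‖e‖}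
  have hS : ∀ p ∈ S, ∀ j, D j p ∈ S := fun p hp j =>
    ⟨dop_mem_rapidFun hp.1 j, (norm_neg _).trans hp.2⟩
  have hfe : (f, e) ∈ S := ⟨hf, rfl⟩
  refine ⟨(multiIter D α (f, e)).2, (multiIter_mem hS α hfe).2, ?_⟩
  rw [pD_eq_multiIter, ← multiIter_semiconj hS Prod.fst (fun _ _ _ => rfl) α hfe]
  exact (multiIter_semiconj hS (fun p => PiOp π p.1 p.2)
    (fun p hp j => (h.infAct_piOp hp.1 p.2 j).symm) α hfe).symm

lemma uvBeu_piOp (h : IsExpRep π C κ) {M : ℕ → ℝ} {f : Rd d → ℂ} (hf : KBeu d M f) (e : E) :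
    UVBeu d M π (PiOp π f e) := by
  have hsm := h.piOp_mem_smoothVec hf.mem_rapidFun e
  refine ⟨hsm, fun k hk => ?_⟩
  obtain ⟨n, hn⟩ := exists_nat_ge (κ + 1)
  obtain ⟨A, hA⟩ := hf.2 k hk n
  refine ⟨C * A * ‖e‖ * ∫ x : Rd d, Real.exp (-‖x‖), fun α => ?_⟩
  obtain ⟨e', he', heq⟩ := h.exists_multiIter_piOp hf.mem_rapidFun e α
  have hkα : 0 < k ^ msize α := by positivity
  have h1 := h.norm_piOp_le hn (f := pD α f) (A := A * M (msize α) / k ^ msize α)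
    (fun x => by
      rw [le_div_iff₀ hkα]
      calc _ = k ^ msize α * ‖pD α f x‖ * Real.exp (n * ‖x‖) := by ring
        _ ≤ _ := hA α x) e'
  rw [h.pD_orbit_zero hsm, heq]
  calc _ ≤ k ^ msize α * (C * (A * M (msize α) / k ^ msize α) * ‖e'‖ *
        ∫ x : Rd d, Real.exp (-‖x‖)) := by gcongr
    _ = _ := by rw [he']; field_simp

end IsExpRep

/-- Strong factorization theorem (Theorem 3.3) for Banach representations of `(ℝ^d,+)`,
Beurling case: `Π(𝒦^{(M)})E = Π(𝒦^{(M)})E^{(M)} = E^{(M)}`, with factorization of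
bounded sets. -/
theorem stmt14 (d : ℕ) (M : ℕ → ℝ) (hM : IsWeightSeq M) (hM2 : M2 M) (h2s : M2star M)
    {E : Type*} [NormedAddCommGroup E] [NormedSpace ℂ E] [CompleteSpace E]
    (π : Rd d → E →L[ℂ] E)
    (hπ0 : π 0 = ContinuousLinearMap.id ℂ E)
    (hπadd : ∀ x y : Rd d, π (x + y) = (π x).comp (π y))
    (hπcont : Continuous fun p : Rd d × E => π p.1 p.2)
    (C κ : ℝ) (hC : 0 < C) (hκ : 0 < κ)
    (hgrowth : ∀ (x : Rd d) (e : E), ‖π x e‖ ≤ C * Real.exp (κ * ‖x‖) * ‖e‖) :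
    ({v : E | ∃ f : Rd d → ℂ, KBeu d M f ∧ ∃ e : E, v = PiOp π f e} =
        {v : E | UVBeu d M π v}) ∧
    ({v : E | ∃ f : Rd d → ℂ, KBeu d M f ∧ ∃ e : E, UVBeu d M π e ∧ v = PiOp π f e} =
        {v : E | UVBeu d M π v}) ∧
    ∀ Bt : Set E, UVBeuBdd d M π Bt →
      ∃ ψ : Rd d → ℂ, KBeu d M ψ ∧
        ∃ At : Set E, UVBeuBdd d M π At ∧ (PiOp π ψ) '' At = Bt := by
  have h : IsExpRep π C κ := ⟨hπ0, hπadd, hπcont, hC, hκ, hgrowth⟩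
  have hfact : ∀ v, UVBeu d M π v →
      ∃ f : Rd d → ℂ, KBeu d M f ∧ ∃ e : E, UVBeu d M π e ∧ v = PiOp π f e := by
    intro v hv
    have hB : UVBeuBdd d M π {v} :=
      ⟨by simpa using hv, fun k hk => by simpa using hv.2 k hk⟩
    obtain ⟨ψ, w, hψ, hw, hψw⟩ := h.exists_factorization hM hM2 h2s hB
    exact ⟨ψ, hψ, w v, hw.1 _ (Set.mem_image_of_mem w rfl), (hψw v rfl).symm⟩
  refine ⟨?_, ?_, fun B hB => ?_⟩
  · ext v
    constructor
    · rintro ⟨f, hf, e, rfl⟩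
      exact h.uvBeu_piOp hf e
    · intro hv
      obtain ⟨f, hf, e, -, rfl⟩ := hfact v hv
      exact ⟨f, hf, e, rfl⟩
  · ext v
    constructor
    · rintro ⟨f, hf, e, -, rfl⟩
      exact h.uvBeu_piOp hf e
    · exact hfact v
  · obtain ⟨ψ, v, hψ, hv, hψv⟩ := h.exists_factorization hM hM2 h2s hB
    refine ⟨ψ, hψ, v '' B, hv, ?_⟩
    rw [Set.image_image, Set.image_congr hψv, Set.image_id']
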